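/- If G is a finitely presented group possessing a finite generating set S such that ω(G,S) < 2^{1/4}, then either G has deficiency at most 0 (that is, G admits no finite presentation with strictly more generators than relators), or G is isomorphic to ℤ, ℤ × ℤ, or the Klein bottle group, in which case ω(G,S) = 1. -/

import Mathlib

open Filter

/-- The set of elements of `G` expressible as a word of length at most `n`
in elements of `S` and their inverses. -/
def wordBall {G : Type*} [Group G] (S : Finset G) (n : ℕ) : Set G :=
  { g | ∃ l : List G, l.length ≤ n ∧ (∀ x ∈ l, x ∈ S ∨ x⁻¹ ∈ S) ∧ l.prod = g }

/-- `ω(G,S)`: the exponential growth rate of `G` with respect to the finite set `S`,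
i.e. the limit (= limsup, since the limit exists by submultiplicativity) of `γ_S(n)^(1/n)`. -/
noncomputable def growthRate {G : Type*} [Group G] (S : Finset G) : ℝ :=
  Filter.limsup (fun n : ℕ => ((wordBall S n).ncard : ℝ) ^ (1 / (n : ℝ))) Filter.atTop

/-- `ω(G)`: the growth constant of `G`, the infimum of `ω(G,S)` over all finite
generating sets `S` of `G`. -/
noncomputable def growthOmega (G : Type*) [Group G] : ℝ :=
  sInf { r : ℝ | ∃ S : Finset G, Subgroup.closure (S : Set G) = ⊤ ∧ growthRate S = r }
/-- The single relator `t a t⁻¹ a` of the Klein bottle group `⟨a, t | t a t⁻¹ = a⁻¹⟩`,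
with generator `0` playing the role of `a` and generator `1` the role of `t`. -/
def kleinBottleRels : Set (FreeGroup (Fin 2)) :=
  {FreeGroup.of 1 * FreeGroup.of 0 * (FreeGroup.of 1)⁻¹ * FreeGroup.of 0}

/-- The Klein bottle group `⟨a, t | t a t⁻¹ = a⁻¹⟩`. -/
abbrev KleinBottleGroup : Type := PresentedGroup kleinBottleRels
/-- A group is finitely presented if it is isomorphic to a presented group on finitely
many generators with finitely many relators. -/
def IsFinitelyPresented (G : Type*) [Group G] : Prop :=
  ∃ (n : ℕ) (rels : Finset (FreeGroup (Fin n))),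
    Nonempty (G ≃* PresentedGroup (rels : Set (FreeGroup (Fin n))))

/-- A group is coherent if every finitely generated subgroup is finitely presented. -/
def IsCoherent (G : Type*) [Group G] : Prop :=
  ∀ H : Subgroup G, H.FG → IsFinitelyPresented ↥H

namespace GW
open Filter Topology
open scoped InnerProductSpace

/-! ### The Hilbert space `ℓ²(Γ)^ι` and equivariant operators -/

abbrev Hil (Γ ι : Type*) := lp (fun _ : Γ × ι => ℝ) 2

open scoped Classical in
/-- standard basis vector -/
noncomputable def bs {Γ ι : Type*} (g : Γ) (i : ι) : Hil Γ ι := lp.single 2 (g, i) 1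

lemma inner_bs_left {Γ ι : Type*} (g : Γ) (i : ι) (f : Hil Γ ι) : ⟪bs g i, f⟫_ℝ = f (g, i) := by
  classical
  unfold bs
  rw [lp.inner_single_left]
  simp

lemma inner_bs_right {Γ ι : Type*} (g : Γ) (i : ι) (f : Hil Γ ι) : ⟪f, bs g i⟫_ℝ = f (g, i) := by
  rw [real_inner_comm, inner_bs_left]

open scoped Classical in
lemma bs_apply {Γ ι : Type*} (g : Γ) (i : ι) (p : Γ × ι) :
    (bs g i : Hil Γ ι) p = if p = (g, i) then 1 else 0 := by
  unfold bs
  rw [lp.single_apply, Pi.single_apply]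

lemma hasSum_parseval {Γ ι : Type*} (x y : Hil Γ ι) :
    HasSum (fun p : Γ × ι => x p * y p) ⟪x, y⟫_ℝ := by
  have := lp.hasSum_inner (𝕜 := ℝ) x y
  simpa [mul_comm] using this

lemma hil_ext {Γ ι : Type*} {x y : Hil Γ ι} (h : ∀ g i, x (g, i) = y (g, i)) : x = y := by
  apply lp.ext
  funext p
  exact h p.1 p.2

lemma clm_ext_bs {Γ ι : Type*} {A B : Hil Γ ι →L[ℝ] Hil Γ ι}
    (h : ∀ g i k j, A (bs g i) (k, j) = B (bs g i) (k, j)) : A = B := by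
  have key : A.adjoint = B.adjoint := by
    ext1 x
    apply hil_ext
    intro g i
    rw [← inner_bs_left, ← inner_bs_left, ContinuousLinearMap.adjoint_inner_right,
      ContinuousLinearMap.adjoint_inner_right]
    congr 1
    exact hil_ext fun k j => h g i k j
  have := congrArg ContinuousLinearMap.adjoint key
  simpa using this

section
variable {Γ ι : Type*} [Group Γ]

/-- equivariance, via matrix coefficients -/
def Eqv (A : Hil Γ ι →L[ℝ] Hil Γ ι) : Prop :=
  ∀ (g x : Γ) (i : ι) (y : Γ) (j : ι), A (bs (g * y) j) (g * x, i) = A (bs y j) (x, i)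

lemma Eqv.add {A B : Hil Γ ι →L[ℝ] Hil Γ ι} (hA : Eqv A) (hB : Eqv B) : Eqv (A + B) := by
  intro g x i y j
  simp [hA g x i y j, hB g x i y j]

lemma Eqv.sub {A B : Hil Γ ι →L[ℝ] Hil Γ ι} (hA : Eqv A) (hB : Eqv B) : Eqv (A - B) := by
  intro g x i y j
  simp [hA g x i y j, hB g x i y j]

lemma Eqv.smul {A : Hil Γ ι →L[ℝ] Hil Γ ι} (hA : Eqv A) (c : ℝ) : Eqv (c • A) := by
  intro g x i y j
  simp [hA g x i y j]

lemma eqv_one : Eqv (1 : Hil Γ ι →L[ℝ] Hil Γ ι) := by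
  intro g x i y j
  have h : ((g * x, i) = (g * y, j)) ↔ ((x, i) = (y, j)) := by simp
  simp only [one_apply_eq_self, bs_apply]
  by_cases h' : (x, i) = (y, j)
  · rw [if_pos h', if_pos (h.2 h')]
  · rw [if_neg h', if_neg fun h'' => h' (h.1 h'')]

lemma eqv_zero : Eqv (0 : Hil Γ ι →L[ℝ] Hil Γ ι) := by
  intro g x i y j
  simp

lemma Eqv.adjoint {A : Hil Γ ι →L[ℝ] Hil Γ ι} (hA : Eqv A) : Eqv A.adjoint := by
  intro g x i y j
  rw [← inner_bs_left, ← inner_bs_left, ContinuousLinearMap.adjoint_inner_right,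
    ContinuousLinearMap.adjoint_inner_right, inner_bs_right, inner_bs_right]
  exact hA g y j x i

lemma adjoint_coeff (A : Hil Γ ι →L[ℝ] Hil Γ ι) (x y : Γ) (i j : ι) :
    A.adjoint (bs x i) (y, j) = A (bs y j) (x, i) := by
  rw [← inner_bs_left, ContinuousLinearMap.adjoint_inner_right, inner_bs_right]

lemma hasSum_mul_coeff (A B : Hil Γ ι →L[ℝ] Hil Γ ι) (x y : Γ) (i j : ι) :
    HasSum (fun p : Γ × ι => A (bs p.1 p.2) (x, i) * B (bs y j) p) ((A * B) (bs y j) (x, i)) := by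
  have h := hasSum_parseval (A.adjoint (bs x i)) (B (bs y j))
  rw [ContinuousLinearMap.adjoint_inner_left, inner_bs_left] at h
  refine h.congr_fun ?_ |> id
  rintro ⟨g, k⟩
  rw [adjoint_coeff]

lemma Eqv.mul {A B : Hil Γ ι →L[ℝ] Hil Γ ι} (hA : Eqv A) (hB : Eqv B) : Eqv (A * B) := by
  intro g x i y j
  have h1 := hasSum_mul_coeff A B (g * x) (g * y) i j
  have h2 := hasSum_mul_coeff A B x y i j
  let e : Γ × ι ≃ Γ × ι := (Equiv.mulLeft g).prodCongr (Equiv.refl ι)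
  have h3 := (e.hasSum_iff).2 h1
  refine h3.unique ?_
  convert h2 using 2 with p
  obtain ⟨k, l⟩ := p
  simp only [Function.comp, e, Equiv.prodCongr_apply, Prod.map, Equiv.coe_mulLeft, Equiv.refl_apply]
  rw [hA, hB]

lemma Eqv.pow {A : Hil Γ ι →L[ℝ] Hil Γ ι} (hA : Eqv A) (k : ℕ) : Eqv (A ^ k) := by
  induction k with
  | zero => exact eqv_one
  | succ k ih => rw [pow_succ]; exact ih.mul hA

lemma eqv_sum {α : Type*} (s : Finset α) (A : α → Hil Γ ι →L[ℝ] Hil Γ ι) (h : ∀ a ∈ s, Eqv (A a)) :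
    Eqv (∑ a ∈ s, A a) := by
  classical
  induction s using Finset.induction_on with
  | empty => simpa using eqv_zero
  | insert a s ha ih =>
    rw [Finset.sum_insert ha]
    exact (h a (by simp)).add (ih fun b hb => h b (by simp [hb]))

variable [Fintype ι]

/-- the von Neumann trace -/
noncomputable def tr (A : Hil Γ ι →L[ℝ] Hil Γ ι) : ℝ := ∑ i, A (bs 1 i) (1, i)

lemma tr_add (A B : Hil Γ ι →L[ℝ] Hil Γ ι) : tr (A + B) = tr A + tr B := by
  simp [tr, Finset.sum_add_distrib]

lemma tr_sub (A B : Hil Γ ι →L[ℝ] Hil Γ ι) : tr (A - B) = tr A - tr B := by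
  simp [tr, Finset.sum_sub_distrib]

lemma tr_smul (c : ℝ) (A : Hil Γ ι →L[ℝ] Hil Γ ι) : tr (c • A) = c * tr A := by
  simp [tr, Finset.mul_sum]

lemma tr_zero : tr (0 : Hil Γ ι →L[ℝ] Hil Γ ι) = 0 := by
  simp [tr]

lemma tr_one : tr (1 : Hil Γ ι →L[ℝ] Hil Γ ι) = Fintype.card ι := by
  simp [tr, bs_apply]

lemma tr_sum {α : Type*} (s : Finset α) (A : α → Hil Γ ι →L[ℝ] Hil Γ ι) :
    tr (∑ a ∈ s, A a) = ∑ a ∈ s, tr (A a) := by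
  classical
  induction s using Finset.induction_on with
  | empty => simp [tr_zero]
  | insert a s ha ih => rw [Finset.sum_insert ha, tr_add, ih, Finset.sum_insert ha]

lemma tr_adjoint (A : Hil Γ ι →L[ℝ] Hil Γ ι) : tr A.adjoint = tr A := by
  simp [tr, adjoint_coeff]

lemma hasSum_tr_mul (A B : Hil Γ ι →L[ℝ] Hil Γ ι) :
    HasSum (fun g : Γ => ∑ j, ∑ i, A (bs g j) (1, i) * B (bs 1 i) (g, j)) (tr (A * B)) := by
  have h : HasSum (fun p : Γ × ι => ∑ i, A (bs p.1 p.2) (1, i) * B (bs 1 i) p) (tr (A * B)) :=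
    hasSum_sum fun i _ => hasSum_mul_coeff A B 1 1 i i
  exact h.prod_fiberwise fun g => hasSum_fintype _

lemma tr_mul_comm {A B : Hil Γ ι →L[ℝ] Hil Γ ι} (hA : Eqv A) (hB : Eqv B) :
    tr (A * B) = tr (B * A) := by
  have h1 := hasSum_tr_mul A B
  have h2 := ((Equiv.inv Γ).hasSum_iff).2 (hasSum_tr_mul B A)
  refine h1.unique ?_
  convert h2 using 2 with g
  simp only [Function.comp, Equiv.inv_apply]
  rw [Finset.sum_comm]
  refine Finset.sum_congr rfl fun i _ => Finset.sum_congr rfl fun j _ => ?_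
  have e1 := hA g g⁻¹ i 1 j
  have e2 := hB g 1 j g⁻¹ i
  simp only [mul_inv_cancel, mul_one] at e1 e2
  rw [e1, e2, mul_comm]

lemma tr_mul_adjoint_nonneg (A : Hil Γ ι →L[ℝ] Hil Γ ι) : 0 ≤ tr (A.adjoint * A) := by
  unfold tr
  refine Finset.sum_nonneg fun i _ => ?_
  rw [← inner_bs_left, mul_apply_eq_comp, ContinuousLinearMap.adjoint_inner_right]
  exact real_inner_self_nonneg

lemma eq_zero_of_tr_adjoint_mul {A : Hil Γ ι →L[ℝ] Hil Γ ι} (hA : Eqv A)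
    (h : tr (A.adjoint * A) = 0) : A = 0 := by
  unfold tr at h
  rw [Finset.sum_eq_zero_iff_of_nonneg] at h
  · apply clm_ext_bs
    intro g i k j
    have h1 := h i (Finset.mem_univ _)
    rw [← inner_bs_left, mul_apply_eq_comp,
      ContinuousLinearMap.adjoint_inner_right, inner_self_eq_zero] at h1
    have := hA g (g⁻¹ * k) j 1 i
    simp only [mul_one, mul_inv_cancel_left] at this
    rw [this, h1]
    simp
  · intro i _
    rw [← inner_bs_left, mul_apply_eq_comp, ContinuousLinearMap.adjoint_inner_right]
    exact real_inner_self_nonneg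

/-! kernel projections -/

/-- orthogonal projection onto the kernel -/
noncomputable def kp (A : Hil Γ ι →L[ℝ] Hil Γ ι) : Hil Γ ι →L[ℝ] Hil Γ ι :=
  (LinearMap.ker A.toLinearMap).starProjection

lemma kp_ker (A : Hil Γ ι →L[ℝ] Hil Γ ι) (x) : A (kp A x) = 0 := by
  have : kp A x ∈ LinearMap.ker A.toLinearMap := Submodule.starProjection_apply_mem _ x
  simpa using this

lemma mul_kp (A : Hil Γ ι →L[ℝ] Hil Γ ι) : A * kp A = 0 := by
  ext1 x
  exact kp_ker A x

lemma kp_of_ker {A : Hil Γ ι →L[ℝ] Hil Γ ι} {x} (h : A x = 0) : kp A x = x :=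
  Submodule.starProjection_eq_self_iff.2 (by simpa using h)

lemma kp_eq_self_iff {A : Hil Γ ι →L[ℝ] Hil Γ ι} {x} : kp A x = x ↔ A x = 0 :=
  ⟨fun h => by rw [← h]; exact kp_ker A x, kp_of_ker⟩

lemma kp_adjoint (A : Hil Γ ι →L[ℝ] Hil Γ ι) : (kp A).adjoint = kp A := by
  exact (isSelfAdjoint_starProjection _)

lemma kp_inner (A : Hil Γ ι →L[ℝ] Hil Γ ι) (x y) : ⟪kp A x, y⟫_ℝ = ⟪x, kp A y⟫_ℝ := by
  conv_lhs => rw [← kp_adjoint A]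
  rw [ContinuousLinearMap.adjoint_inner_left]

lemma kp_mul_kp {A B : Hil Γ ι →L[ℝ] Hil Γ ι} (h : ∀ x, A x = 0 → B x = 0) :
    kp B * kp A = kp A := by
  ext1 x
  exact kp_of_ker (h _ (kp_ker A x))

lemma kp_mul_kp' {A B : Hil Γ ι →L[ℝ] Hil Γ ι} (h : ∀ x, A x = 0 → B x = 0) :
    kp A * kp B = kp A := by
  have := congrArg ContinuousLinearMap.adjoint (kp_mul_kp h)
  rw [ContinuousLinearMap.mul_def, ContinuousLinearMap.adjoint_comp, kp_adjoint, kp_adjoint] at this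
  exact this

/-- the contraction used for the mean ergodic theorem -/
noncomputable def ctr (A : Hil Γ ι →L[ℝ] Hil Γ ι) : Hil Γ ι →L[ℝ] Hil Γ ι :=
  1 - (1 / (‖A‖ ^ 2 + 1)) • (A.adjoint * A)

lemma ctr_norm (A : Hil Γ ι →L[ℝ] Hil Γ ι) : ‖ctr A‖ ≤ 1 := by
  refine ContinuousLinearMap.opNorm_le_bound _ zero_le_one fun x => ?_
  rw [one_mul]
  refine le_of_sq_le_sq ?_ (norm_nonneg _) |> id
  have e : ctr A x = x - (1 / (‖A‖ ^ 2 + 1)) • A.adjoint (A x) := by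
    simp [ctr, mul_apply_eq_comp]
  rw [e, norm_sub_sq_real, inner_smul_right, ContinuousLinearMap.adjoint_inner_right,
    real_inner_self_eq_norm_sq, norm_smul]
  set c := 1 / (‖A‖ ^ 2 + 1) with hc
  have hcpos : 0 < c := by positivity
  have h1 : ‖A.adjoint (A x)‖ ≤ ‖A‖ * ‖A x‖ := by
    have := A.adjoint.le_opNorm (A x)
    rwa [LinearIsometryEquiv.norm_map] at this
  have hcA : c * ‖A‖ ^ 2 ≤ 1 := by
    rw [hc, one_div, inv_mul_le_iff₀ (by positivity)]
    linarith
  have h2 : (‖c‖ * ‖A.adjoint (A x)‖) ^ 2 ≤ c * ‖A x‖ ^ 2 := by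
    rw [Real.norm_of_nonneg hcpos.le]
    have : (c * ‖A.adjoint (A x)‖) ^ 2 ≤ (c * (‖A‖ * ‖A x‖)) ^ 2 := by gcongr
    refine this.trans ?_
    have : (c * (‖A‖ * ‖A x‖)) ^ 2 = (c * ‖A‖ ^ 2) * (c * ‖A x‖ ^ 2) := by ring
    rw [this]
    exact mul_le_of_le_one_left (by positivity) hcA
  have h3 : 0 ≤ c * ‖A x‖ ^ 2 := by positivity
  linarith

lemma Eqv.ctr {A : Hil Γ ι →L[ℝ] Hil Γ ι} (hA : Eqv A) : Eqv (ctr A) :=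
  eqv_one.sub ((hA.adjoint.mul hA).smul _)

lemma ctr_fix (A : Hil Γ ι →L[ℝ] Hil Γ ι) (x) : ctr A x = x ↔ A x = 0 := by
  have e : ctr A x = x - (1 / (‖A‖ ^ 2 + 1)) • A.adjoint (A x) := by
    simp [ctr, mul_apply_eq_comp]
  rw [e]
  have hc : (1 / (‖A‖ ^ 2 + 1)) ≠ 0 := by positivity
  constructor
  · intro h
    have h1 : A.adjoint (A x) = 0 := by
      have := sub_eq_self.1 h
      exact (smul_eq_zero.1 this).resolve_left hc
    have h2 : ⟪A x, A x⟫_ℝ = 0 := by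
      rw [← ContinuousLinearMap.adjoint_inner_left, h1, inner_zero_left]
    exact inner_self_eq_zero.1 h2
  · intro h
    rw [h]; simp

lemma ctr_tendsto (A : Hil Γ ι →L[ℝ] Hil Γ ι) (x) :
    Tendsto (fun n => birkhoffAverage ℝ (ctr A) id n x) atTop (𝓝 (kp A x)) := by
  have h := (ctr A).tendsto_birkhoffAverage_orthogonalProjection (ctr_norm A) x
  have hk : (LinearMap.eqLocus (ctr A).toLinearMap (1 : Hil Γ ι →L[ℝ] Hil Γ ι).toLinearMap) = LinearMap.ker A.toLinearMap := by
    ext y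
    rw [LinearMap.mem_eqLocus, LinearMap.mem_ker]
    exact ctr_fix A y
  convert h using 2
  unfold kp
  rw [← Submodule.starProjection_apply]
  congr 2
  exact hk.symm

/-- averages of powers -/
noncomputable def avg (B : Hil Γ ι →L[ℝ] Hil Γ ι) (n : ℕ) : Hil Γ ι →L[ℝ] Hil Γ ι :=
  (n : ℝ)⁻¹ • ∑ k ∈ Finset.range n, B ^ k

lemma avg_eq (B : Hil Γ ι →L[ℝ] Hil Γ ι) (n : ℕ) (x) : birkhoffAverage ℝ B id n x = avg B n x := by
  unfold birkhoffAverage birkhoffSum avg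
  simp only [id, smul_apply, FunLike.coe_sum, Finset.sum_apply]
  congr 1
  refine Finset.sum_congr rfl fun k hk => ?_
  clear hk
  induction k with
  | zero => simp
  | succ k ih => rw [Function.iterate_succ_apply', pow_succ', mul_apply_eq_comp, ih]

lemma tendsto_coeff (A : Hil Γ ι →L[ℝ] Hil Γ ι) (x : Γ) (i : ι) (y) :
    Tendsto (fun n => avg (ctr A) n y (x, i)) atTop (𝓝 (kp A y (x, i))) := by
  simp only [← inner_bs_left, ← avg_eq]
  exact tendsto_const_nhds.inner (ctr_tendsto A y)

lemma Eqv.kp {A : Hil Γ ι →L[ℝ] Hil Γ ι} (hA : Eqv A) : Eqv (kp A) := by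
  intro g x i y j
  refine tendsto_nhds_unique (tendsto_coeff A _ _ _) ?_
  refine (tendsto_coeff A x i (bs y j)).congr fun n => ?_
  exact ((eqv_sum _ _ fun k _ => hA.ctr.pow k).smul _ g x i y j).symm

/-- von Neumann nullity -/
noncomputable def nul (A : Hil Γ ι →L[ℝ] Hil Γ ι) : ℝ := tr (kp A)

lemma tendsto_tr_avg (A : Hil Γ ι →L[ℝ] Hil Γ ι) :
    Tendsto (fun n => tr (avg (ctr A) n)) atTop (𝓝 (nul A)) :=
  tendsto_finsetSum _ fun i _ => tendsto_coeff A 1 i (bs 1 i)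

lemma ctr_adjoint_mul (A : Hil Γ ι →L[ℝ] Hil Γ ι) : ctr A.adjoint * A = A * ctr A := by
  unfold ctr
  rw [LinearIsometryEquiv.norm_map, ContinuousLinearMap.adjoint_adjoint, sub_mul, mul_sub,
    smul_mul_assoc, mul_smul_comm, one_mul, mul_one, mul_assoc]

lemma ctr_adjoint_pow_mul (A : Hil Γ ι →L[ℝ] Hil Γ ι) (k : ℕ) :
    ctr A.adjoint ^ k * A = A * ctr A ^ k := by
  induction k with
  | zero => simp
  | succ k ih => rw [pow_succ, mul_assoc, ctr_adjoint_mul, ← mul_assoc, ih, mul_assoc, ← pow_succ]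

lemma tr_ctr_pow {A : Hil Γ ι →L[ℝ] Hil Γ ι} (hA : Eqv A) (k : ℕ) :
    tr (ctr A.adjoint ^ k) = tr (ctr A ^ k) := by
  induction k with
  | zero => simp
  | succ k ih =>
    have e1 : ctr A.adjoint ^ (k + 1) = ctr A.adjoint ^ k
        - (1 / (‖A‖ ^ 2 + 1)) • (ctr A.adjoint ^ k * A * A.adjoint) := by
      rw [pow_succ]
      conv_lhs => rw [show ctr A.adjoint = 1 - (1 / (‖A‖ ^ 2 + 1)) • (A * A.adjoint) from by
        unfold ctr; rw [LinearIsometryEquiv.norm_map, ContinuousLinearMap.adjoint_adjoint]]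
      rw [show (1 - (1 / (‖A‖ ^ 2 + 1)) • (A * A.adjoint)) = ctr A.adjoint from by
        unfold ctr; rw [LinearIsometryEquiv.norm_map, ContinuousLinearMap.adjoint_adjoint]]
      conv_lhs => rw [show ctr A.adjoint ^ k * ctr A.adjoint = ctr A.adjoint ^ k *
        (1 - (1 / (‖A‖ ^ 2 + 1)) • (A * A.adjoint)) from by
          congr 1; unfold ctr
          rw [LinearIsometryEquiv.norm_map, ContinuousLinearMap.adjoint_adjoint]]
      rw [mul_sub, mul_one, mul_smul_comm, mul_assoc]
    have e2 : ctr A ^ (k + 1) = ctr A ^ k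
        - (1 / (‖A‖ ^ 2 + 1)) • (A.adjoint * A * ctr A ^ k) := by
      rw [pow_succ']
      conv_lhs => rw [show ctr A * ctr A ^ k =
        (1 - (1 / (‖A‖ ^ 2 + 1)) • (A.adjoint * A)) * ctr A ^ k from rfl]
      rw [sub_mul, one_mul, smul_mul_assoc]
    rw [e1, e2, tr_sub, tr_sub, tr_smul, tr_smul, ih, ctr_adjoint_pow_mul,
      tr_mul_comm (hA.mul (hA.ctr.pow k)) hA.adjoint, mul_assoc]

/-- N1 -/
lemma nul_adjoint {A : Hil Γ ι →L[ℝ] Hil Γ ι} (hA : Eqv A) : nul A.adjoint = nul A := by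
  refine tendsto_nhds_unique (tendsto_tr_avg _) ((tendsto_tr_avg A).congr fun n => ?_)
  unfold avg
  rw [tr_smul, tr_smul, tr_sum, tr_sum]
  simp only [tr_ctr_pow hA]

end
end GW

namespace GW
open Filter Topology
open scoped InnerProductSpace

section
variable {Γ ι : Type*} [Group Γ] [Fintype ι]

lemma kp_congr {A B : Hil Γ ι →L[ℝ] Hil Γ ι} (h : ∀ x, A x = 0 ↔ B x = 0) : kp A = kp B := by
  exact (kp_mul_kp fun x => (h x).1).symm.trans (kp_mul_kp' fun x => (h x).2)

lemma nul_congr {A B : Hil Γ ι →L[ℝ] Hil Γ ι} (h : ∀ x, A x = 0 ↔ B x = 0) : nul A = nul B := by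
  unfold nul
  rw [kp_congr h]

lemma nul_sub_eq {A B : Hil Γ ι →L[ℝ] Hil Γ ι} (h : ∀ x, A x = 0 → B x = 0) :
    nul B - nul A = tr ((kp B - kp A).adjoint * (kp B - kp A)) := by
  unfold nul
  rw [← tr_sub, map_sub, kp_adjoint, kp_adjoint, sub_mul, mul_sub, mul_sub, kp_mul_kp h,
    kp_mul_kp' h, kp_mul_kp fun x h => h, kp_mul_kp fun x h => h]
  congr 1
  abel

/-- N2 -/
lemma nul_mono {A B : Hil Γ ι →L[ℝ] Hil Γ ι} (h : ∀ x, A x = 0 → B x = 0) : nul A ≤ nul B := by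
  have := nul_sub_eq h
  have := tr_mul_adjoint_nonneg (kp B - kp A)
  linarith

lemma ker_of_nul_eq {A B : Hil Γ ι →L[ℝ] Hil Γ ι} (hA : Eqv A) (hB : Eqv B)
    (h : ∀ x, A x = 0 → B x = 0) (hn : nul B ≤ nul A) : ∀ x, B x = 0 → A x = 0 := by
  have h1 := nul_sub_eq h
  have h2 := tr_mul_adjoint_nonneg (kp B - kp A)
  have h3 : kp B - kp A = 0 := eq_zero_of_tr_adjoint_mul (hB.kp.sub hA.kp) (by linarith)
  intro x hx
  rw [← kp_eq_self_iff, ← sub_eq_zero.1 h3]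
  exact kp_of_ker hx

/-- N3 -/
lemma nul_idem {E : Hil Γ ι →L[ℝ] Hil Γ ι} (hE : Eqv E) (h : E * E = E) :
    nul E = Fintype.card ι - tr E := by
  have h1 : kp E * (1 - E) = 1 - E := by
    ext1 x
    apply kp_of_ker
    change (E * (1 - E)) x = 0
    rw [mul_sub, mul_one, h, sub_self]
    rfl
  have h2 : (1 - E) * kp E = kp E := by
    rw [sub_mul, one_mul, mul_kp, sub_zero]
  have h3 := tr_mul_comm hE.kp (eqv_one.sub hE)
  rw [h1, h2, tr_sub, tr_one] at h3
  exact h3.symm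

lemma nul_kp {A : Hil Γ ι →L[ℝ] Hil Γ ι} (hA : Eqv A) : nul (kp A) = Fintype.card ι - nul A :=
  nul_idem hA.kp (kp_mul_kp fun _ h => h)

lemma nul_zero : nul (0 : Hil Γ ι →L[ℝ] Hil Γ ι) = Fintype.card ι := by
  rw [nul_idem eqv_zero (by simp), tr_zero, sub_zero]

lemma idem_eq_zero {E : Hil Γ ι →L[ℝ] Hil Γ ι} (hE : Eqv E) (h : E * E = E) (ht : tr E = 0) :
    E = 0 := by
  have := ker_of_nul_eq hE eqv_zero (fun x _ => by simp) (by rw [nul_zero, nul_idem hE h, ht, sub_zero])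
  ext1 x
  exact this x (by simp)

lemma adjoint_mul' (A B : Hil Γ ι →L[ℝ] Hil Γ ι) : (A * B).adjoint = B.adjoint * A.adjoint := by
  rw [ContinuousLinearMap.mul_def, ContinuousLinearMap.adjoint_comp]
  rfl

/-- N4 -/
lemma nul_add_le {T S : Hil Γ ι →L[ℝ] Hil Γ ι} (hT : Eqv T) (hS : Eqv S)
    (h : ∀ x, T x = 0 → S x = 0 → x = 0) : nul T + nul S ≤ Fintype.card ι := by
  have h1 : nul (S * kp T) = Fintype.card ι - nul T := by
    rw [← nul_kp hT]
    refine nul_congr fun x => ?_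
    rw [mul_apply_eq_comp]
    constructor
    · intro hx
      exact h _ (kp_ker T x) hx
    · intro hx
      rw [hx, map_zero]
  have h2 : nul S.adjoint ≤ nul (S * kp T).adjoint := by
    refine nul_mono fun x hx => ?_
    rw [adjoint_mul', mul_apply_eq_comp, hx, map_zero]
  rw [nul_adjoint hS, nul_adjoint (hS.mul hT.kp), h1] at h2
  linarith

lemma tr_eq_at {A : Hil Γ ι →L[ℝ] Hil Γ ι} (hA : Eqv A) (h : Γ) :
    tr A = ∑ i, A (bs h i) (h, i) := by
  unfold tr
  refine Finset.sum_congr rfl fun i _ => ?_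
  have := hA h 1 i 1 i
  rw [mul_one] at this
  exact this.symm

lemma nul_le_of_perp {X : Hil Γ ι →L[ℝ] Hil Γ ι} (hX : Eqv X) (e : Hil Γ ι) (he : e ≠ 0)
    (hp : ∀ x, X x = 0 → ⟪x, e⟫_ℝ = 0) (h : Γ) (i : ι) :
    nul X ≤ Fintype.card ι - (e (h, i)) ^ 2 / ‖e‖ ^ 2 := by
  set Q := 1 - kp X with hQ
  have hQE : Eqv Q := eqv_one.sub hX.kp
  have hQe : ∀ x, ⟪Q x, e⟫_ℝ = ⟪x, e⟫_ℝ := by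
    intro x
    rw [hQ, sub_apply, inner_sub_left, hp _ (kp_ker X x), sub_zero]
    rfl
  have hQQ : ∀ x, ⟪x, Q x⟫_ℝ = ‖Q x‖ ^ 2 := by
    intro x
    rw [← real_inner_self_eq_norm_sq]
    have h1 : ⟪kp X x, Q x⟫_ℝ = 0 := by
      rw [kp_inner, hQ, sub_apply, map_sub]
      rw [show kp X ((1 : Hil Γ ι →L[ℝ] Hil Γ ι) x) = kp X x from rfl, kp_of_ker (kp_ker X x)]
      simp
    have h2 : Q x = x - kp X x := by simp [hQ]
    conv_rhs => rw [h2, inner_sub_left, ← h2, h1, sub_zero]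
  have h1 : nul X = Fintype.card ι - tr Q := by
    rw [hQ, tr_sub, tr_one]; unfold nul; ring
  have h2 : ‖Q (bs h i)‖ ^ 2 ≤ tr Q := by
    rw [tr_eq_at hQE h, ← hQQ, inner_bs_left]
    refine Finset.single_le_sum (f := fun i => Q (bs h i) (h, i)) (fun j _ => ?_) (Finset.mem_univ i)
    show 0 ≤ Q (bs h j) (h, j)
    rw [← inner_bs_left, hQQ]
    positivity
  have h3 : (e (h, i)) ^ 2 ≤ ‖Q (bs h i)‖ ^ 2 * ‖e‖ ^ 2 := by
    rw [← inner_bs_left, ← hQe, ← mul_pow, ← sq_abs]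
    have := abs_real_inner_le_norm (Q (bs h i)) e
    gcongr
  have h4 : 0 < ‖e‖ ^ 2 := by
    have := norm_pos_iff.2 he
    positivity
  have h5 : (e (h, i)) ^ 2 / ‖e‖ ^ 2 ≤ ‖Q (bs h i)‖ ^ 2 := by
    rw [div_le_iff₀ h4]; exact h3
  linarith

/-- N5 -/
lemma nul_drop {T P T' : Hil Γ ι →L[ℝ] Hil Γ ι} (hT : Eqv T) (hP : Eqv P) (hT' : Eqv T')
    (hk : ∀ x, T' x = 0 ↔ T x = 0 ∧ P x = 0) (f : Hil Γ ι) (hf : T f = 0) (hPf : P f ≠ 0)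
    (h : Γ) (i : ι) : nul T' + (P f (h, i)) ^ 2 / ‖P f‖ ^ 2 ≤ nul T := by
  have hsub : ∀ x, T' x = 0 → T x = 0 := fun x hx => ((hk x).1 hx).1
  have hid : (kp T - kp T') * (kp T - kp T') = kp T - kp T' := by
    rw [sub_mul, mul_sub, mul_sub, kp_mul_kp hsub, kp_mul_kp' hsub, kp_mul_kp fun x h => h,
      kp_mul_kp fun x h => h]
    abel
  have h1 := nul_idem (hT.kp.sub hT'.kp) hid
  have h2 : nul (kp T - kp T') ≤ nul (P * kp T) := by
    refine nul_mono fun x hx => ?_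
    rw [sub_apply, sub_eq_zero] at hx
    rw [mul_apply_eq_comp, hx]
    exact ((hk _).1 (kp_ker T' x)).2
  have h3 : nul (P * kp T).adjoint ≤ Fintype.card ι - (P f (h, i)) ^ 2 / ‖P f‖ ^ 2 := by
    refine nul_le_of_perp (hP.mul hT.kp).adjoint (P f) hPf (fun x hx => ?_) h i
    have : P f = (P * kp T) f := by rw [mul_apply_eq_comp, kp_of_ker hf]
    rw [this, ← ContinuousLinearMap.adjoint_inner_left, hx, inner_zero_left]
  rw [nul_adjoint (hP.mul hT.kp)] at h3
  rw [tr_sub] at h1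
  change _ = _ - (nul T - nul T') at h1
  linarith

lemma ker_sum_sq (T P : Hil Γ ι →L[ℝ] Hil Γ ι) (x) :
    (T.adjoint * T + P.adjoint * P) x = 0 ↔ T x = 0 ∧ P x = 0 := by
  constructor
  · intro h
    have h1 : ⟪(T.adjoint * T + P.adjoint * P) x, x⟫_ℝ = ‖T x‖ ^ 2 + ‖P x‖ ^ 2 := by
      rw [add_apply, inner_add_left, mul_apply_eq_comp, mul_apply_eq_comp,
        ContinuousLinearMap.adjoint_inner_left, ContinuousLinearMap.adjoint_inner_left,
        real_inner_self_eq_norm_sq, real_inner_self_eq_norm_sq]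
    rw [h, inner_zero_left] at h1
    have h2 : ‖T x‖ ^ 2 = 0 := by nlinarith [sq_nonneg ‖T x‖, sq_nonneg ‖P x‖]
    have h3 : ‖P x‖ ^ 2 = 0 := by nlinarith [sq_nonneg ‖T x‖, sq_nonneg ‖P x‖]
    exact ⟨by simpa using h2, by simpa using h3⟩
  · rintro ⟨h1, h2⟩
    rw [add_apply, mul_apply_eq_comp, mul_apply_eq_comp, h1, h2]
    simp

end
end GW

namespace GW
open Filter Topology MonoidAlgebra
open scoped InnerProductSpace

section
variable {Γ ι : Type*} [Group Γ]

open scoped Classical in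
/-- underlying function of the elementary shift operator -/
noncomputable def shFun (h : Γ) (i j : ι) (f : Γ × ι → ℝ) : Γ × ι → ℝ :=
  fun p => if p.2 = j then f (p.1 * h⁻¹, i) else 0

lemma sh_summable (h : Γ) (i j : ι) (f : Hil Γ ι) :
    Summable (fun p => shFun h i j f p * shFun h i j f p) ∧
    ∑' p, shFun h i j f p * shFun h i j f p ≤ ‖f‖ ^ 2 := by
  have h0 := hasSum_parseval f f
  rw [real_inner_self_eq_norm_sq] at h0
  have inj1 : Function.Injective (fun k : Γ => (k, j)) := fun a b hab => (Prod.ext_iff.1 hab).1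
  have inj2 : Function.Injective (fun k : Γ => (k * h⁻¹, i)) :=
    fun a b hab => mul_right_cancel (Prod.ext_iff.1 hab).1
  have hz : ∀ x ∉ Set.range (fun k : Γ => (k, j)), shFun h i j f x * shFun h i j f x = 0 := by
    intro x hx
    have : x.2 ≠ j := fun e => hx ⟨x.1, by rw [← e]⟩
    simp [shFun, this]
  have hc : (fun p => shFun h i j f p * shFun h i j f p) ∘ (fun k : Γ => (k, j)) =
      (fun p => f p * f p) ∘ (fun k : Γ => (k * h⁻¹, i)) := by
    funext k
    simp [shFun]
  have hs : Summable ((fun p => shFun h i j f p * shFun h i j f p) ∘ (fun k : Γ => (k, j))) := by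
    rw [hc]
    exact h0.summable.comp_injective inj2
  refine ⟨(inj1.summable_iff hz).1 hs, ?_⟩
  have h1 := inj1.tsum_eq (f := fun p => shFun h i j f p * shFun h i j f p)
    (fun x hx => by by_contra hx'; exact hx (hz x hx'))
  rw [← h1, ← h0.tsum_eq]
  have hc' := fun k => congrFun hc k
  simp only [Function.comp] at hc'
  rw [tsum_congr hc']
  exact tsum_comp_le_tsum_of_inj h0.summable (fun p => mul_self_nonneg _) inj2

lemma sh_memlp (h : Γ) (i j : ι) (f : Hil Γ ι) : Memℓp (shFun h i j f) 2 := by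
  refine memℓp_gen ?_
  refine (sh_summable h i j f).1.congr fun p => ?_
  simp [sq]

/-- elementary shift operator -/
noncomputable def sh (h : Γ) (i j : ι) : Hil Γ ι →L[ℝ] Hil Γ ι :=
  LinearMap.mkContinuous
    { toFun := fun f => ⟨shFun h i j f, sh_memlp h i j f⟩
      map_add' := fun f g => by
        apply lp.ext; funext p
        change shFun h i j (f + g : Hil Γ ι) p = shFun h i j f p + shFun h i j g p
        by_cases hp : p.2 = j <;> simp [shFun, hp]
      map_smul' := fun c f => by
        apply lp.ext; funext p
        by_cases hp : p.2 = j <;> simp [shFun, hp] } 1 (fun f => by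
    rw [one_mul]
    refine le_of_sq_le_sq ?_ (norm_nonneg _) |> id
    rw [← real_inner_self_eq_norm_sq, ← (hasSum_parseval _ _).tsum_eq]
    exact (sh_summable h i j f).2)

open scoped Classical in
lemma sh_apply (h : Γ) (i j : ι) (f : Hil Γ ι) (k : Γ) (l : ι) :
    sh h i j f (k, l) = if l = j then f (k * h⁻¹, i) else 0 := rfl

open scoped Classical in
lemma sh_mul (h h' : Γ) (i j i' j' : ι) :
    sh h' i' j' * sh h i j = if i' = j then sh (h * h') i j' else 0 := by
  ext1 f
  apply hil_ext
  intro k l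
  rw [mul_apply_eq_comp, sh_apply, sh_apply]
  by_cases h1 : l = j' <;> by_cases h2 : i' = j <;> simp [h1, h2, sh_apply, mul_assoc]

/-- elementary operator of a group ring element -/
noncomputable def opE (i j : ι) : MonoidAlgebra ℤ Γ →+ (Hil Γ ι →L[ℝ] Hil Γ ι) :=
  liftNC (Int.castAddHom _) (fun h => sh h i j)

lemma opE_single (i j : ι) (h : Γ) (z : ℤ) : opE i j (single h z) = (z : ℝ) • sh h i j := by
  unfold opE
  rw [liftNC_single]
  ext1 f
  rw [mul_apply_eq_comp]
  simp only [Int.coe_castAddHom, _root_.smul_apply]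
  rw [Int.cast_smul_eq_zsmul]
  simp

open scoped Classical in
lemma opE_mul (i j i' j' : ι) (r r' : MonoidAlgebra ℤ Γ) :
    opE i' j' r' * opE i j r = if i' = j then opE i j' (r * r') else 0 := by
  induction r using MonoidAlgebra.induction_linear with
  | zero => simp
  | add f g hf hg => rw [map_add, mul_add, hf, hg, add_mul, map_add]; split_ifs <;> simp
  | single h z =>
    induction r' using MonoidAlgebra.induction_linear with
    | zero => simp
    | add f g hf hg => rw [map_add, add_mul, hf, hg, mul_add, map_add]; split_ifs <;> simp
    | single h' z' =>
      rw [opE_single, opE_single, single_mul_single, opE_single, smul_mul_smul_comm, sh_mul]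
      split_ifs
      · push_cast; rw [mul_comm]
      · simp

open scoped Classical in
lemma opE_apply (i j : ι) (r : MonoidAlgebra ℤ Γ) (f : Hil Γ ι) (k : Γ) (l : ι) :
    opE i j r f (k, l) = if l = j then r.coeff.sum (fun h z => f (k * h⁻¹, i) * z) else 0 := by
  induction r using MonoidAlgebra.induction_linear with
  | zero => simp
  | add p q hp hq =>
    rw [map_add, add_apply, lp.coeFn_add, Pi.add_apply, hp, hq, coeff_add, Finsupp.sum_add_index']
    · split_ifs <;> simp
    · simp
    · intro a b c; push_cast; ring
  | single h z =>
    rw [opE_single, _root_.smul_apply, lp.coeFn_smul, Pi.smul_apply, sh_apply, coeff_single,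
      Finsupp.sum_single_index (by simp)]
    split_ifs <;> simp [mul_comm]

variable [Fintype ι]

/-- right multiplication by a matrix over the group ring -/
noncomputable def op (M : Matrix ι ι (MonoidAlgebra ℤ Γ)) : Hil Γ ι →L[ℝ] Hil Γ ι :=
  ∑ i, ∑ j, opE i j (M i j)

lemma op_apply (M : Matrix ι ι (MonoidAlgebra ℤ Γ)) (f : Hil Γ ι) (k : Γ) (l : ι) :
    op M f (k, l) = ∑ i, (M i l).coeff.sum (fun h z => f (k * h⁻¹, i) * z) := by
  classical
  unfold op
  simp only [sum_apply, lp.coeFn_sum, Finset.sum_apply]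
  refine Finset.sum_congr rfl fun i _ => ?_
  simp [opE_apply]

lemma op_bs (M : Matrix ι ι (MonoidAlgebra ℤ Γ)) (x y : Γ) (i j : ι) :
    op M (bs x i) (y, j) = (M i j).coeff (x⁻¹ * y) := by
  classical
  rw [op_apply, Finset.sum_eq_single i]
  · rw [Finsupp.sum, Finset.sum_eq_single (x⁻¹ * y)]
    · simp [bs_apply]
    · intro b _ hb
      rw [bs_apply, if_neg, zero_mul]
      intro e
      have := (Prod.ext_iff.1 e).1
      apply hb
      simp only at this
      rw [← this]; group
    · intro h
      rw [Finsupp.notMem_support_iff.1 h]; simp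
  · intro b _ hb
    refine Finset.sum_eq_zero fun h _ => ?_
    change bs x i (y * h⁻¹, b) * _ = (0 : ℝ)
    rw [bs_apply, if_neg, zero_mul]
    intro e
    exact hb (Prod.ext_iff.1 e).2
  · simp

lemma op_eqv (M : Matrix ι ι (MonoidAlgebra ℤ Γ)) : Eqv (op M) := by
  intro g x i y j
  rw [op_bs, op_bs]
  congr 2
  group

lemma op_mul (M M' : Matrix ι ι (MonoidAlgebra ℤ Γ)) : op M' * op M = op (M * M') := by
  classical
  unfold op
  simp only [Finset.sum_mul_sum, opE_mul, Matrix.mul_apply, map_sum, Finset.sum_ite_eq,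
    Finset.mem_univ, if_true]
  rw [Finset.sum_comm]
  refine Finset.sum_congr rfl fun i _ => ?_
  rw [Finset.sum_comm]

lemma op_inj {M M' : Matrix ι ι (MonoidAlgebra ℤ Γ)} (h : op M = op M') : M = M' := by
  ext i j g
  have := op_bs M 1 g i j
  rw [h, op_bs] at this
  simpa using this.symm

lemma op_zero : op (0 : Matrix ι ι (MonoidAlgebra ℤ Γ)) = 0 := by
  simp [op]

lemma op_add (M M' : Matrix ι ι (MonoidAlgebra ℤ Γ)) : op (M + M') = op M + op M' := by
  simp [op, Finset.sum_add_distrib]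

lemma op_one [DecidableEq ι] : op (1 : Matrix ι ι (MonoidAlgebra ℤ Γ)) = 1 := by
  classical
  apply clm_ext_bs
  intro g i k j
  rw [op_bs, one_apply_eq_self, bs_apply, Matrix.one_apply]
  by_cases h1 : i = j
  · subst h1
    by_cases h2 : k = g
    · subst h2; simp
    · have : g⁻¹ * k ≠ 1 := fun e => h2 (by rw [inv_mul_eq_one] at e; exact e.symm)
      rw [if_pos rfl, one_def, coeff_single, Finsupp.single_apply, if_neg this.symm]
      simp [h2]
  · have : j ≠ i := fun e => h1 e.symm
    simp [h1, this]

lemma tr_op (M : Matrix ι ι (MonoidAlgebra ℤ Γ)) : tr (op M) = ∑ i, ((M i i).coeff 1 : ℝ) := by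
  simp [tr, op_bs]

/-- conjugate transpose -/
noncomputable def mstar (M : Matrix ι ι (MonoidAlgebra ℤ Γ)) : Matrix ι ι (MonoidAlgebra ℤ Γ) :=
  fun i j => MonoidAlgebra.mapDomain (·⁻¹) (M j i)

lemma coeff_mapDomain_inv (r : MonoidAlgebra ℤ Γ) (g : Γ) :
    (MonoidAlgebra.mapDomain (·⁻¹) r).coeff g = r.coeff g⁻¹ := by
  have := Finsupp.mapDomain_apply (f := fun g : Γ => g⁻¹) inv_injective r.coeff g⁻¹
  rw [inv_inv] at this
  exact this

lemma op_adjoint (M : Matrix ι ι (MonoidAlgebra ℤ Γ)) : (op M).adjoint = op (mstar M) := by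
  apply clm_ext_bs
  intro g i k j
  rw [adjoint_coeff, op_bs, op_bs, mstar, coeff_mapDomain_inv]
  congr 2
  group

end
end GW

namespace GW
open Filter Topology MonoidAlgebra

abbrev Zg (Γ : Type*) := MonoidAlgebra ℤ Γ

section
variable {Γ : Type*} [Group Γ]

/-- group element in the group ring -/
noncomputable def gr (g : Γ) : Zg Γ := single g 1

lemma gr_mul (g h : Γ) : gr (g * h) = gr g * gr h := by simp [gr, single_mul_single]

lemma gr_one : gr (1 : Γ) = 1 := rfl

lemma gr_mul_inv (g : Γ) : gr g * gr g⁻¹ = 1 := by rw [← gr_mul, mul_inv_cancel, gr_one]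

lemma gr_inv_mul (g : Γ) : gr g⁻¹ * gr g = 1 := by rw [← gr_mul, inv_mul_cancel, gr_one]

lemma coeff_gr_mul (g : Γ) (r : Zg Γ) (h : Γ) : (gr g * r).coeff h = r.coeff (g⁻¹ * h) := by
  have := coeff_single_mul_eq_mul_coeff (x := r) (m := g) (m₁ := h) (r := 1) (g⁻¹ * h) (by
    intro m' _
    constructor
    · rintro rfl; group
    · rintro rfl; group)
  rw [gr, this, one_mul]

lemma coeff_mul_gr (g : Γ) (r : Zg Γ) (h : Γ) : (r * gr g).coeff h = r.coeff (h * g⁻¹) := by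
  have := coeff_mul_single_eq_coeff_mul (x := r) (m := g) (m₁ := h) (r := 1) (h * g⁻¹) (by
    intro m' _
    constructor
    · rintro rfl; group
    · rintro rfl; group)
  rw [gr, this, mul_one]

lemma gr_inj {g h : Γ} (e : gr g = gr h) : g = h := by
  have := congrArg (fun r : Zg Γ => r.coeff h) e
  classical
  simp only [gr, coeff_single, Finsupp.single_apply] at this
  by_contra hne
  simp [hne] at this

lemma coeff_gr (g : Γ) [DecidableEq Γ] (h : Γ) : (gr g).coeff h = if g = h then 1 else 0 := by
  simp only [gr, coeff_single, Finsupp.single_apply]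

lemma zg_ext {r s : Zg Γ} (h : ∀ g, r.coeff g = s.coeff g) : r = s := by
  ext g; exact h g

/-- additive extension of a map on the group -/
noncomputable def zlift {A : Type*} [AddCommGroup A] (f : Γ → A) : Zg Γ →+ A :=
  (Finsupp.liftAddHom (fun g => (zmultiplesHom A (f g)))).comp
    (coeffAddEquiv : Zg Γ ≃+ (Γ →₀ ℤ)).toAddMonoidHom

lemma zlift_single {A : Type*} [AddCommGroup A] (f : Γ → A) (g : Γ) (z : ℤ) :
    zlift f (single g z) = z • f g := by
  simp [zlift]

lemma zlift_gr {A : Type*} [AddCommGroup A] (f : Γ → A) (g : Γ) : zlift f (gr g) = f g := by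
  rw [gr, zlift_single, one_smul]

lemma zlift_apply {A : Type*} [AddCommGroup A] (f : Γ → A) (r : Zg Γ) :
    zlift f r = r.coeff.sum fun g z => z • f g := by
  simp [zlift, Finsupp.liftAddHom_apply]
  rfl

lemma single_eq (g : Γ) (z : ℤ) : (single g z : Zg Γ) = z • gr g := by
  rw [gr, smul_single]; simp

lemma zg_ind {p : Zg Γ → Prop} (r : Zg Γ) (h0 : p 0) (hg : ∀ g, p (gr g))
    (ha : ∀ r s, p r → p s → p (r + s)) (hn : ∀ r, p r → p (-r)) : p r := by
  have hsm : ∀ (z : ℤ) r, p r → p (z • r) := by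
    intro z r hr
    induction z using Int.induction_on with
    | zero => simpa
    | succ n ih => rw [add_smul, one_smul]; exact ha _ _ ih hr
    | pred n ih => rw [sub_smul, one_smul, sub_eq_add_neg]; exact ha _ _ ih (hn _ hr)
  induction r using MonoidAlgebra.induction_linear with
  | zero => exact h0
  | add f g hf hg => exact ha _ _ hf hg
  | single g z => rw [single_eq]; exact hsm _ _ (hg g)

lemma zhom_ext {A : Type*} [AddCommGroup A] {f f' : Zg Γ →+ A} (h : ∀ g, f (gr g) = f' (gr g)) (r) :
    f r = f' r := by
  induction r using zg_ind with
  | h0 => simp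
  | hg g => exact h g
  | ha r s hr hs => rw [map_add, map_add, hr, hs]
  | hn r hr => rw [map_neg, map_neg, hr]

/-- augmentation -/
noncomputable def aug : Zg Γ →+* ℤ := (MonoidAlgebra.lift ℤ ℤ Γ 1).toRingHom

lemma aug_gr (g : Γ) : aug (gr g) = 1 := by
  simp [aug, gr, MonoidAlgebra.lift_single]

lemma aug_eq (r : Zg Γ) : aug r = r.coeff.sum fun _ z => z := by
  have := zhom_ext (f := (aug : Zg Γ →+* ℤ).toAddMonoidHom) (f' := zlift fun _ => 1)
    (fun g => by rw [zlift_gr]; exact aug_gr g) r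
  rw [zlift_apply] at this
  simpa using this

/-- elements of infinite order are not zero divisors together with 1 -/
lemma eq_zero_of_shift {x : Γ} (hx : ∀ n : ℕ, n ≠ 0 → x ^ n ≠ 1) (r : Zg Γ)
    (h : gr x * r = r) : r = 0 := by
  apply zg_ext
  intro g
  by_contra hne
  have h1 : ∀ g, r.coeff (x * g) = r.coeff g := by
    intro g
    have := coeff_gr_mul x r (x * g)
    rw [h] at this
    rw [this]; congr 1; group
  have h2 : ∀ n : ℕ, r.coeff (x ^ n * g) = r.coeff g := by
    intro n
    induction n with
    | zero => simp
    | succ n ih => rw [pow_succ', mul_assoc, h1, ih]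
  have hinj : Function.Injective (fun n : ℕ => x ^ n * g) := by
    intro a b hab
    have hab' : x ^ a = x ^ b := mul_right_cancel hab
    by_contra hne
    rcases lt_or_gt_of_ne hne with hlt | hlt
    · apply hx (b - a) (by omega)
      rw [← mul_right_inj (x ^ a), ← pow_add, mul_one, hab']; congr 1; omega
    · apply hx (a - b) (by omega)
      rw [← mul_right_inj (x ^ b), ← pow_add, mul_one, ← hab']; congr 1; omega
  have := Set.infinite_range_of_injective hinj
  apply this
  refine r.coeff.support.finite_toSet.subset ?_
  rintro _ ⟨n, rfl⟩
  simp only [Finset.mem_coe, Finsupp.mem_support_iff]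
  rw [h2]
  simpa using hne

lemma eq_zero_of_sub_mul {x : Γ} (hx : ∀ n : ℕ, n ≠ 0 → x ^ n ≠ 1) (r : Zg Γ)
    (h : (gr x - 1) * r = 0) : r = 0 := by
  apply eq_zero_of_shift hx
  rwa [sub_mul, one_mul, sub_eq_zero] at h

/-! levels -/

/-- homomorphism to the integers, unbundled -/
def IsHomZ (χ : Γ → ℤ) : Prop := ∀ a b, χ (a * b) = χ a + χ b

lemma IsHomZ.one {χ : Γ → ℤ} (h : IsHomZ χ) : χ 1 = 0 := by
  have := h 1 1; rw [mul_one] at this; omega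

lemma IsHomZ.inv {χ : Γ → ℤ} (h : IsHomZ χ) (a : Γ) : χ a⁻¹ = - χ a := by
  have := h a a⁻¹; rw [mul_inv_cancel, h.one] at this; omega

lemma IsHomZ.pow {χ : Γ → ℤ} (h : IsHomZ χ) (a : Γ) (n : ℕ) : χ (a ^ n) = n * χ a := by
  induction n with
  | zero => simp [h.one]
  | succ n ih => rw [pow_succ, h, ih]; push_cast; ring

lemma IsHomZ.zpow {χ : Γ → ℤ} (h : IsHomZ χ) (a : Γ) (n : ℤ) : χ (a ^ n) = n * χ a := by
  cases n with
  | ofNat n => simpa using h.pow a n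
  | negSucc n => rw [zpow_negSucc, h.inv, h.pow]; simp [Int.negSucc_eq]; ring

open scoped Classical in
/-- restriction to a set of levels -/
noncomputable def levs (χ : Γ → ℤ) (s : Set ℤ) : Zg Γ →+ Zg Γ where
  toFun r := ofCoeff (r.coeff.filter fun g => χ g ∈ s)
  map_zero' := by
    ext g
    change (Finsupp.filter (fun g => χ g ∈ s) (0 : Γ →₀ ℤ)) g = 0
    rw [Finsupp.filter_zero]; rfl
  map_add' r t := by rw [coeff_add, Finsupp.filter_add, ofCoeff_add]

open scoped Classical in
lemma coeff_levs (χ : Γ → ℤ) (s : Set ℤ) (r : Zg Γ) (g : Γ) :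
    (levs χ s r).coeff g = if χ g ∈ s then r.coeff g else 0 := by
  change (r.coeff.filter fun g => χ g ∈ s) g = _
  rw [Finsupp.filter_apply]

lemma levs_gr_mul {χ : Γ → ℤ} (h : IsHomZ χ) (s : Set ℤ) (g : Γ) (r : Zg Γ) :
    levs χ s (gr g * r) = gr g * levs χ {k | k + χ g ∈ s} r := by
  apply zg_ext
  intro k
  rw [coeff_levs, coeff_gr_mul, coeff_gr_mul, coeff_levs]
  have : χ (g⁻¹ * k) + χ g = χ k := by rw [h, h.inv]; ring
  have h2 : χ (g⁻¹ * k) ∈ {k | k + χ g ∈ s} ↔ χ k ∈ s := by rw [Set.mem_ofPred_eq, this]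
  by_cases h3 : χ k ∈ s
  · rw [if_pos h3, if_pos (h2.2 h3)]
  · rw [if_neg h3, if_neg (fun h => h3 (h2.1 h))]

/-- single level -/
noncomputable abbrev lev (χ : Γ → ℤ) (k : ℤ) : Zg Γ →+ Zg Γ := levs χ {k}

lemma lev_gr_mul {χ : Γ → ℤ} (h : IsHomZ χ) (k : ℤ) (g : Γ) (r : Zg Γ) :
    lev χ k (gr g * r) = gr g * lev χ (k - χ g) r := by
  rw [lev, levs_gr_mul h]
  congr 3
  ext a
  simp only [Set.mem_ofPred_eq, Set.mem_singleton_iff]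
  omega

lemma eq_sum_lev (χ : Γ → ℤ) (K : Finset ℤ) (r : Zg Γ) (h : ∀ k ∉ K, lev χ k r = 0) :
    r = ∑ k ∈ K, lev χ k r := by
  classical
  apply zg_ext
  intro g
  rw [coeff_sum, Finsupp.finsetSum_apply]
  simp only [coeff_levs, Set.mem_singleton_iff, Finset.sum_ite_eq]
  split_ifs with hg
  · rfl
  · have := congrArg (fun r : Zg Γ => r.coeff g) (h _ hg)
    simpa [coeff_levs] using this

/-- levels where `r` is supported -/
noncomputable def levSupp (χ : Γ → ℤ) (r : Zg Γ) : Finset ℤ := r.coeff.support.image χ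

lemma lev_eq_zero {χ : Γ → ℤ} {r : Zg Γ} {k : ℤ} (h : k ∉ levSupp χ r) : lev χ k r = 0 := by
  classical
  apply zg_ext
  intro g
  rw [coeff_levs]
  split_ifs with hg
  · by_contra hne
    apply h
    simp only [Set.mem_singleton_iff] at hg
    exact Finset.mem_image.2 ⟨g, Finsupp.mem_support_iff.2 hne, hg⟩
  · rfl

/-! derivations -/

/-- derivations from the group to the group ring -/
def IsDer (D : Γ → Zg Γ) : Prop := ∀ g h, D (g * h) = D g + gr g * D h

lemma IsDer.one {D : Γ → Zg Γ} (hD : IsDer D) : D 1 = 0 := by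
  have := hD 1 1
  rw [mul_one, gr_one, one_mul] at this
  simpa using this

lemma IsDer.inv {D : Γ → Zg Γ} (hD : IsDer D) (g : Γ) : D g⁻¹ = - (gr g⁻¹ * D g) := by
  have := hD g⁻¹ g
  rw [inv_mul_cancel, hD.one] at this
  exact eq_neg_of_add_eq_zero_left this.symm

lemma IsDer.pow {D : Γ → Zg Γ} (hD : IsDer D) (g : Γ) (n : ℕ) :
    D (g ^ n) = (∑ i ∈ Finset.range n, gr (g ^ i)) * D g := by
  induction n with
  | zero => simp [hD.one]
  | succ n ih => rw [pow_succ, hD, ih, Finset.sum_range_succ, add_mul]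

lemma IsDer.eq_zero {D : Γ → Zg Γ} (hD : IsDer D) {s : Set Γ} (hs : Subgroup.closure s = ⊤)
    (h : ∀ g ∈ s, D g = 0) (g : Γ) : D g = 0 := by
  have hg : g ∈ Subgroup.closure s := by rw [hs]; trivial
  induction hg using Subgroup.closure_induction with
  | mem x hx => exact h x hx
  | one => exact hD.one
  | mul x y _ _ hx hy => rw [hD, hx, hy]; simp
  | inv x _ hx => rw [hD.inv, hx]; simp

/-- finite family of derivations splitting the augmentation ideal -/
structure Fam (Γ : Type*) [Group Γ] (κ : Type*) [Fintype κ] where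
  D : κ → Γ → Zg Γ
  q : κ → Zg Γ
  der : ∀ k, IsDer (D k)
  augq : ∀ k, aug (q k) = 0
  split : ∀ h, ∑ k, D k h * q k = gr h - 1

def CD1 (Γ : Type*) [Group Γ] : Prop := ∃ n : ℕ, Nonempty (Fam Γ (Fin n))

lemma Fam.cd1 {κ : Type*} [Fintype κ] (F : Fam Γ κ) : CD1 Γ := by
  classical
  let e := (Fintype.equivFin κ).symm
  refine ⟨Fintype.card κ, ⟨⟨fun k => F.D (e k), fun k => F.q (e k), fun k => F.der _,
    fun k => F.augq _, fun h => ?_⟩⟩⟩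
  rw [← F.split h]
  exact Equiv.sum_comp e (fun k => F.D k h * F.q k)

/-- D3 core lemma -/
lemma core {κ : Type*} [Fintype κ] (F : Fam Γ κ) {χ : Γ → ℤ} (hχ : IsHomZ χ) {x₀ y : Γ}
    (hy : χ y = 1) (hx : χ x₀ = 0) (hinf : ∀ n : ℕ, n ≠ 0 → x₀ ^ n ≠ 1)
    (rank : ∀ j k, lev χ k (F.D j x₀) = 0 → ∀ m, χ m = 0 → lev χ k (F.D j m) = 0) : False := by
  have key : ∀ j, ∃ c, F.D j x₀ = (gr x₀ - 1) * c := by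
    intro j
    set D := F.D j with hDdef
    have hD : IsDer D := F.der j
    have conj : ∀ m, D (y * m * y⁻¹) = gr y * D m - (gr (y * m * y⁻¹) - 1) * D y := by
      intro m
      rw [hD, hD, hD.inv, mul_neg, ← mul_assoc, ← gr_mul]
      noncomm_ring
    have lev_mul : ∀ (m : Γ) (k : ℤ) (r : Zg Γ), χ m = 0 →
        lev χ k ((gr m - 1) * r) = (gr m - 1) * lev χ k r := by
      intro m k r hm
      rw [sub_mul, one_mul, map_sub, lev_gr_mul hχ, hm, sub_zero, sub_mul, one_mul]
    have step : ∀ k, (∃ c, ∀ m, χ m = 0 → lev χ k (D m) = (gr m - 1) * c) →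
        ∃ c, ∀ m, χ m = 0 → lev χ (k - 1) (D m) = (gr m - 1) * c := by
      rintro k ⟨c, hc⟩
      refine ⟨gr y⁻¹ * (c + lev χ k (D y)), fun m hm => ?_⟩
      have hm' : χ (y * m * y⁻¹) = 0 := by rw [hχ, hχ, hχ.inv, hm]; ring
      have h1 := congrArg (lev χ k) (conj m)
      rw [map_sub, lev_mul _ _ _ hm', hc _ hm', lev_gr_mul hχ, hy] at h1
      have h2 : gr y * lev χ (k - 1) (D m) =
          (gr (y * m * y⁻¹) - 1) * (c + lev χ k (D y)) := by
        rw [mul_add, h1]; abel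
      have h3 := congrArg (fun r => gr y⁻¹ * r) h2
      rw [← mul_assoc, gr_inv_mul, one_mul] at h3
      have h4 : gr y⁻¹ * (gr (y * m * y⁻¹) - 1) = (gr m - 1) * gr y⁻¹ := by
        rw [mul_sub, sub_mul, ← gr_mul, ← gr_mul, mul_one, one_mul]
        congr 2; group
      rw [h3, ← mul_assoc, ← mul_assoc, h4]
    have all : ∀ k, ∃ c, ∀ m, χ m = 0 → lev χ k (D m) = (gr m - 1) * c := by
      obtain ⟨B, hB⟩ := (levSupp χ (D x₀)).bddAbove
      have hbase : ∃ c, ∀ m, χ m = 0 → lev χ (B + 1) (D m) = (gr m - 1) * c := by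
        refine ⟨0, fun m hm => ?_⟩
        rw [mul_zero]
        refine rank j _ (lev_eq_zero fun hmem => ?_) m hm
        have := hB (Finset.mem_coe.2 hmem)
        omega
      have hdown : ∀ n : ℕ, ∃ c, ∀ m, χ m = 0 → lev χ (B + 1 - n) (D m) = (gr m - 1) * c := by
        intro n
        induction n with
        | zero => simpa using hbase
        | succ n ih =>
          have := step _ ih
          push_cast
          rwa [← sub_sub]
      intro k
      by_cases hk : k ≤ B
      · have := hdown (B + 1 - k).toNat
        rwa [Int.toNat_of_nonneg (by omega), sub_sub_cancel] at this
      · refine ⟨0, fun m hm => ?_⟩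
        rw [mul_zero]
        refine rank j _ (lev_eq_zero fun hmem => ?_) m hm
        have := hB (Finset.mem_coe.2 hmem)
        omega
    choose c hc using all
    refine ⟨∑ k ∈ levSupp χ (D x₀), c k, ?_⟩
    rw [Finset.mul_sum]
    conv_lhs => rw [eq_sum_lev χ (levSupp χ (D x₀)) (D x₀) fun k hk => lev_eq_zero hk]
    exact Finset.sum_congr rfl fun k _ => hc k x₀ hx
  choose c hc using key
  have h1 := F.split x₀
  have h2 : (gr x₀ - 1) * (1 - ∑ k, c k * F.q k) = 0 := by
    rw [mul_sub, mul_one, ← h1, Finset.mul_sum]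
    rw [sub_eq_zero]
    refine Finset.sum_congr rfl fun k _ => ?_
    rw [hc, mul_assoc, h1]
  have h3 := congrArg aug (sub_eq_zero.1 (eq_zero_of_sub_mul hinf _ h2))
  rw [map_one, map_sum] at h3
  simp [F.augq] at h3

end
end GW

namespace GW
open Filter Topology MonoidAlgebra

section
variable {Γ : Type*} [Group Γ]

lemma zg_eq_sum (r : Zg Γ) : r = ∑ g ∈ r.coeff.support, r.coeff g • gr g := by
  classical
  apply zg_ext
  intro h
  rw [coeff_sum, Finsupp.finsetSum_apply]
  have : ∀ g, (r.coeff g • gr g).coeff h = if g = h then r.coeff g else 0 := by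
    intro g
    rw [coeff_smul, Finsupp.smul_apply, coeff_gr]
    simp
  simp only [this, Finset.sum_ite_eq']
  split_ifs with hh
  · rfl
  · simpa using hh

lemma zhom_ext_supp {A : Type*} [AddCommGroup A] {f f' : Zg Γ →+ A} (r : Zg Γ)
    (h : ∀ g, r.coeff g ≠ 0 → f (gr g) = f' (gr g)) : f r = f' r := by
  rw [zg_eq_sum r, map_sum, map_sum]
  refine Finset.sum_congr rfl fun g hg => ?_
  rw [map_zsmul, map_zsmul, h g (by simpa using hg)]

/-- inheritance of the splitting property by finitely generated subgroups -/
theorem CD1.sub {N : Type*} [Group N] (hN : CD1 N) (L : Subgroup N) (s : Finset N)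
    (hs : Subgroup.closure (s : Set N) = L) : CD1 L := by
  classical
  obtain ⟨n, ⟨F⟩⟩ := hN
  let σ : N → N := fun x => (Quotient.mk (QuotientGroup.rightRel L) x).out
  have hσ : ∀ (l : L) x, σ (l * x) = σ x := by
    intro l x
    have : Quotient.mk (QuotientGroup.rightRel L) (l * x) = Quotient.mk (QuotientGroup.rightRel L) x := by
      apply Quotient.sound
      change QuotientGroup.rightRel L _ _
      rw [QuotientGroup.rightRel_apply]
      simp
    simp only [σ, this]
  have hρ : ∀ x, x * (σ x)⁻¹ ∈ L := by
    intro x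
    have : Quotient.mk (QuotientGroup.rightRel L) (σ x) = Quotient.mk (QuotientGroup.rightRel L) x :=
      Quotient.out_eq _
    have := Quotient.exact this
    change QuotientGroup.rightRel L _ _ at this
    rwa [QuotientGroup.rightRel_apply] at this
  let ρ : N → L := fun x => ⟨x * (σ x)⁻¹, hρ x⟩
  have hρl : ∀ (l : L) x, ρ (l * x) = l * ρ x := by
    intro l x
    apply Subtype.ext
    simp only [ρ, hσ, Subgroup.coe_mul, mul_assoc]
  have hρσ : ∀ x, (ρ x : N) * σ x = x := by intro x; simp [ρ]
  let R : Zg N →+ Zg L := zlift fun x => gr (ρ x * (ρ 1)⁻¹)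
  have hR : ∀ (l : L) r, R (gr (l : N) * r) = gr l * R r := by
    intro l r
    refine zhom_ext (f := R.comp (AddMonoidHom.mulLeft (gr (l : N))))
      (f' := (AddMonoidHom.mulLeft (gr l)).comp R) (fun g => ?_) r
    simp only [AddMonoidHom.comp_apply, AddMonoidHom.coe_mulLeft, ← gr_mul, R, zlift_gr, hρl, mul_assoc]
  let res : N → Zg N →+ Zg L := fun g => zlift fun x => if σ x = g then gr (ρ x) else 0
  have hres : ∀ g (l : L) r, res g (gr (l : N) * r) = gr l * res g r := by
    intro g l r
    refine zhom_ext (f := (res g).comp (AddMonoidHom.mulLeft (gr (l : N))))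
      (f' := (AddMonoidHom.mulLeft (gr l)).comp (res g)) (fun x => ?_) r
    simp only [AddMonoidHom.comp_apply, AddMonoidHom.coe_mulLeft, ← gr_mul, res, zlift_gr, hρl, hσ,
      mul_ite, mul_zero]
  let FF : Finset N := s.biUnion fun x => Finset.univ.biUnion fun k => (F.D k x).coeff.support.image σ
  let P : Zg N → Prop := fun r => ∀ x, r.coeff x ≠ 0 → σ x ∈ FF
  have P0 : P 0 := by intro x hx; simp at hx
  have Padd : ∀ r t, P r → P t → P (r + t) := by
    intro r t hr ht x hx
    by_cases h : r.coeff x = 0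
    · apply ht; intro h'; apply hx; simp [h, h']
    · exact hr x h
  have Pneg : ∀ r, P r → P (-r) := by
    intro r hr x hx; apply hr; intro h; apply hx; simp [h]
  have Pgr : ∀ (l : L) r, P r → P (gr (l : N) * r) := by
    intro l r hr x hx
    rw [coeff_gr_mul] at hx
    have := hr _ hx
    rwa [← Subgroup.coe_inv, hσ] at this
  have hP : ∀ k, ∀ h ∈ L, P (F.D k h) := by
    intro k h hh
    rw [← hs] at hh
    induction hh using Subgroup.closure_induction with
    | mem x hx =>
      intro y hy
      exact Finset.mem_biUnion.2 ⟨x, hx, Finset.mem_biUnion.2 ⟨k, Finset.mem_univ _,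
        Finset.mem_image_of_mem _ (by simpa using hy)⟩⟩
    | one => rw [(F.der k).one]; exact P0
    | mul x y hx _ h1 h2 =>
      rw [F.der k]; rw [hs] at hx; exact Padd _ _ h1 (Pgr ⟨x, hx⟩ _ h2)
    | inv x hx h1 =>
      rw [(F.der k).inv]; rw [hs] at hx; exact Pneg _ (Pgr (⟨x, hx⟩⁻¹ : L) _ h1)
  have key : ∀ (r q : Zg N), P r → ∑ g : FF, res g r * R (gr (g : N) * q) = R (r * q) := by
    intro r q hr
    have := zhom_ext_supp (f := ∑ g : FF, (AddMonoidHom.mulRight (R (gr (g : N) * q))).comp (res g))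
      (f' := R.comp (AddMonoidHom.mulRight q)) r ?_
    · simpa [AddMonoidHom.finsetSum_apply] using this
    · intro x hx
      have hx' := hr x hx
      simp only [AddMonoidHom.finsetSum_apply, AddMonoidHom.comp_apply, AddMonoidHom.coe_mulRight]
      rw [Finset.sum_eq_single (⟨σ x, hx'⟩ : FF)]
      · simp only [res, zlift_gr, if_true]
        rw [← hR, ← mul_assoc, ← gr_mul, hρσ]
      · intro b _ hb
        have : σ x ≠ b := fun h => hb (Subtype.ext h.symm)
        simp only [res, zlift_gr, if_neg this, zero_mul]
      · simp
  refine Fam.cd1 (κ := Fin n × FF) ⟨fun kg h => res kg.2 (F.D kg.1 h),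
    fun kg => R (gr (kg.2 : N) * F.q kg.1), ?_, ?_, ?_⟩
  · intro kg g h
    change res _ (F.D _ (g * h : L)) = _
    rw [Subgroup.coe_mul, F.der, map_add, hres]
  · intro kg
    have : ∀ r, aug (R r) = aug r := by
      intro r
      refine zhom_ext (f := (aug : Zg L →+* ℤ).toAddMonoidHom.comp R)
        (f' := (aug : Zg N →+* ℤ).toAddMonoidHom) (fun g => ?_) r
      simp [R, zlift_gr, aug_gr]
    rw [this, map_mul, F.augq, mul_zero]
  · intro h
    rw [Fintype.sum_prod_type]
    simp only
    rw [Finset.sum_congr rfl fun k _ => key _ _ (hP k h h.2), ← map_sum, F.split, map_sub]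
    have h1 : R (gr (h : N)) = gr h := by
      have := hρl h 1
      simp only [R, zlift_gr]
      rw [mul_one] at this
      rw [this]; simp
    have h2 : R 1 = 1 := by
      rw [← gr_one]; simp only [R, zlift_gr]; simp [gr_one]
    rw [h1, h2]

end
end GW

namespace GW
open Filter Topology MonoidAlgebra

section
variable {Γ : Type*} [Group Γ]

theorem CD1.finite_trivial (hN : CD1 Γ) [Finite Γ] (c : Γ) : c = 1 := by
  classical
  obtain ⟨n, ⟨F⟩⟩ := hN
  have := Fintype.ofFinite Γ
  let φ : Fin n → Zg Γ := fun j => ∑ k, (-((F.D j k).coeff k)) • gr k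
  have hφ : ∀ j k, (φ j).coeff k = -((F.D j k).coeff k) := by
    intro j k
    simp only [φ, coeff_sum, Finsupp.finsetSum_apply, coeff_smul, Finsupp.smul_apply, coeff_gr]
    simp
  have hD : ∀ j h, F.D j h = (gr h - 1) * φ j := by
    intro j h
    apply zg_ext
    intro k
    rw [sub_mul, one_mul, coeff_sub, Finsupp.sub_apply, coeff_gr_mul, hφ, hφ]
    have h1 := F.der j h (h⁻¹ * k)
    have h2 := congrArg (fun r : Zg Γ => r.coeff k) h1
    simp only [coeff_add, Finsupp.add_apply, coeff_gr_mul, mul_inv_cancel_left] at h2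
    rw [h2]; ring
  let y := 1 - ∑ j, φ j * F.q j
  have hy : ∀ h, gr h * y = y := by
    intro h
    rw [← sub_eq_zero]
    have : (gr h - 1) * y = 0 := by
      rw [mul_sub, mul_one, ← F.split h, Finset.mul_sum, sub_eq_zero]
      refine Finset.sum_congr rfl fun j _ => ?_
      rw [hD, mul_assoc, F.split h]
    rwa [sub_mul, one_mul] at this
  have haug : aug y = 1 := by
    simp [y, map_sub, map_sum, map_mul, F.augq]
  have hc : ∀ k, y.coeff k = y.coeff 1 := by
    intro k
    have := coeff_gr_mul k⁻¹ y 1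
    rw [hy] at this
    rw [this]; simp
  have h1 : (Fintype.card Γ : ℤ) * y.coeff 1 = 1 := by
    rw [aug_eq, Finsupp.sum_fintype _ _ (fun _ => rfl)] at haug
    simp only [hc, Finset.sum_const, Finset.card_univ, nsmul_eq_mul] at haug
    exact haug
  have h2 : (Fintype.card Γ : ℤ) = 1 := by
    rcases Int.eq_one_or_neg_one_of_mul_eq_one h1 with h | h
    · exact h
    · omega
  have h3 : Fintype.card Γ = 1 := by exact_mod_cast h2
  exact (Fintype.card_le_one_iff.1 h3.le) c 1

theorem CD1.tf (hN : CD1 Γ) {g : Γ} (hg : g ≠ 1) (n : ℕ) (hn : n ≠ 0) : g ^ n ≠ 1 := by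
  classical
  intro h
  have hfin : IsOfFinOrder g := isOfFinOrder_iff_pow_eq_one.2 ⟨n, Nat.pos_of_ne_zero hn, h⟩
  have h1 : CD1 (Subgroup.zpowers g) := hN.sub _ {g} (by
    rw [Finset.coe_singleton, Subgroup.zpowers_eq_closure])
  have : Finite (Subgroup.zpowers g) := by
    exact finite_zpowers.2 hfin
  have := h1.finite_trivial ⟨g, Subgroup.mem_zpowers g⟩
  exact hg (congrArg Subtype.val this)

theorem CD1.tfz (hN : CD1 Γ) {g : Γ} (hg : g ≠ 1) (n : ℤ) (hn : n ≠ 0) : g ^ n ≠ 1 := by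
  intro h
  apply hN.tf hg n.natAbs (by omega)
  rcases Int.natAbs_eq n with h1 | h1
  · rw [h1, zpow_natCast] at h; exact h
  · rw [h1, zpow_neg, zpow_natCast, inv_eq_one] at h; exact h

theorem CD1.zpow_inj (hN : CD1 Γ) {g : Γ} (hg : g ≠ 1) {a b : ℤ} (h : g ^ a = g ^ b) : a = b := by
  by_contra hne
  apply hN.tfz hg (a - b) (by omega)
  rw [zpow_sub, h, mul_inv_cancel]

/-- the case where `y, g` generate -/
theorem CD1.noBS' (hN : CD1 Γ) {g y : Γ} (hgen : Subgroup.closure {y, g} = ⊤) (hg : g ≠ 1) (m : ℤ)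
    (hm : 2 ≤ m) (h : y * g * y⁻¹ = g ^ m) : False := by
  have hm0 : (m : ℚ) ≠ 0 := by exact_mod_cast (by omega : m ≠ 0)
  have conjz : ∀ (x : Γ) (a : ℤ), x * g ^ a * x⁻¹ = (x * g * x⁻¹) ^ a := by
    intro x a; rw [conj_zpow]
  let Rel : Γ → ℤ → Prop := fun x k => ∃ a b : ℤ, a ≠ 0 ∧ x * g ^ a * x⁻¹ = g ^ b ∧ (b : ℚ) = a * (m : ℚ) ^ k
  have Rmul : ∀ x x' k k', Rel x k → Rel x' k' → Rel (x * x') (k + k') := by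
    rintro x x' k k' ⟨a, b, ha, h1, h2⟩ ⟨a', b', ha', h1', h2'⟩
    refine ⟨a * a', b * b', mul_ne_zero ha ha', ?_, ?_⟩
    · have e1 : x' * g ^ (a * a') * x'⁻¹ = g ^ (a * b') := by
        rw [mul_comm a a', zpow_mul, ← conj_zpow, h1', ← zpow_mul, mul_comm]
      have e2 : x * g ^ (a * b') * x⁻¹ = g ^ (b * b') := by
        rw [zpow_mul, ← conj_zpow, h1, ← zpow_mul]
      rw [← e2, ← e1]; group
    · push_cast
      rw [h2, h2', zpow_add₀ hm0]; ring
  have Rinv : ∀ x k, Rel x k → Rel x⁻¹ (-k) := by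
    rintro x k ⟨a, b, ha, h1, h2⟩
    refine ⟨b, a, ?_, ?_, ?_⟩
    · intro hb
      rw [hb] at h2
      have : (a : ℚ) ≠ 0 := by exact_mod_cast ha
      have := zpow_ne_zero k hm0
      simp_all
    · rw [← h1]; group
    · rw [h2, zpow_neg]
      have := zpow_ne_zero k hm0
      field_simp
  have Rg : Rel g 0 := ⟨1, 1, one_ne_zero, by group, by simp⟩
  have Ry : Rel y 1 := ⟨1, m, one_ne_zero, by rw [zpow_one, h], by simp⟩
  have Rone : Rel 1 0 := ⟨1, 1, one_ne_zero, by group, by simp⟩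
  have ex : ∀ x, ∃ k, Rel x k := by
    intro x
    have hx : x ∈ Subgroup.closure {y, g} := by rw [hgen]; trivial
    induction hx using Subgroup.closure_induction with
    | mem x hx =>
      rcases hx with rfl | hx
      · exact ⟨1, Ry⟩
      · rw [Set.mem_singleton_iff] at hx; rw [hx]; exact ⟨0, Rg⟩
    | one => exact ⟨0, Rone⟩
    | mul x x' _ _ h1 h2 =>
      obtain ⟨k, hk⟩ := h1; obtain ⟨k', hk'⟩ := h2; exact ⟨_, Rmul _ _ _ _ hk hk'⟩
    | inv x _ h1 => obtain ⟨k, hk⟩ := h1; exact ⟨_, Rinv _ _ hk⟩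
  have Rone' : ∀ k, Rel 1 k → k = 0 := by
    rintro k ⟨a, b, ha, h1, h2⟩
    have : a = b := hN.zpow_inj hg (by simpa using h1)
    rw [← this] at h2
    have ha' : (a : ℚ) ≠ 0 := by exact_mod_cast ha
    have h3 : (m : ℚ) ^ k = 1 := by
      have : (a : ℚ) * (m : ℚ) ^ k = a * 1 := by rw [← h2, mul_one]
      exact mul_left_cancel₀ ha' this
    have hm1 : (1 : ℚ) < m := by exact_mod_cast (by omega : 1 < m)
    exact (zpow_right_injective₀ (by linarith) hm1.ne') (by simpa using h3)
  have uniq : ∀ x k k', Rel x k → Rel x k' → k = k' := by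
    intro x k k' h1 h2
    have := Rmul _ _ _ _ h1 (Rinv _ _ h2)
    rw [mul_inv_cancel] at this
    have := Rone' _ this
    omega
  choose χ hχ using ex
  have hhom : IsHomZ χ := fun a b => uniq _ _ _ (hχ _) (Rmul _ _ _ _ (hχ a) (hχ b))
  have hχy : χ y = 1 := uniq _ _ _ (hχ y) Ry
  have hχg : χ g = 0 := uniq _ _ _ (hχ g) Rg
  have hcomm : ∀ x, χ x = 0 → ∃ a : ℕ, a ≠ 0 ∧ g ^ a * x = x * g ^ a := by
    intro x hx
    obtain ⟨a, b, ha, h1, h2⟩ := hχ x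
    rw [hx, zpow_zero, mul_one] at h2
    have hab : b = a := by exact_mod_cast h2
    rw [hab] at h1
    have h3 : x * g ^ a = g ^ a * x := by
      rw [mul_inv_eq_iff_eq_mul] at h1; exact h1
    refine ⟨a.natAbs, by omega, ?_⟩
    have h4 : Commute x (g ^ a) := h3
    rcases Int.natAbs_eq a with h5 | h5
    · rw [h5, zpow_natCast] at h4; exact h4.eq.symm
    · rw [h5, zpow_neg, zpow_natCast] at h4; exact (Commute.inv_right_iff.1 h4).eq.symm
  obtain ⟨n, ⟨F⟩⟩ := id hN
  refine core F hhom hχy hχg (hN.tf hg) ?_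
  intro j k hk x hx
  obtain ⟨a, ha, hax⟩ := hcomm x hx
  have hD := F.der j
  have h1 : (gr (g ^ a) - 1) * F.D j x = (gr x - 1) * ((∑ i ∈ Finset.range a, gr (g ^ i)) * F.D j g) := by
    rw [← hD.pow]
    have h2 := congrArg (F.D j) hax
    rw [hD, hD] at h2
    rw [sub_mul, sub_mul, one_mul, one_mul, sub_eq_sub_iff_add_eq_add, add_comm _ (F.D j (g ^ a)), h2,
      add_comm]
  have levl : ∀ (z : Γ) (r : Zg Γ), χ z = 0 → lev χ k (gr z * r) = gr z * lev χ k r := by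
    intro z r hz
    rw [lev_gr_mul hhom, hz, sub_zero]
  have hga : χ (g ^ a) = 0 := by rw [hhom.pow, hχg, mul_zero]
  have h2 := congrArg (lev χ k) h1
  rw [sub_mul, sub_mul, one_mul, one_mul, map_sub, map_sub, levl _ _ hga, levl _ _ hx, Finset.sum_mul,
    map_sum, Finset.sum_eq_zero, mul_zero, sub_zero] at h2
  · refine eq_zero_of_shift (x := g ^ a) (hN.tf (hN.tf hg a ha)) _ (sub_eq_zero.1 h2)
  · intro i _
    rw [levl _ _ (by rw [hhom.pow, hχg, mul_zero]), hk, mul_zero]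

theorem CD1.noBS (hN : CD1 Γ) {g y : Γ} (hg : g ≠ 1) (m : ℤ)
    (hm : 2 ≤ m) (h : y * g * y⁻¹ = g ^ m) : False := by
  classical
  let L := Subgroup.closure ({y, g} : Set Γ)
  have hL : CD1 L := hN.sub L {y, g} (by simp [L])
  have hy : y ∈ L := Subgroup.subset_closure (by simp)
  have hg' : g ∈ L := Subgroup.subset_closure (by simp)
  refine hL.noBS' (g := ⟨g, hg'⟩) (y := ⟨y, hy⟩) ?_ (fun h => hg (congrArg Subtype.val h)) m hm
    (Subtype.ext ?_)
  · have := Subgroup.closure_closure_coe_preimage (k := ({y, g} : Set Γ))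
    rw [← this]
    congr 1
    ext ⟨x, hx⟩
    simp
  · simpa using h

end
end GW

namespace GW
open Filter Topology

section frob
open Polynomial
variable {R : Type*} [Ring R] {p : ℕ} [Fact p.Prime] (τ : R →+ ZMod p)

lemma frob_poly_trace (hτ : ∀ a b, τ (a * b) = τ (b * a)) (P Q : R[X]) (k : ℕ) :
    τ ((P * Q).coeff k) = τ ((Q * P).coeff k) := by
  rw [coeff_mul, coeff_mul, map_sum, map_sum, ← Finset.Nat.sum_antidiagonal_swap]
  exact Finset.sum_congr rfl fun x _ => hτ _ _

lemma frob_deriv (hτ : ∀ a b, τ (a * b) = τ (b * a)) (F : R[X]) (k n m : ℕ) :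
    τ ((derivative (F ^ n) * F ^ m).coeff k) = n * τ ((derivative F * F ^ (n + m - 1)).coeff k) := by
  induction n generalizing m with
  | zero => simp
  | succ n ih =>
    rw [pow_succ, derivative_mul, add_mul, coeff_add, map_add, mul_assoc _ F, ← pow_succ', ih,
      mul_assoc (F ^ n), frob_poly_trace τ hτ (F ^ n), mul_assoc (derivative F), ← pow_add]
    have h1 : n + (m + 1) - 1 = m + n := by omega
    have h2 : n + 1 + m - 1 = m + n := by omega
    rw [h1, h2]; push_cast; ring

lemma frob_two (hτ : ∀ a b, τ (a * b) = τ (b * a)) (a b : R) :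
    τ ((a + b) ^ p) = τ (a ^ p) + τ (b ^ p) := by
  have hp : p.Prime := Fact.out
  let F : R[X] := C a * X + C b
  have hdeg : F.natDegree ≤ 1 := natDegree_linear_le
  have hdeg' : (F ^ p).natDegree ≤ p * 1 := natDegree_pow_le_of_le p hdeg
  have htop : (F ^ p).coeff p = a ^ p := by
    have := coeff_pow_of_natDegree_le (p := F) (m := p) (n := 1) hdeg
    rw [mul_one] at this
    rw [this]; simp [F]
  have hbot : (F ^ p).coeff 0 = b ^ p := by
    have : constantCoeff (F ^ p) = (constantCoeff F) ^ p := map_pow _ _ _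
    simpa [F] using this
  have hmid : ∀ k, k + 1 < p → τ ((F ^ p).coeff (k + 1)) = 0 := by
    intro k hk
    have h1 := frob_deriv τ hτ F k p 0
    rw [pow_zero, mul_one, coeff_derivative] at h1
    simp only [CharP.cast_eq_zero, zero_mul] at h1
    have h2 : ((k : R) + 1) = ((k + 1 : ℕ) : R) := by push_cast; rfl
    rw [h2, ← nsmul_eq_mul', map_nsmul, nsmul_eq_mul] at h1
    rcases mul_eq_zero.1 h1 with h | h
    · rw [ZMod.natCast_eq_zero_iff] at h
      exact absurd (Nat.le_of_dvd (by omega) h) (by omega)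
    · exact h
  have hev : (a + b) ^ p = ∑ k ∈ Finset.range (p + 1), (F ^ p).coeff k := by
    let e := eval₂RingHom' (RingHom.id R) 1 (fun r => Commute.one_right _)
    have h1 : e (F ^ p) = (a + b) ^ p := by
      rw [map_pow]; congr 1
      change eval₂ _ _ F = _
      simp [F, eval₂_add]
    rw [← h1]
    change eval₂ _ _ (F ^ p) = _
    rw [eval₂_eq_sum_range' (RingHom.id R) (n := p + 1) (by omega)]
    simp
  rw [hev, map_sum, Finset.sum_range_succ, htop, add_comm]
  congr 1
  rw [← hbot]
  obtain ⟨q, hq⟩ : ∃ q, p = q + 1 := ⟨p - 1, by have := hp.pos; omega⟩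
  have : ∀ (n : ℕ), n + 1 ≤ p → ∑ k ∈ Finset.range (n + 1), τ ((F ^ p).coeff k) = τ ((F ^ p).coeff 0) := by
    intro n hn
    induction n with
    | zero => simp
    | succ n ih => rw [Finset.sum_range_succ, ih (by omega), hmid n (by omega), add_zero]
  have := this q hq.ge
  rwa [← hq] at this

lemma frob_sum (hτ : ∀ a b, τ (a * b) = τ (b * a)) {ι : Type*} (s : Finset ι) (x : ι → R) :
    τ ((∑ i ∈ s, x i) ^ p) = ∑ i ∈ s, τ (x i ^ p) := by
  classical
  have hp : p.Prime := Fact.out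
  induction s using Finset.induction_on with
  | empty => simp [hp.ne_zero]
  | insert a s ha ih => rw [Finset.sum_insert ha, Finset.sum_insert ha, frob_two τ hτ, ih]

end frob

section
open MonoidAlgebra
variable {Γ : Type*} [Group Γ] {ι : Type*} [Fintype ι] [DecidableEq ι]

open scoped Classical in
/-- indicator of a conjugacy class -/
noncomputable def ccInd (c : ConjClasses Γ) (g : Γ) : ℤ := if ConjClasses.mk g = c then 1 else 0

lemma cc_mk_mul (g h : Γ) : ConjClasses.mk (g * h) = ConjClasses.mk (h * g) := by
  rw [ConjClasses.mk_eq_mk_iff_isConj, isConj_iff]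
  exact ⟨h, by group⟩

lemma ccInd_mul (c : ConjClasses Γ) (r s : Zg Γ) :
    zlift (ccInd c) (r * s) = zlift (ccInd c) (s * r) := by
  refine zhom_ext (f := (zlift (ccInd c)).comp (AddMonoidHom.mulRight s))
    (f' := (zlift (ccInd c)).comp (AddMonoidHom.mulLeft s)) (fun g => ?_) r
  simp only [AddMonoidHom.comp_apply, AddMonoidHom.coe_mulRight, AddMonoidHom.coe_mulLeft]
  refine zhom_ext (f := (zlift (ccInd c)).comp (AddMonoidHom.mulLeft (gr g)))
    (f' := (zlift (ccInd c)).comp (AddMonoidHom.mulRight (gr g))) (fun h => ?_) s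
  simp only [AddMonoidHom.comp_apply, AddMonoidHom.coe_mulRight, AddMonoidHom.coe_mulLeft, ← gr_mul,
    zlift_gr, ccInd]
  congr 2; exact cc_mk_mul g h

/-- conjugacy class trace -/
noncomputable def cct (c : ConjClasses Γ) : Matrix ι ι (Zg Γ) →+ ℤ where
  toFun M := ∑ i, zlift (ccInd c) (M i i)
  map_zero' := by simp
  map_add' M M' := by simp [Finset.sum_add_distrib]

lemma cct_apply (c : ConjClasses Γ) (M : Matrix ι ι (Zg Γ)) : cct c M = ∑ i, zlift (ccInd c) (M i i) := rfl

lemma cct_mul (c : ConjClasses Γ) (M M' : Matrix ι ι (Zg Γ)) : cct c (M * M') = cct c (M' * M) := by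
  simp only [cct_apply, Matrix.mul_apply, map_sum]
  rw [Finset.sum_comm]
  exact Finset.sum_congr rfl fun i _ => Finset.sum_congr rfl fun j _ => ccInd_mul _ _ _

lemma matrix_eq_sum (M : Matrix ι ι (Zg Γ)) (s : Finset Γ) (hs : ∀ i j, (M i j).coeff.support ⊆ s) :
    M = ∑ x ∈ (Finset.univ ×ˢ Finset.univ ×ˢ s : Finset (ι × ι × Γ)),
      Matrix.single x.1 x.2.1 (((M x.1 x.2.1).coeff x.2.2) • gr x.2.2) := by
  simp only [Finset.sum_product]
  conv_lhs => rw [Matrix.matrix_eq_sum_single M]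
  refine Finset.sum_congr rfl fun i _ => Finset.sum_congr rfl fun j _ => ?_
  have : M i j = ∑ g ∈ s, (M i j).coeff g • gr g := by
    conv_lhs => rw [zg_eq_sum (M i j)]
    refine Finset.sum_subset (hs i j) fun g _ hg => ?_
    simp only [Finsupp.mem_support_iff, not_not] at hg
    rw [hg, zero_smul]
  conv_lhs => rw [this]
  exact map_sum (Matrix.singleAddMonoidHom i j) _ _

lemma single_pow_ne {i j : ι} (hij : i ≠ j) (r : Zg Γ) (n : ℕ) (hn : 2 ≤ n) :
    (Matrix.single i j r) ^ n = 0 := by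
  obtain ⟨m, rfl⟩ := Nat.exists_eq_add_of_le hn
  rw [pow_add, pow_two, Matrix.single_mul_single_of_ne _ _ _ _ hij.symm, zero_mul]

lemma single_pow_eq (i : ι) (r : Zg Γ) (n : ℕ) (hn : 1 ≤ n) :
    (Matrix.single i i r) ^ n = Matrix.single i i (r ^ n) := by
  induction n, hn using Nat.le_induction with
  | base => simp
  | succ n hn ih => rw [pow_succ, ih, Matrix.single_mul_single_same, pow_succ]

lemma gr_pow (g : Γ) (n : ℕ) : gr (g ^ n) = gr g ^ n := by
  induction n with
  | zero => simp [gr_one]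
  | succ n ih => rw [pow_succ, pow_succ, gr_mul, ih]

/-- Frobenius congruence for idempotents -/
lemma cct_frob (E : Matrix ι ι (Zg Γ)) (hE : E * E = E) (p : ℕ) [Fact p.Prime] (c : ConjClasses Γ) :
    ((cct c E : ℤ) : ZMod p) = ((∑ i, zlift (fun g => ccInd c (g ^ p)) (E i i) : ℤ) : ZMod p) := by
  classical
  have hp : p.Prime := Fact.out
  let τ : Matrix ι ι (Zg Γ) →+ ZMod p := (Int.castAddHom (ZMod p)).comp (cct c)
  have hτ : ∀ a b, τ (a * b) = τ (b * a) := by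
    intro a b; simp only [τ, AddMonoidHom.comp_apply, cct_mul c a b]
  have hEp : ∀ n, E ^ (n + 1) = E := by
    intro n
    induction n with
    | zero => simp
    | succ n ih => rw [pow_succ, ih, hE]
  have hEp' : E ^ p = E := by
    have := hEp (p - 1)
    rwa [Nat.sub_add_cancel hp.pos] at this
  let s : Finset Γ := Finset.univ.biUnion fun x : ι × ι => (E x.1 x.2).coeff.support
  have hs : ∀ i j, (E i j).coeff.support ⊆ s := fun i j g hg =>
    Finset.mem_biUnion.2 ⟨(i, j), Finset.mem_univ _, hg⟩
  have h1 : τ E = ∑ x ∈ (Finset.univ ×ˢ Finset.univ ×ˢ s : Finset (ι × ι × Γ)),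
      τ ((Matrix.single x.1 x.2.1 (((E x.1 x.2.1).coeff x.2.2) • gr x.2.2)) ^ p) := by
    rw [← frob_sum τ hτ, ← matrix_eq_sum E s hs, hEp']
  change τ E = _
  rw [h1]
  simp only [Finset.sum_product]
  rw [Int.cast_sum]
  refine Finset.sum_congr rfl fun i _ => ?_
  rw [Finset.sum_eq_single i]
  · have hx : zlift (fun g => ccInd c (g ^ p)) (E i i) = ∑ g ∈ s, (E i i).coeff g • ccInd c (g ^ p) := by
      rw [zlift_apply]
      exact Finsupp.sum_of_support_subset _ (hs i i) _ (fun g _ => zero_smul _ _)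
    rw [hx, Int.cast_sum]
    refine Finset.sum_congr rfl fun g _ => ?_
    rw [single_pow_eq _ _ _ hp.pos, smul_pow, ← gr_pow]
    change ((cct c _ : ℤ) : ZMod p) = _
    have : cct c (Matrix.single i i (((E i i).coeff g ^ p) • gr (g ^ p))) = (E i i).coeff g ^ p * ccInd c (g ^ p) := by
      rw [cct_apply, Finset.sum_eq_single i]
      · rw [Matrix.single_apply_same, map_zsmul, zlift_gr, smul_eq_mul]
      · intro j _ hj
        rw [Matrix.single_apply_of_ne]
        · simp
        · simp [hj.symm]
      · simp
    rw [this]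
    push_cast
    rw [ZMod.pow_card, smul_eq_mul]; push_cast; rfl
  · intro j _ hj
    refine Finset.sum_eq_zero fun g _ => ?_
    rw [single_pow_ne (Ne.symm hj) _ _ hp.two_le, map_zero]
  · simp

/-- power map on conjugacy classes -/
def ccPow (p : ℕ) : ConjClasses Γ → ConjClasses Γ :=
  Quotient.map (fun g => g ^ p) (fun a b h => by
    have h' : IsConj a b := h
    exact h'.pow p)

lemma ccPow_mk (p : ℕ) (g : Γ) : ccPow p (ConjClasses.mk g) = ConjClasses.mk (g ^ p) := rfl

lemma ccPow_iter (p k : ℕ) (g : Γ) : (ccPow p)^[k] (ConjClasses.mk g) = ConjClasses.mk (g ^ (p ^ k)) := by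
  induction k with
  | zero => simp
  | succ k ih => rw [Function.iterate_succ_apply', ih, ccPow_mk, ← pow_mul, ← pow_succ]

theorem CD1.cct_eq_zero (hN : CD1 Γ) (E : Matrix ι ι (Zg Γ)) (hE : E * E = E) (c : ConjClasses Γ)
    (hc : c ≠ 1) : cct c E = 0 := by
  classical
  let K : Finset (ConjClasses Γ) := Finset.univ.biUnion fun i => (E i i).coeff.support.image ConjClasses.mk
  have hK : ∀ i g, (E i i).coeff g ≠ 0 → ConjClasses.mk g ∈ K := fun i g hg =>
    Finset.mem_biUnion.2 ⟨i, Finset.mem_univ _, Finset.mem_image_of_mem _ (by simpa using hg)⟩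
  have hK' : ∀ c ∉ K, cct c E = 0 := by
    intro c hc
    rw [cct_apply]
    refine Finset.sum_eq_zero fun i _ => ?_
    refine zhom_ext_supp (f := zlift (ccInd c)) (f' := 0) (E i i) fun g hg => ?_
    rw [zlift_gr, ccInd, if_neg]; · rfl
    rintro rfl
    exact hc (hK i g hg)
  let B : ℤ := ∑ i, (E i i).coeff.sum fun _ z => |z|
  have hB : ∀ f : Γ → ℤ, (∀ g, |f g| ≤ 1) → |∑ i, zlift f (E i i)| ≤ B := by
    intro f hf
    refine (Finset.abs_sum_le_sum_abs _ _).trans (Finset.sum_le_sum fun i _ => ?_)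
    rw [zlift_apply]
    refine (Finset.abs_sum_le_sum_abs _ _).trans (Finset.sum_le_sum fun g _ => ?_)
    change |(E i i).coeff g * f g| ≤ |(E i i).coeff g|
    rw [abs_mul]
    exact mul_le_of_le_one_right (abs_nonneg _) (hf _)
  have hind : ∀ c (g : Γ), |ccInd c g| ≤ 1 := by
    intro c g; rw [ccInd]; split_ifs <;> simp
  obtain ⟨p, hpB, hp⟩ := Nat.exists_infinite_primes (2 * B.toNat + 1)
  have : Fact p.Prime := ⟨hp⟩
  have heq : ∀ c, cct c E = ∑ i, zlift (fun g => ccInd c (g ^ p)) (E i i) := by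
    intro c
    have h1 := cct_frob E hE p c
    rw [ZMod.intCast_eq_intCast_iff_dvd_sub] at h1
    have h2 := hB _ (hind c)
    rw [← cct_apply] at h2
    have h3 := hB _ (fun g => hind c (g ^ p))
    have h4 := Int.eq_zero_of_abs_lt_dvd h1 (by
      have := abs_sub (∑ i, zlift (fun g => ccInd c (g ^ p)) (E i i)) (cct c E)
      have : B ≤ B.toNat := Int.self_le_toNat B
      have : ((2 * B.toNat + 1 : ℕ) : ℤ) ≤ p := by exact_mod_cast hpB
      push_cast at this
      linarith)
    linarith
  have hpre : ∀ c, cct c E ≠ 0 → ∃ c', cct c' E ≠ 0 ∧ ccPow p c' = c := by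
    intro c hc
    by_contra hno
    push Not at hno
    apply hc
    rw [heq]
    have : ∀ i, zlift (fun g => ccInd c (g ^ p)) (E i i) =
        ∑ c' ∈ K, (if ccPow p c' = c then 1 else 0) * zlift (ccInd c') (E i i) := by
      intro i
      have := zhom_ext_supp (f := zlift (fun g => ccInd c (g ^ p)))
        (f' := ∑ c' ∈ K, (AddMonoidHom.mulLeft (if ccPow p c' = c then 1 else 0 : ℤ)).comp (zlift (ccInd c')))
        (E i i) (fun g hg => ?_)
      · rw [this]; simp only [AddMonoidHom.finsetSum_apply]; rfl
      · simp only [AddMonoidHom.finsetSum_apply, AddMonoidHom.comp_apply, AddMonoidHom.coe_mulLeft, zlift_gr]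
        rw [Finset.sum_eq_single (ConjClasses.mk g)]
        · rw [ccPow_mk]; simp [ccInd]
        · intro b _ hb; simp [ccInd, Ne.symm hb]
        · intro h; exact absurd (hK i g hg) h
    simp only [this]
    rw [Finset.sum_comm]
    refine Finset.sum_eq_zero fun c' _ => ?_
    rw [← Finset.mul_sum, ← cct_apply]
    by_cases h : ccPow p c' = c
    · have : cct c' E = 0 := by
        by_contra h'; exact hno c' h' h
      rw [this, mul_zero]
    · rw [if_neg h, zero_mul]
  by_contra hne
  let K' := {c : ConjClasses Γ // c ≠ 1 ∧ cct c E ≠ 0}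
  have : Finite K' := by
    refine Finite.of_injective (β := K) (fun c => ⟨c.1, ?_⟩) ?_
    · by_contra h; exact c.2.2 (hK' _ h)
    · intro a b h; exact Subtype.ext (congrArg (fun x : K => x.1) h)
  have hs : ∀ c : K', ∃ c' : K', ccPow p c'.1 = c.1 := by
    intro c
    obtain ⟨c', h1, h2⟩ := hpre c.1 c.2.2
    refine ⟨⟨c', ?_, h1⟩, h2⟩
    rintro rfl
    apply c.2.1
    rw [← h2]
    change ccPow p (ConjClasses.mk 1) = _
    rw [ccPow_mk, one_pow]; rfl
  choose s hs using hs
  have hinj : Function.Injective s := by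
    intro a b h
    apply Subtype.ext
    rw [← hs a, ← hs b, h]
  have hper := Function.Injective.mem_periodicPts hinj (⟨c, hc, hne⟩ : K')
  obtain ⟨k, hk, hper⟩ := hper
  have hit : ∀ k (c : K'), (ccPow p)^[k] (s^[k] c).1 = c.1 := by
    intro k
    induction k with
    | zero => intro c; rfl
    | succ k ih => intro c; rw [Function.iterate_succ_apply', Function.iterate_succ_apply, ← hs c, ih]
  have h1 := hit k ⟨c, hc, hne⟩
  rw [hper.eq] at h1
  obtain ⟨g, rfl⟩ := ConjClasses.mk_surjective c
  simp only at h1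
  rw [ccPow_iter, ConjClasses.mk_eq_mk_iff_isConj] at h1
  obtain ⟨y, hy⟩ := isConj_iff.1 h1.symm
  have hg : g ≠ 1 := by rintro rfl; exact hc rfl
  refine hN.noBS hg (p ^ k : ℕ) ?_ (by rw [zpow_natCast]; exact hy)
  have : 2 ≤ p ^ k := hp.two_le.trans (Nat.le_self_pow (by omega) p)
  exact_mod_cast this

theorem CD1.trace_eq_aug (hN : CD1 Γ) (E : Matrix ι ι (Zg Γ)) (hE : E * E = E) :
    ∑ i, (E i i).coeff 1 = ∑ i, aug (E i i) := by
  classical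
  let K : Finset (ConjClasses Γ) := insert 1
    (Finset.univ.biUnion fun i => (E i i).coeff.support.image ConjClasses.mk)
  have hK : ∀ i g, (E i i).coeff g ≠ 0 → ConjClasses.mk g ∈ K := fun i g hg =>
    Finset.mem_insert_of_mem
      (Finset.mem_biUnion.2 ⟨i, Finset.mem_univ _, Finset.mem_image_of_mem _ (by simpa using hg)⟩)
  have h1 : ∀ i, aug (E i i) = ∑ c ∈ K, zlift (ccInd c) (E i i) := by
    intro i
    have := zhom_ext_supp (f := (aug : Zg Γ →+* ℤ).toAddMonoidHom)
      (f' := ∑ c ∈ K, zlift (ccInd c)) (E i i) (fun g hg => ?_)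
    · simpa [AddMonoidHom.finsetSum_apply] using this
    · rw [AddMonoidHom.finsetSum_apply, Finset.sum_eq_single (ConjClasses.mk g)]
      · rw [zlift_gr]; simp [ccInd, aug_gr]
      · intro b _ hb; simp [zlift_gr, ccInd, Ne.symm hb]
      · intro h; exact absurd (hK i g hg) h
  have h2 : ∀ i, (E i i).coeff 1 = zlift (ccInd 1) (E i i) := by
    intro i
    rw [zlift_apply, Finsupp.sum, Finset.sum_eq_single 1]
    · have : ccInd 1 (1 : Γ) = 1 := by rw [ccInd, if_pos]; rfl
      rw [this]; simp
    · intro g _ hg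
      have : ccInd 1 g = 0 := by
        rw [ccInd, if_neg]
        intro h
        exact hg (isConj_one_right.1 (ConjClasses.mk_eq_mk_iff_isConj.1 h.symm))
      rw [this, smul_zero]
    · intro h; simp only [Finsupp.mem_support_iff, not_not] at h; rw [h, zero_smul]
  simp only [h1, h2]
  conv_rhs => rw [Finset.sum_comm]
  symm
  refine Finset.sum_eq_single (1 : ConjClasses Γ) ?_ ?_
  · intro c _ hc
    exact hN.cct_eq_zero E hE c hc
  · intro h; exact absurd (Finset.mem_insert_self _ _) h

end
end GW

namespace GW
open Filter Topology MonoidAlgebra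

section
variable {Γ : Type*} [Group Γ]

lemma exists_fox {κ : Type*} [Fintype κ] [DecidableEq κ] (a : κ → Γ)
    (ha : Subgroup.closure (Set.range a) = ⊤) (r : Zg Γ)
    (hr : aug r = 0) : ∃ c : κ → Zg Γ, r = ∑ j, c j * (gr (a j) - 1) := by
  have hg : ∀ g : Γ, ∃ c : κ → Zg Γ, gr g - 1 = ∑ j, c j * (gr (a j) - 1) := by
    intro g
    have hg : g ∈ Subgroup.closure (Set.range a) := by rw [ha]; trivial
    induction hg using Subgroup.closure_induction with
    | mem x hx =>
      obtain ⟨j, rfl⟩ := hx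
      refine ⟨fun i => if i = j then 1 else 0, ?_⟩
      simp
    | one => exact ⟨0, by simp [gr_one]⟩
    | mul x y _ _ h1 h2 =>
      obtain ⟨c, hc⟩ := h1; obtain ⟨d, hd⟩ := h2
      refine ⟨fun j => c j + gr x * d j, ?_⟩
      simp only [add_mul, Finset.sum_add_distrib, mul_assoc, ← Finset.mul_sum, ← hc, ← hd, gr_mul]
      noncomm_ring
    | inv x _ h1 =>
      obtain ⟨c, hc⟩ := h1
      refine ⟨fun j => -(gr x⁻¹ * c j), ?_⟩
      simp only [neg_mul, Finset.sum_neg_distrib, mul_assoc, ← Finset.mul_sum, ← hc]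
      rw [mul_sub, gr_inv_mul, mul_one]; abel
  have : ∀ r : Zg Γ, ∃ c : κ → Zg Γ, r - (aug r : ℤ) • 1 = ∑ j, c j * (gr (a j) - 1) := by
    intro r
    induction r using zg_ind with
    | h0 => exact ⟨0, by simp⟩
    | hg g => rw [aug_gr, one_smul]; exact hg g
    | ha r s hr hs =>
      obtain ⟨c, hc⟩ := hr; obtain ⟨d, hd⟩ := hs
      refine ⟨c + d, ?_⟩
      simp only [Pi.add_apply, add_mul, Finset.sum_add_distrib, ← hc, ← hd, map_add, add_smul]
      abel
    | hn r hr =>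
      obtain ⟨c, hc⟩ := hr
      refine ⟨-c, ?_⟩
      simp only [Pi.neg_apply, neg_mul, Finset.sum_neg_distrib, ← hc, map_neg, neg_smul]
      abel
  have := this r
  rwa [hr, zero_smul, sub_zero] at this

lemma CD1.normal (hN : CD1 Γ) {κ : Type*} [Fintype κ] [DecidableEq κ] (a : κ → Γ)
    (ha : Subgroup.closure (Set.range a) = ⊤) : ∃ F : Fam Γ κ, ∀ j, F.q j = gr (a j) - 1 := by
  obtain ⟨n, ⟨F⟩⟩ := hN
  choose c hc using fun k => exists_fox a ha (F.q k) (F.augq k)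
  refine ⟨⟨fun j h => ∑ k, F.D k h * c k j, fun j => gr (a j) - 1, ?_, ?_, ?_⟩, fun _ => rfl⟩
  · intro j g h
    simp only [(F.der _) g h, add_mul, Finset.sum_add_distrib, mul_assoc, Finset.mul_sum]
  · intro j; simp [aug_gr]
  · intro h
    rw [← F.split h]
    simp only [Finset.sum_mul]
    rw [Finset.sum_comm]
    refine Finset.sum_congr rfl fun k _ => ?_
    conv_rhs => rw [hc k, Finset.mul_sum]
    simp only [mul_assoc]

section normal
variable {κ : Type*} [Fintype κ] [DecidableEq κ] {a : κ → Γ} (F : Fam Γ κ)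

lemma zlift_der {D : Γ → Zg Γ} (hD : IsDer D) (r s : Zg Γ) :
    zlift D (r * s) = r * zlift D s + (aug s : ℤ) • zlift D r := by
  induction r using zg_ind with
  | h0 => simp
  | hg g =>
    induction s using zg_ind with
    | h0 => simp
    | hg h => rw [← gr_mul, zlift_gr, zlift_gr, zlift_gr, aug_gr, one_smul, hD]; abel
    | ha r s hr hs => rw [mul_add, map_add, map_add, map_add, hr, hs, mul_add, add_smul]; abel
    | hn r hr => rw [mul_neg, map_neg, map_neg, map_neg, hr, mul_neg, neg_smul]; abel
  | ha r t hr ht => rw [add_mul, map_add, map_add, hr, ht, add_mul, smul_add]; abel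
  | hn r hr => rw [neg_mul, map_neg, map_neg, hr, neg_mul, smul_neg]; abel

/-- the idempotent attached to a normalised family -/
noncomputable def Fam.E (F : Fam Γ κ) (a : κ → Γ) : Matrix κ κ (Zg Γ) := fun i j => F.D j (a i)

lemma Fam.mulE (hF : ∀ j, F.q j = gr (a j) - 1) (j : κ) (h : Γ) : F.D j h = ∑ i, F.D i h * F.E a i j := by
  have h1 := congrArg (zlift (F.D j)) (F.split h)
  rw [map_sum, map_sub, zlift_gr, ← gr_one, zlift_gr, (F.der j).one, sub_zero] at h1
  rw [← h1]
  refine Finset.sum_congr rfl fun i _ => ?_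
  rw [zlift_der (F.der j), F.augq, zero_smul, add_zero, hF, map_sub, zlift_gr, ← gr_one, zlift_gr,
    (F.der j).one, sub_zero]
  rfl

lemma Fam.E_idem (hF : ∀ j, F.q j = gr (a j) - 1) : F.E a * F.E a = F.E a := by
  ext1 i j
  rw [Matrix.mul_apply]
  exact (F.mulE hF j (a i)).symm

end normal

end
end GW

namespace GW
open Filter Topology MonoidAlgebra

section
variable {Γ : Type*} [Group Γ] {ι : Type*} [Fintype ι]

/-- convolution -/
noncomputable def cv (f : Γ × ι → ℝ) (k : Γ) (i : ι) : Zg Γ →+ ℝ := zlift fun h => f (k * h⁻¹, i)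

lemma cv_gr (f : Γ × ι → ℝ) (k : Γ) (i : ι) (a : Γ) : cv f k i (gr a) = f (k * a⁻¹, i) := zlift_gr _ _

lemma cv_one (f : Γ × ι → ℝ) (k : Γ) (i : ι) : cv f k i 1 = f (k, i) := by
  rw [← gr_one, cv_gr]; simp

lemma op_cv (M : Matrix ι ι (Zg Γ)) (f : Hil Γ ι) (k : Γ) (l : ι) :
    op M f (k, l) = ∑ i, cv f k i (M i l) := by
  rw [op_apply]
  refine Finset.sum_congr rfl fun i _ => ?_
  rw [cv, zlift_apply]
  refine Finsupp.sum_congr fun h _ => ?_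
  rw [zsmul_eq_mul, mul_comm]

lemma hil_zero_of_inv {f : Hil Γ ι} {x : Γ} (hx : ∀ n : ℕ, n ≠ 0 → x ^ n ≠ 1) (i : ι)
    (h : ∀ g, f (g * x, i) = f (g, i)) (g : Γ) : f (g, i) = 0 := by
  have h2 : ∀ n : ℕ, f (g * x ^ n, i) = f (g, i) := by
    intro n
    induction n with
    | zero => simp
    | succ n ih => rw [pow_succ, ← mul_assoc, h, ih]
  have hinj : Function.Injective (fun n : ℕ => (g * x ^ n, i)) := by
    intro a b hab
    simp only [Prod.mk.injEq, and_true, mul_right_inj] at hab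
    by_contra hne
    rcases lt_or_gt_of_ne hne with hlt | hlt
    · apply hx (b - a) (by omega)
      rw [← mul_right_inj (x ^ a), ← pow_add, mul_one, hab]; congr 1; omega
    · apply hx (a - b) (by omega)
      rw [← mul_right_inj (x ^ b), ← pow_add, mul_one, ← hab]; congr 1; omega
  have hs := (hasSum_parseval f f).summable
  have := (hs.comp_injective hinj).tendsto_atTop_zero
  simp only [Function.comp_def, h2] at this
  have := tendsto_nhds_unique this tendsto_const_nhds
  simpa using this.symm

open scoped Classical in
/-- restriction of a vector to a level -/
noncomputable def hlev (χ : Γ → ℤ) (l : ℤ) (f : Hil Γ ι) : Hil Γ ι :=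
  ⟨fun p => if χ p.1 = l then f p else 0, by
    have h2 := (lp.memℓp f).summable (by norm_num)
    refine memℓp_gen (Summable.of_nonneg_of_le (fun p => by positivity) (fun p => ?_) h2)
    split_ifs
    · exact le_rfl
    · simp; positivity⟩

open scoped Classical in
lemma hlev_apply (χ : Γ → ℤ) (l : ℤ) (f : Hil Γ ι) (p) :
    hlev χ l f p = if χ p.1 = l then f p else 0 := rfl

lemma nul_nonneg (A : Hil Γ ι →L[ℝ] Hil Γ ι) : 0 ≤ nul A := by
  have h1 : nul (1 : Hil Γ ι →L[ℝ] Hil Γ ι) = 0 := by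
    rw [nul_idem eqv_one (by simp), tr_one, sub_self]
  rw [← h1]
  refine nul_mono fun x hx => ?_
  have : x = 0 := hx
  rw [this, map_zero]

lemma nul_le_card (A : Hil Γ ι →L[ℝ] Hil Γ ι) : nul A ≤ Fintype.card ι := by
  rw [← nul_zero (Γ := Γ)]
  exact nul_mono fun x _ => by simp

lemma op_smulmul {M M' : Matrix ι ι (Zg Γ)} (f : Hil Γ ι) : op M' (op M f) = op (M * M') f := by
  rw [← op_mul]; rfl

end

section rank
variable {Γ : Type*} [Group Γ]

lemma op_diag_adj (P : Matrix (Fin 2) (Fin 2) (Zg Γ)) (hP : mstar P = P) : (op P).adjoint = op P := by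
  rw [op_adjoint, hP]

/-- projections -/
noncomputable def P0 : Matrix (Fin 2) (Fin 2) (Zg Γ) := !![1, 0; 0, 0]
noncomputable def P1 : Matrix (Fin 2) (Fin 2) (Zg Γ) := !![0, 0; 0, 1]

lemma inv_one' : (MonoidAlgebra.mapDomain (·⁻¹) (1 : Zg Γ)) = 1 := by
  classical
  apply zg_ext
  intro g
  rw [coeff_mapDomain_inv, ← gr_one, coeff_gr, coeff_gr]
  simp [eq_comm]

lemma inv_zero' : (MonoidAlgebra.mapDomain (·⁻¹) (0 : Zg Γ)) = 0 := by
  apply zg_ext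
  intro g
  rw [coeff_mapDomain_inv]; simp

lemma inv_gr (a : Γ) : (MonoidAlgebra.mapDomain (·⁻¹) (gr a - 1)) = gr a⁻¹ - 1 := by
  classical
  apply zg_ext
  intro g
  rw [coeff_mapDomain_inv, coeff_sub, coeff_sub, Finsupp.sub_apply, Finsupp.sub_apply, ← gr_one, coeff_gr,
    coeff_gr, coeff_gr, coeff_gr]
  have : a = g⁻¹ ↔ a⁻¹ = g := by constructor <;> (rintro rfl; simp)
  have h2 : 1 = g ↔ g = 1 := eq_comm
  simp [this, h2]

lemma P0_star : mstar (P0 : Matrix (Fin 2) (Fin 2) (Zg Γ)) = P0 := by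
  ext1 i j
  fin_cases i <;> fin_cases j <;> simp [mstar, P0, inv_one']

lemma P1_star : mstar (P1 : Matrix (Fin 2) (Fin 2) (Zg Γ)) = P1 := by
  ext1 i j
  fin_cases i <;> fin_cases j <;> simp [mstar, P1, inv_one']

lemma coeff_one_one : ((1 : Zg Γ).coeff 1) = 1 := by
  classical
  rw [← gr_one, coeff_gr, if_pos rfl]

lemma nul_P0 : nul (op (P0 : Matrix (Fin 2) (Fin 2) (Zg Γ))) = 1 := by
  rw [nul_idem (op_eqv _), tr_op]
  · simp [P0]; norm_num
  · rw [op_mul]; congr 1; ext1 i j; fin_cases i <;> fin_cases j <;> simp [P0]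

lemma nul_P1 : nul (op (P1 : Matrix (Fin 2) (Fin 2) (Zg Γ))) = 1 := by
  rw [nul_idem (op_eqv _), tr_op]
  · simp [P1]; norm_num
  · rw [op_mul]; congr 1; ext1 i j; fin_cases i <;> fin_cases j <;> simp [P1]

lemma P0_apply (f : Hil Γ (Fin 2)) (h : ∀ g, f (g, 0) = 0) : op P0 f = 0 := by
  apply hil_ext
  intro g j
  rw [op_cv]
  fin_cases j <;> simp [P0, cv_one, h]

theorem rank_lemma (hN : CD1 Γ) {a : Fin 2 → Γ} (F : Fam Γ (Fin 2)) (hF : ∀ j, F.q j = gr (a j) - 1)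
    (hn : nul (op (F.E a)) = 1) {i₀ : Fin 2} (hi₀ : a i₀ ≠ 1) {χ : Γ → ℤ} (hχ : IsHomZ χ) {x₀ : Γ}
    (hx₀ : x₀ ≠ 1) (hx : χ x₀ = 0) (j : Fin 2) (k : ℤ) (hk : lev χ k (F.D j x₀) = 0) (m : Γ)
    (hm : χ m = 0) : lev χ k (F.D j m) = 0 := by
  let Mt : Matrix (Fin 2) (Fin 2) (Zg Γ) := !![gr (a 0) - 1, 0; gr (a 1) - 1, 0]
  have hMt0 : ∀ i, Mt i 0 = gr (a i) - 1 := by intro i; fin_cases i <;> rfl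
  have hMt1 : ∀ i, Mt i 1 = 0 := by intro i; fin_cases i <;> rfl
  have hT1 : nul (op Mt) ≤ 1 := by
    rw [← nul_adjoint (op_eqv _), ← nul_P0 (Γ := Γ)]
    refine nul_mono fun f hf => P0_apply f ?_
    rw [op_adjoint] at hf
    refine hil_zero_of_inv (hN.tf hi₀) 0 fun g => ?_
    have h1 := congrArg (fun v : Hil Γ (Fin 2) => v (g, i₀)) hf
    simp only [op_cv, Fin.sum_univ_two] at h1
    have h2 : mstar Mt 0 i₀ = gr (a i₀)⁻¹ - 1 := by
      rw [mstar, hMt0, inv_gr]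
    have h3 : mstar Mt 1 i₀ = 0 := by rw [mstar, hMt1, inv_zero']
    rw [h2, h3, map_sub, cv_gr, cv_one, map_zero, inv_inv, add_zero] at h1
    exact sub_eq_zero.1 h1
  have hEM : F.E a * Mt = Mt := by
    ext1 i l
    rw [Matrix.mul_apply]
    fin_cases l
    · simp only [Fin.zero_eta, hMt0]
      rw [← F.split (a i)]
      exact Finset.sum_congr rfl fun k _ => by rw [hF]; rfl
    · simp [hMt1]
  have hker : ∀ f, op Mt f = 0 → op (F.E a) f = 0 := by
    refine ker_of_nul_eq (op_eqv _) (op_eqv _) (fun f hf => ?_) (by rw [hn]; exact hT1)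
    rw [← hEM, ← op_smulmul, hf, map_zero]
  let Φ : Matrix (Fin 2) (Fin 2) (Zg Γ) := !![F.D 0 x₀, F.D 1 x₀; -F.D 0 m, -F.D 1 m]
  have hΦ0 : ∀ j, Φ 0 j = F.D j x₀ := by intro i; fin_cases i <;> rfl
  have hΦ1 : ∀ j, Φ 1 j = -F.D j m := by intro i; fin_cases i <;> rfl
  have hΦE : Φ * F.E a = Φ := by
    ext1 i l
    rw [Matrix.mul_apply]
    fin_cases i
    · simp only [Fin.zero_eta, hΦ0]; exact (F.mulE hF l x₀).symm
    · simp only [Fin.mk_one, hΦ1, neg_mul, Finset.sum_neg_distrib]; rw [← F.mulE hF l m]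
  let M1 : Matrix (Fin 2) (Fin 2) (Zg Γ) := !![gr x₀ - 1, 0; -(gr m - 1), 0]
  have hM1 : Φ * Mt = M1 := by
    ext1 i l
    rw [Matrix.mul_apply]
    fin_cases l
    · simp only [Fin.zero_eta, hMt0]
      fin_cases i
      · simp only [Fin.zero_eta, hΦ0, ← hF]; exact F.split x₀
      · simp only [Fin.mk_one, hΦ1, neg_mul, Finset.sum_neg_distrib, ← hF]; rw [F.split m]; rfl
    · simp only [Fin.mk_one, hMt1, mul_zero, Finset.sum_const_zero]
      fin_cases i <;> rfl
  have hker1 : ∀ f, op M1 f = 0 → op Φ f = 0 := by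
    intro f hf
    have h1 : op Mt (op Φ f) = 0 := by rw [op_smulmul, hM1, hf]
    have h2 := hker _ h1
    rwa [op_smulmul, hΦE] at h2
  have hM1ap : ∀ (f : Hil Γ (Fin 2)) g, op M1 f (g, 0) =
      f (g * x₀⁻¹, 0) - f (g, 0) - (f (g * m⁻¹, 1) - f (g, 1)) := by
    intro f g
    rw [op_cv, Fin.sum_univ_two]
    change cv f g 0 (gr x₀ - 1) + cv f g 1 (-(gr m - 1)) = _
    rw [map_neg, map_sub, map_sub, cv_gr, cv_gr, cv_one, cv_one]; ring
  have hM1ap' : ∀ (f : Hil Γ (Fin 2)) g, op M1 f (g, 1) = 0 := by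
    intro f g
    rw [op_cv, Fin.sum_univ_two]
    change cv f g 0 0 + cv f g 1 0 = _
    simp
  have hlevker : ∀ l f, op M1 f = 0 → op M1 (hlev χ l f) = 0 := by
    intro l f hf
    apply hil_ext
    intro g i
    fin_cases i
    · have h1 := congrArg (fun v : Hil Γ (Fin 2) => v (g, 0)) hf
      simp only [hM1ap] at h1
      simp only [Fin.zero_eta]
      rw [hM1ap]
      simp only [hlev_apply]
      rw [hχ, hχ, hχ.inv, hχ.inv, hx, hm, neg_zero, add_zero]
      split_ifs
      · exact h1
      · simp
    · exact hM1ap' _ _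
  set w := lev χ k (F.D j m) with hw
  -- the key vanishing
  have hvan : ∀ f, op M1 f = 0 → ∀ g, cv f g 1 w = 0 := by
    intro f hf g
    have h1 := hker1 _ (hlevker (χ g - k) f hf)
    have h2 := congrArg (fun v : Hil Γ (Fin 2) => v (g, j)) h1
    simp only [op_cv, Fin.sum_univ_two, hΦ0, hΦ1] at h2
    have h3 : ∀ i r, cv (hlev χ (χ g - k) f) g i r = cv f g i (lev χ k r) := by
      intro i r
      refine zhom_ext (f := cv (hlev χ (χ g - k) f) g i) (f' := (cv f g i).comp (lev χ k)) (fun h => ?_) r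
      rw [AddMonoidHom.comp_apply, cv_gr, hlev_apply]
      have h4 : lev χ k (gr h) = if χ h = k then gr h else 0 := by
        classical
        apply zg_ext
        intro x
        rw [coeff_levs, coeff_gr]
        by_cases hxh : h = x
        · subst hxh; by_cases hh : χ h = k <;> simp [hh, coeff_gr]
        · by_cases hh : χ h = k <;> simp [hh, coeff_gr, hxh]
      rw [h4, hχ, hχ.inv]
      by_cases hh : χ h = k
      · rw [if_pos hh, if_pos (by omega), cv_gr]
      · rw [if_neg hh, if_neg (by omega), map_zero]
    rw [h3, h3, hk, map_neg, map_zero, zero_add, map_neg] at h2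
    exact neg_eq_zero.1 h2
  let X : Matrix (Fin 2) (Fin 2) (Zg Γ) := !![0, 0; w, 0]
  have hXker : ∀ f, op M1 f = 0 → op X f = 0 := by
    intro f hf
    apply hil_ext
    intro g i
    rw [op_cv, Fin.sum_univ_two]
    fin_cases i
    · change cv f g 0 0 + cv f g 1 w = 0
      rw [hvan f hf g]; simp
    · change cv f g 0 0 + cv f g 1 0 = 0
      simp
  -- conclude
  have hQ1 : 1 ≤ nul (op M1) := by
    rw [← nul_adjoint (op_eqv _), ← nul_P0 (Γ := Γ)]
    refine nul_mono fun f hf => ?_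
    have h1 : M1 = M1 * P0 := by
      ext1 i l
      fin_cases i <;> fin_cases l <;> simp [M1, P0]
    rw [h1, ← op_mul, adjoint_mul', op_diag_adj P0 P0_star, mul_apply_eq_comp, hf, map_zero]
  let K := kp (op M1)
  have hK : Eqv K := (op_eqv _).kp
  let L := op P1 * K
  have hL : Eqv L := (op_eqv _).mul hK
  have hLn : nul L ≤ 1 := by
    have h1 : nul L ≤ nul K := by
      refine nul_mono fun f hf => ?_
      have hf' : op P1 (K f) = 0 := hf
      have hz : op M1 (K f) = 0 := kp_ker _ _
      have hv : ∀ g, K f (g, 1) = 0 := by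
        intro g
        have := congrArg (fun v : Hil Γ (Fin 2) => v (g, 1)) hf'
        simp only [op_cv, Fin.sum_univ_two] at this
        simpa [P1, cv_one] using this
      have hu : ∀ g, K f (g, 0) = 0 := by
        refine hil_zero_of_inv (hN.tf hx₀) 0 fun g => ?_
        have := congrArg (fun v : Hil Γ (Fin 2) => v (g * x₀, 0)) hz
        simp only [hM1ap, hv] at this
        have h5 : K f (g, 0) - K f (g * x₀, 0) = 0 := by simpa using this
        linarith
      apply hil_ext
      intro g i
      fin_cases i
      · exact hu g
      · exact hv g
    have h2 := nul_kp (op_eqv (Γ := Γ) M1)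
    simp only [Fintype.card_fin] at h2
    push_cast at h2
    change nul K = _ at h2
    linarith
  have hLadj : L.adjoint = K * op P1 := by
    rw [adjoint_mul', op_diag_adj P1 P1_star, kp_adjoint]
  have hLker : ∀ f, L.adjoint f = 0 → op P1 f = 0 := by
    refine ker_of_nul_eq (op_eqv _) hL.adjoint (fun f hf => ?_) (by rw [nul_adjoint hL, nul_P1]; exact hLn)
    rw [hLadj, mul_apply_eq_comp, hf, map_zero]
  have hXK : op X * K = 0 := by
    ext1 f
    exact hXker _ (kp_ker _ _)
  have hXK' : K * (op X).adjoint = 0 := by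
    have := congrArg ContinuousLinearMap.adjoint hXK
    rw [adjoint_mul', kp_adjoint, map_zero] at this
    exact this
  have hXS : op P1 * (op X).adjoint = (op X).adjoint := by
    have h1 : X = P1 * X := by
      ext1 i l
      fin_cases i <;> fin_cases l <;> simp [X, P1]
    conv_rhs => rw [h1, ← op_mul, adjoint_mul', op_diag_adj P1 P1_star]
  have hX0 : (op X).adjoint = 0 := by
    ext1 f
    rw [← hXS, mul_apply_eq_comp]
    apply hLker
    rw [hLadj, mul_apply_eq_comp, ← mul_apply_eq_comp (op P1), hXS, ← mul_apply_eq_comp, hXK']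
    rfl
  have hX0' : op X = 0 := by
    rw [← ContinuousLinearMap.adjoint_adjoint (op X), hX0, map_zero]
  have h3 : X = 0 := op_inj (by rw [hX0', op_zero])
  exact congrFun (congrFun h3 1) 0

end rank
end GW

namespace GW
open Filter Topology MonoidAlgebra

/-- evaluation of positive words in two letters -/
def ev {G : Type*} [Group G] (x y : G) (l : List Bool) : G := (l.map (fun b => cond b x y)).prod

lemma ev_cons {G : Type*} [Group G] (x y : G) (b : Bool) (l : List Bool) :
    ev x y (b :: l) = cond b x y * ev x y l := by simp [ev]

lemma ev_nil {G : Type*} [Group G] (x y : G) : ev x y [] = 1 := by simp [ev]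

section
variable {Γ : Type*} [Group Γ]

lemma free_of_E_one {x y : Γ} (Dx Dy : Γ → Zg Γ) (hx : IsDer Dx) (hy : IsDer Dy)
    (h1 : Dx x = 1) (h2 : Dx y = 0) (h3 : Dy x = 0) (h4 : Dy y = 1) : Function.Injective (ev x y) := by
  classical
  have hcons : ∀ b l, (∀ D : Γ → Zg Γ, IsDer D → D (ev x y (b :: l)) =
      D (cond b x y) + gr (cond b x y) * D (ev x y l)) := by
    intro b l D hD; rw [ev_cons, hD]
  have hlen : ∀ l, aug (Dx (ev x y l)) + aug (Dy (ev x y l)) = l.length := by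
    intro l
    induction l with
    | nil => simp [ev_nil, hx.one, hy.one]
    | cons b l ih =>
      rw [hcons b l _ hx, hcons b l _ hy, map_add, map_add, map_mul, map_mul, aug_gr, one_mul, one_mul]
      rw [List.length_cons]; push_cast; rw [← ih]
      cases b <;> simp [h1, h2, h3, h4] <;> ring
  have hnn : ∀ D : Γ → Zg Γ, IsDer D → (D x = 1 ∨ D x = 0) → (D y = 1 ∨ D y = 0) → ∀ l g,
      0 ≤ (D (ev x y l)).coeff g ∧ ((D (ev x y l)).coeff g ≠ 0 → ∃ p, ev x y p = g) := by
    intro D hD hDx hDy l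
    induction l with
    | nil => intro g; simp [ev_nil, hD.one]
    | cons b l ih =>
      intro g
      rw [hcons b l D hD, coeff_add, Finsupp.add_apply, coeff_gr_mul]
      obtain ⟨i1, i2⟩ := ih ((cond b x y)⁻¹ * g)
      have hb : D (cond b x y) = 1 ∨ D (cond b x y) = 0 := by cases b <;> simpa
      have hb1 : 0 ≤ (D (cond b x y)).coeff g ∧ ((D (cond b x y)).coeff g ≠ 0 → g = 1) := by
        rcases hb with hb | hb <;> rw [hb]
        · rw [← gr_one, coeff_gr]; split_ifs with h <;> simp [eq_comm, h]
        · simp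
      refine ⟨by linarith [hb1.1], fun hne => ?_⟩
      by_cases hz : (D (cond b x y)).coeff g = 0
      · rw [hz, zero_add] at hne
        obtain ⟨p, hp⟩ := i2 hne
        exact ⟨b :: p, by rw [ev_cons, hp]; group⟩
      · exact ⟨[], by rw [hb1.2 hz, ev_nil]⟩
  have hone : ∀ l, ev x y l = 1 → l = [] := by
    intro l hl
    have := hlen l
    rw [hl, hx.one, hy.one] at this
    simp at this
    exact List.length_eq_zero_iff.1 (by omega)
  have hdiff : ∀ m m', ev x y (true :: m) ≠ ev x y (false :: m') := by
    intro m m' h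
    have e := congrArg (fun g => (Dx g).coeff 1) h
    simp only [hcons _ _ _ hx, coeff_add, Finsupp.add_apply, coeff_gr_mul, cond_true, cond_false, h1, h2,
      coeff_one_one, mul_one] at e
    have n1 := (hnn Dx hx (Or.inl h1) (Or.inr h2) m x⁻¹).1
    obtain ⟨p, hp⟩ := (hnn Dx hx (Or.inl h1) (Or.inr h2) m' y⁻¹).2 (by
      intro h0; rw [h0] at e; simp at e; omega)
    have := hone (false :: p) (by rw [ev_cons, hp]; simp)
    simp at this
  intro l l' h
  induction l generalizing l' with
  | nil => rw [ev_nil] at h; exact (hone l' h.symm).symm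
  | cons b m ih =>
    cases l' with
    | nil => rw [ev_nil] at h; exact hone _ h
    | cons b' m' =>
      have hbb : b = b' := by
        cases b <;> cases b' <;> first | rfl | exact absurd h (hdiff _ _) | exact absurd h.symm (hdiff _ _)
      subst hbb
      rw [ev_cons, ev_cons] at h
      rw [ih (mul_left_cancel h)]

lemma exists_surj {χ₀ : Γ → ℤ} (h0 : IsHomZ χ₀) {g : Γ} (hg : χ₀ g ≠ 0) :
    ∃ χ : Γ → ℤ, IsHomZ χ ∧ ∃ y, χ y = 1 := by
  let S : AddSubgroup ℤ :=
    { carrier := Set.range χ₀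
      add_mem' := by rintro _ _ ⟨a, rfl⟩ ⟨b, rfl⟩; exact ⟨a * b, h0 _ _⟩
      zero_mem' := ⟨1, h0.one⟩
      neg_mem' := by rintro _ ⟨a, rfl⟩; exact ⟨a⁻¹, h0.inv a⟩ }
  obtain ⟨n, hn⟩ := Int.subgroup_cyclic S
  have hmem : ∀ g, n ∣ χ₀ g := by
    intro g
    have : χ₀ g ∈ S := ⟨g, rfl⟩
    rw [hn, AddSubgroup.mem_closure_singleton] at this
    obtain ⟨k, hk⟩ := this
    exact ⟨k, by rw [← hk, smul_eq_mul, mul_comm]⟩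
  have hn0 : n ≠ 0 := by
    rintro rfl; exact hg (zero_dvd_iff.1 (hmem g))
  choose χ hχ using hmem
  refine ⟨χ, fun a b => ?_, ?_⟩
  · apply mul_left_cancel₀ hn0
    rw [← hχ, h0, hχ a, hχ b]; ring
  · have : n ∈ S := by rw [hn]; exact AddSubgroup.subset_closure rfl
    obtain ⟨y, hy⟩ := this
    refine ⟨y, mul_left_cancel₀ hn0 ?_⟩
    rw [← hχ, hy, mul_one]

theorem CD1.twoGen' (hN : CD1 Γ) (x y : Γ) (hxy : Subgroup.closure {x, y} = ⊤) :
    (∃ (c : Γ) (i j : ℤ), x = c ^ i ∧ y = c ^ j) ∨ Function.Injective (ev x y) := by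
  classical
  let a : Fin 2 → Γ := ![x, y]
  have ha : Subgroup.closure (Set.range a) = ⊤ := by
    rw [← hxy]; congr 1
    ext z; simp [a, eq_comm]; tauto
  obtain ⟨F, hF⟩ := hN.normal a ha
  have hE := F.E_idem hF
  have hopE : op (F.E a) * op (F.E a) = op (F.E a) := by rw [op_mul, hE]
  have htr := hN.trace_eq_aug _ hE
  set d : ℤ := ∑ i, aug (F.E a i i) with hd
  have htr' : tr (op (F.E a)) = d := by
    rw [tr_op, ← htr]; push_cast; rfl
  have hnul : nul (op (F.E a)) = 2 - d := by
    rw [nul_idem (op_eqv _) hopE, htr', Fintype.card_fin]; norm_num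
  have h1 := nul_nonneg (op (F.E a))
  have h2 := nul_le_card (op (F.E a))
  rw [hnul] at h1 h2
  simp only [Fintype.card_fin] at h2
  have hd2 : d ≤ 2 := by
    have : (d : ℝ) ≤ 2 := by linarith
    exact_mod_cast this
  have hd0 : 0 ≤ d := by
    have : (0 : ℝ) ≤ d := by push_cast at h2; linarith
    exact_mod_cast this
  have hcases : d = 0 ∨ d = 1 ∨ d = 2 := by omega
  rcases hcases with hd' | hd' | hd'
  · left
    have h3 : op (F.E a) = 0 := idem_eq_zero (op_eqv _) hopE (by rw [htr', hd']; simp)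
    have h4 : F.E a = 0 := op_inj (by rw [h3, op_zero])
    have h5 : ∀ i, a i = 1 := by
      intro i
      apply gr_inj
      rw [gr_one, ← sub_eq_zero, ← F.split (a i)]
      refine Finset.sum_eq_zero fun j _ => ?_
      have : F.D j (a i) = 0 := congrFun (congrFun h4 i) j
      rw [this, zero_mul]
    exact ⟨1, 0, 0, by simpa [a] using h5 0, by simpa [a] using h5 1⟩
  · left
    have hj : ∃ j, aug (F.D j (a j)) ≠ 0 := by
      by_contra hno
      push Not at hno
      have : d = 0 := by rw [hd]; exact Finset.sum_eq_zero fun i _ => hno i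
      omega
    obtain ⟨j, hj⟩ := hj
    have h0 : IsHomZ (fun g => aug (F.D j g)) := by
      intro g h
      simp only [(F.der j) g h, map_add, map_mul, aug_gr, one_mul]
    obtain ⟨χ, hχ, t, ht⟩ := exists_surj h0 hj
    have haj : a j ≠ 1 := by
      intro h; rw [h, (F.der j).one, map_zero] at hj; exact hj rfl
    by_cases hk : ∃ x₀, x₀ ≠ 1 ∧ χ x₀ = 0
    · obtain ⟨x₀, hx₀, hx0⟩ := hk
      exfalso
      refine core F hχ ht hx0 (hN.tf hx₀) fun j k hk m hm => ?_
      refine rank_lemma hN F hF (by rw [hnul, hd']; norm_num) haj hχ hx₀ hx0 j k hk m hm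
    · push Not at hk
      have : ∀ h, h = t ^ (χ h) := by
        intro h
        by_contra hne
        refine hk (h * (t ^ χ h)⁻¹) ?_ ?_
        · intro h'; exact hne (mul_inv_eq_one.1 h')
        · rw [hχ, hχ.inv, hχ.zpow, ht]; ring
      exact ⟨t, _, _, this x, this y⟩
  · right
    have h3 : op (1 - F.E a) = 0 := by
      refine idem_eq_zero (op_eqv _) ?_ ?_
      · rw [op_mul]; congr 1
        rw [sub_mul, one_mul, mul_sub, mul_one, hE, sub_self, sub_zero]
      · rw [tr_op]
        have : ∀ i, (((1 - F.E a) i i).coeff 1 : ℝ) = 1 - ((F.E a i i).coeff 1 : ℤ) := by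
          intro i
          simp [coeff_sub]
        simp only [this, Finset.sum_sub_distrib]
        rw [← Int.cast_sum, htr, hd']; simp
    have h4 : 1 - F.E a = 0 := op_inj (by rw [h3, op_zero])
    have h5 : ∀ i j, F.D j (a i) = (1 : Matrix (Fin 2) (Fin 2) (Zg Γ)) i j := by
      intro i j; rw [sub_eq_zero.1 h4]; rfl
    refine free_of_E_one (F.D 0) (F.D 1) (F.der 0) (F.der 1) ?_ ?_ ?_ ?_
    · simpa [a] using h5 0 0
    · simpa [a] using h5 1 0
    · simpa [a] using h5 0 1
    · simpa [a] using h5 1 1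

theorem CD1.twoGen (hN : CD1 Γ) (x y : Γ) :
    (∃ (c : Γ) (i j : ℤ), x = c ^ i ∧ y = c ^ j) ∨ Function.Injective (ev x y) := by
  classical
  let L := Subgroup.closure ({x, y} : Set Γ)
  have hL : CD1 L := hN.sub L {x, y} (by simp [L])
  have hx : x ∈ L := Subgroup.subset_closure (by simp)
  have hy : y ∈ L := Subgroup.subset_closure (by simp)
  have hgen : Subgroup.closure ({⟨x, hx⟩, ⟨y, hy⟩} : Set L) = ⊤ := by
    rw [← Subgroup.closure_closure_coe_preimage (k := ({x, y} : Set Γ))]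
    congr 1
    ext ⟨z, hz⟩
    simp
  rcases hL.twoGen' ⟨x, hx⟩ ⟨y, hy⟩ hgen with ⟨c, i, j, h1, h2⟩ | h
  · left
    refine ⟨c, i, j, ?_, ?_⟩
    · simpa using congrArg Subtype.val h1
    · simpa using congrArg Subtype.val h2
  · right
    have hev : ∀ l, ((ev (⟨x, hx⟩ : L) ⟨y, hy⟩ l : L) : Γ) = ev x y l := by
      intro l
      induction l with
      | nil => simp [ev_nil]
      | cons b l ih => rw [ev_cons, ev_cons, Subgroup.coe_mul, ih]; cases b <;> rfl
    intro l l' hl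
    apply h
    apply Subtype.ext
    rw [hev, hev, hl]

end
end GW

namespace GW
open Filter Topology MonoidAlgebra

/-! functions on the group as a bimodule over the group ring -/
section
variable {Γ : Type*} [Group Γ]

/-- left translation of functions -/
def lsh (h : Γ) : (Γ → ℤ) →+ (Γ → ℤ) where
  toFun F g := F (h⁻¹ * g)
  map_zero' := rfl
  map_add' _ _ := rfl

/-- right translation of functions -/
def rsh (h : Γ) : (Γ → ℤ) →+ (Γ → ℤ) where
  toFun F g := F (g * h⁻¹)
  map_zero' := rfl
  map_add' _ _ := rfl

noncomputable def lm : Zg Γ →+ ((Γ → ℤ) →+ (Γ → ℤ)) := zlift lsh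
noncomputable def rm : Zg Γ →+ ((Γ → ℤ) →+ (Γ → ℤ)) := zlift rsh

lemma lm_gr (h : Γ) (F : Γ → ℤ) (g : Γ) : lm (gr h) F g = F (h⁻¹ * g) := by
  rw [lm, zlift_gr]; rfl
lemma rm_gr (h : Γ) (F : Γ → ℤ) (g : Γ) : rm (gr h) F g = F (g * h⁻¹) := by
  rw [rm, zlift_gr]; rfl

lemma lm_one (F : Γ → ℤ) : lm 1 F = F := by
  funext g; rw [← gr_one, lm_gr]; simp

lemma lm_rm (v r : Zg Γ) (F : Γ → ℤ) : lm v (rm r F) = rm r (lm v F) := by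
  induction v using zg_ind with
  | h0 => simp
  | ha v w hv hw => simp [hv, hw]
  | hn v hv => simp [hv]
  | hg g =>
    induction r using zg_ind with
    | h0 => simp
    | ha v w hv hw => simp [hv, hw]
    | hn v hv => simp [hv]
    | hg h => funext k; rw [lm_gr, rm_gr, rm_gr, lm_gr, mul_assoc]

lemma lm_mul (v r : Zg Γ) (F : Γ → ℤ) : lm (v * r) F = lm v (lm r F) := by
  induction v using zg_ind with
  | h0 => simp
  | ha v w hv hw => simp [hv, hw, add_mul]
  | hn v hv => simp [hv]
  | hg g =>
    induction r using zg_ind with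
    | h0 => simp
    | ha v w hv hw => simp [hv, hw, mul_add]
    | hn v hv => simp [hv]
    | hg h => funext k; rw [← gr_mul, lm_gr, lm_gr, lm_gr, mul_inv_rev, mul_assoc]

lemma rm_mul (v r : Zg Γ) (F : Γ → ℤ) : rm (v * r) F = rm r (rm v F) := by
  induction v using zg_ind with
  | h0 => simp
  | ha v w hv hw => simp [hv, hw, add_mul]
  | hn v hv => simp [hv]
  | hg g =>
    induction r using zg_ind with
    | h0 => simp
    | ha v w hv hw => simp [hv, hw, mul_add]
    | hn v hv => simp [hv]
    | hg h => funext k; rw [← gr_mul, rm_gr, rm_gr, rm_gr, mul_inv_rev, mul_assoc]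

/-- the coefficient function -/
noncomputable def cf : Zg Γ →+ (Γ → ℤ) where
  toFun r g := r.coeff g
  map_zero' := rfl
  map_add' r s := by funext g; rw [coeff_add]; rfl

lemma cf_apply (r : Zg Γ) (g : Γ) : cf r g = r.coeff g := rfl

lemma cf_inj {r s : Zg Γ} (h : cf r = cf s) : r = s := zg_ext fun g => congrFun h g

lemma lm_cf (v r : Zg Γ) : lm v (cf r) = cf (v * r) := by
  induction v using zg_ind with
  | h0 => simp
  | ha v w hv hw => simp [hv, hw, add_mul]
  | hn v hv => simp [hv]
  | hg g => funext k; rw [lm_gr, cf_apply, cf_apply, coeff_gr_mul]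

lemma rm_cf (r v : Zg Γ) : rm r (cf v) = cf (v * r) := by
  induction r using zg_ind with
  | h0 => simp
  | ha v w hv hw => simp [hv, hw, mul_add]
  | hn v hv => simp [hv]
  | hg g => funext k; rw [rm_gr, cf_apply, cf_apply, coeff_mul_gr]

lemma rm_apply (r : Zg Γ) (F : Γ → ℤ) (g : Γ) :
    rm r F g = r.coeff.sum fun h z => z * F (g * h⁻¹) := by
  rw [rm, zlift_apply, Finsupp.sum, Finsupp.sum, AddMonoidHom.finsetSum_apply, Finset.sum_apply]
  rfl

lemma lm_apply (r : Zg Γ) (F : Γ → ℤ) (g : Γ) :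
    lm r F g = r.coeff.sum fun h z => z * F (h⁻¹ * g) := by
  rw [lm, zlift_apply, Finsupp.sum, Finsupp.sum, AddMonoidHom.finsetSum_apply, Finset.sum_apply]
  rfl

/-- `rm` only depends on local values -/
lemma rm_congr (r : Zg Γ) (F F' : Γ → ℤ) (g : Γ) (h : ∀ k, r.coeff k ≠ 0 → F (g * k⁻¹) = F' (g * k⁻¹)) :
    rm r F g = rm r F' g := by
  rw [rm_apply, rm_apply]
  exact Finset.sum_congr rfl fun k hk => by
    simp only []
    rw [h k (Finsupp.mem_support_iff.1 hk)]

lemma lm_congr (r : Zg Γ) (F F' : Γ → ℤ) (g : Γ) (h : ∀ k, r.coeff k ≠ 0 → F (k⁻¹ * g) = F' (k⁻¹ * g)) :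
    lm r F g = lm r F' g := by
  rw [lm_apply, lm_apply]
  exact Finset.sum_congr rfl fun k hk => by
    simp only []
    rw [h k (Finsupp.mem_support_iff.1 hk)]

/-- finitely supported functions give group ring elements; junk otherwise -/
noncomputable def mk (F : Γ → ℤ) : Zg Γ :=
  open scoped Classical in
  if h : F.support.Finite then ofCoeff (Finsupp.ofSupportFinite F h) else 0

lemma cf_mk {F : Γ → ℤ} (h : F.support.Finite) : cf (mk F) = F := by
  funext g
  rw [mk, dif_pos h]
  rfl

lemma coeff_mk {F : Γ → ℤ} (h : F.support.Finite) (g : Γ) : (mk F).coeff g = F g := congrFun (cf_mk h) g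

/-- finitely many support points in each level -/
def LF (χ : Γ → ℤ) (F : Γ → ℤ) : Prop := ∀ l : ℤ, {g | χ g = l ∧ F g ≠ 0}.Finite

lemma LF.cf (χ : Γ → ℤ) (r : Zg Γ) : LF χ (cf r) := fun l =>
  (r.coeff.support.finite_toSet).subset fun g hg => by
    simpa [cf_apply] using hg.2

lemma LF.zero (χ : Γ → ℤ) : LF χ 0 := by
  have := LF.cf χ 0
  rwa [map_zero] at this

lemma LF.add {χ F F' : Γ → ℤ} (h : LF χ F) (h' : LF χ F') : LF χ (F + F') := fun l => by
  refine ((h l).union (h' l)).subset fun g hg => ?_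
  by_cases h0 : F g = 0
  · refine Or.inr ⟨hg.1, fun h1 => hg.2 ?_⟩
    rw [Pi.add_apply, h0, h1, add_zero]
  · exact Or.inl ⟨hg.1, h0⟩

lemma LF.neg {χ F : Γ → ℤ} (h : LF χ F) : LF χ (-F) := fun l => by
  refine (h l).subset fun g hg => ⟨hg.1, fun h1 => hg.2 ?_⟩
  rw [Pi.neg_apply, h1, neg_zero]

lemma LF.sum {χ : Γ → ℤ} {κ : Type*} (s : Finset κ) {F : κ → Γ → ℤ} (h : ∀ k, LF χ (F k)) :
    LF χ (∑ k ∈ s, F k) := by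
  classical
  induction s using Finset.induction_on with
  | empty => rw [Finset.sum_empty]; exact LF.zero χ
  | insert a s ha ih => rw [Finset.sum_insert ha]; exact (h a).add ih

lemma LF.lm {χ F : Γ → ℤ} (hχ : IsHomZ χ) (h : LF χ F) (v : Zg Γ) : LF χ (lm v F) := by
  induction v using zg_ind with
  | h0 => rw [map_zero]; exact LF.zero χ
  | ha v w hv hw => rw [map_add]; exact hv.add hw
  | hn v hv => rw [map_neg]; exact hv.neg
  | hg a =>
    intro l
    refine ((h (l - χ a)).image (fun x => a * x)).subset fun g hg => ?_
    obtain ⟨h1, h2⟩ := hg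
    rw [lm_gr] at h2
    exact ⟨a⁻¹ * g, ⟨by rw [hχ, hχ.inv, h1]; ring, h2⟩, by simp⟩

lemma LF.rm {χ F : Γ → ℤ} (hχ : IsHomZ χ) (h : LF χ F) (v : Zg Γ) : LF χ (rm v F) := by
  induction v using zg_ind with
  | h0 => rw [map_zero]; exact LF.zero χ
  | ha v w hv hw => rw [map_add]; exact hv.add hw
  | hn v hv => rw [map_neg]; exact hv.neg
  | hg a =>
    intro l
    refine ((h (l - χ a)).image (fun x => x * a)).subset fun g hg => ?_
    obtain ⟨h1, h2⟩ := hg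
    rw [rm_gr] at h2
    exact ⟨g * a⁻¹, ⟨by rw [hχ, hχ.inv, h1]; ring, h2⟩, by simp⟩

end
end GW

namespace GW
open Filter Topology MonoidAlgebra

section diag
variable {Γ : Type*} [Group Γ] {ι : Type*} [Fintype ι]

open scoped Classical in
/-- coordinate projection matrix -/
noncomputable def dg (Γ : Type*) [Group Γ] (a : ι → Prop) : Matrix ι ι (Zg Γ) :=
  Matrix.diagonal fun i => if a i then 1 else 0

open scoped Classical in
lemma op_dg (a : ι → Prop) (f : Hil Γ ι) (g : Γ) (i : ι) :
    op (dg Γ a) f (g, i) = if a i then f (g, i) else 0 := by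
  rw [op_cv, Finset.sum_eq_single i]
  · rw [dg, Matrix.diagonal_apply_eq]
    split_ifs
    · rw [cv_one]
    · simp
  · intro j _ hj
    rw [dg, Matrix.diagonal_apply_ne _ hj, map_zero]
  · simp

lemma op_dg_zero (a : ι → Prop) (f : Hil Γ ι) :
    op (dg Γ a) f = 0 ↔ ∀ g i, a i → f (g, i) = 0 := by
  classical
  constructor
  · intro h g i hi
    have := op_dg a f g i
    rw [h, if_pos hi] at this
    exact this.symm
  · intro h
    apply hil_ext
    intro g i
    rw [op_dg]
    split_ifs with hi
    · exact h g i hi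
    · rfl

lemma dg_star (a : ι → Prop) : mstar (dg Γ a) = dg Γ a := by
  classical
  ext1 i j
  apply zg_ext
  intro g
  rw [mstar, coeff_mapDomain_inv, dg]
  by_cases h : i = j
  · subst h
    rw [Matrix.diagonal_apply_eq]
    split_ifs
    · rw [← gr_one, coeff_gr, coeff_gr]; simp [eq_comm]
    · rfl
  · rw [Matrix.diagonal_apply_ne _ h, Matrix.diagonal_apply_ne _ (Ne.symm h)]; rfl

open scoped Classical in
lemma nul_dg (a : ι → Prop) : nul (op (dg Γ a)) = ((Finset.univ.filter fun i => ¬ a i).card : ℝ) := by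
  rw [nul_idem (op_eqv _), tr_op]
  · have h1 : ∀ i, (((dg Γ a) i i).coeff 1 : ℝ) = if a i then 1 else 0 := by
      intro i
      rw [dg, Matrix.diagonal_apply_eq]
      split_ifs
      · rw [coeff_one_one]; simp
      · simp
    simp only [h1]
    rw [Finset.sum_boole, sub_eq_iff_eq_add, ← Nat.cast_add, add_comm,
      Finset.card_filter_add_card_filter_not, Finset.card_univ]
  · rw [op_mul]; congr 1
    rw [dg, Matrix.diagonal_mul_diagonal]
    congr 1; funext i; split_ifs <;> simp

lemma dg_pos {a : ι → Prop} {i : ι} (h : a i) : dg Γ a i i = 1 := by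
  classical
  rw [dg, Matrix.diagonal_apply_eq, if_pos h]

lemma dg_neg {a : ι → Prop} {i : ι} (h : ¬ a i) (j : ι) : dg Γ a i j = 0 := by
  classical
  by_cases hij : i = j
  · subst hij; rw [dg, Matrix.diagonal_apply_eq, if_neg h]
  · rw [dg, Matrix.diagonal_apply_ne _ hij]

lemma dg_ne {a : ι → Prop} {i j : ι} (h : i ≠ j) : dg Γ a i j = 0 := by
  classical
  rw [dg, Matrix.diagonal_apply_ne _ h]

lemma nul_dg_le {a : ι → Prop} (s : Finset ι) (h : ∀ i, ¬ a i → i ∈ s) : nul (op (dg Γ a)) ≤ s.card := by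
  classical
  rw [nul_dg]
  norm_cast
  exact Finset.card_le_card fun i hi => h i (by simpa using hi)
end diag

section block
variable {G : Type*} [Group G]

/-- block of a function -/
noncomputable def bl (N : Subgroup G) (t : G) (k m : ℤ) (F : G → ℤ) : Zg N :=
  mk fun h : N => F (t ^ (-k) * h * t ^ m)

lemma bl_coeff {N : Subgroup G} {χ : G → ℤ} (hχ : IsHomZ χ) (hN : ∀ g, g ∈ N ↔ χ g = 0)
    {t : G} (ht : χ t = 1) (k m : ℤ) {F : G → ℤ} (hF : LF χ F) (h : N) :
    (bl N t k m F).coeff h = F (t ^ (-k) * h * t ^ m) := by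
  rw [bl, coeff_mk]
  refine Set.Finite.of_finite_image (f := fun h : N => t ^ (-k) * h * t ^ m)
    ((hF (m - k)).subset ?_) ?_
  · rintro _ ⟨h, hh, rfl⟩
    refine ⟨?_, hh⟩
    simp only []
    rw [hχ, hχ, hχ.zpow, hχ.zpow, ht, (hN _).1 h.2]; ring
  · intro a _ b _ hab
    simpa using hab

open scoped Classical in
/-- block of a ring element -/
noncomputable def bz (N : Subgroup G) (t : G) (m l : ℤ) : Zg G →+ Zg N :=
  zlift fun g => if h : t ^ m * g * t ^ (-l) ∈ N then gr ⟨_, h⟩ else 0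

lemma blmul {N : Subgroup G} {χ : G → ℤ} (hχ : IsHomZ χ) (hN : ∀ g, g ∈ N ↔ χ g = 0)
    {t : G} (ht : χ t = 1) {W : ℕ} (k l : ℤ) {F : G → ℤ} (hF : LF χ F)
    (hF0 : ∀ g, F g ≠ 0 → -k ≤ χ g) (r : Zg G) (hr : ∀ g, r.coeff g ≠ 0 → l - χ g < W) :
    ∑ m : Fin W, bl N t k m F * bz N t m l r = bl N t k l (rm r F) := by
  classical
  apply zg_ext
  intro h
  rw [bl_coeff hχ hN ht _ _ (hF.rm hχ r)]
  let f : Zg G →+ ℤ :=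
    { toFun := fun r => (∑ m : Fin W, bl N t k m F * bz N t m l r).coeff h
      map_zero' := by simp
      map_add' := fun r s => by
        rw [← Finsupp.add_apply, ← coeff_add, ← Finset.sum_add_distrib]
        simp only [map_add, mul_add] }
  let f' : Zg G →+ ℤ :=
    { toFun := fun r => rm r F (t ^ (-k) * h * t ^ l)
      map_zero' := by simp
      map_add' := fun r s => by simp }
  refine zhom_ext_supp (f := f) (f' := f') r fun g hg => ?_
  change (∑ m : Fin W, bl N t k m F * bz N t m l (gr g)).coeff h = rm (gr g) F (t ^ (-k) * h * t ^ l)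
  have hlt := hr g hg
  have hmem : ∀ m : ℤ, t ^ m * g * t ^ (-l) ∈ N ↔ m = l - χ g := by
    intro m
    rw [hN, hχ, hχ, hχ.zpow, hχ.zpow, ht]
    constructor <;> intro h <;> linarith
  rw [rm_gr]
  by_cases h0 : 0 ≤ l - χ g
  · obtain ⟨m₀, hm₀⟩ := Int.eq_ofNat_of_zero_le h0
    have hlt' : m₀ < W := by rw [hm₀] at hlt; exact_mod_cast hlt
    rw [Finset.sum_eq_single (⟨m₀, hlt'⟩ : Fin W)]
    · have hm : t ^ (m₀ : ℤ) * g * t ^ (-l) ∈ N := (hmem _).2 hm₀.symm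
      rw [bz, zlift_gr, dif_pos hm, coeff_mul_gr, bl_coeff hχ hN ht _ _ hF]
      congr 1
      simp only [Subgroup.coe_mul, InvMemClass.coe_inv]
      group
    · intro m _ hne
      rw [bz, zlift_gr, dif_neg, mul_zero]
      rw [hmem, hm₀]
      intro h
      apply hne
      ext
      simpa using h
    · simp
  · rw [Finset.sum_eq_zero]
    · symm
      by_contra hne
      have := hF0 _ hne
      rw [hχ, hχ, hχ, hχ.inv, hχ.zpow, hχ.zpow, ht, (hN _).1 h.2] at this
      omega
    · intro m _
      rw [bz, zlift_gr, dif_neg, mul_zero]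
      rw [hmem]
      omega
end block
end GW

namespace GW
open Filter Topology MonoidAlgebra

section stab
variable {G : Type*} [Group G]

open scoped Classical in
/-- the truncated block matrix of `J` -/
noncomputable def TT (N : Subgroup G) (t : G) {n : ℕ} (J : Matrix (Fin n) (Fin n) (Zg G)) (W jb : ℕ) :
    Matrix (Fin W × Fin n) (Fin W × Fin n) (Zg N) :=
  fun p q => if (q.1 : ℕ) + jb < W then bz N t p.1 q.1 (J p.2 q.2) else 0

variable {N : Subgroup G} {χ : G → ℤ} {t : G} {n : ℕ} {J : Matrix (Fin n) (Fin n) (Zg G)} {jb : ℕ}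

lemma row_TT (hχ : IsHomZ χ) (hN : ∀ g, g ∈ N ↔ χ g = 0) (ht : χ t = 1)
    (hJ : ∀ i j g, (J i j).coeff g ≠ 0 → -(jb : ℤ) ≤ χ g) {W : ℕ} (k : ℕ) (F : Fin n → G → ℤ)
    (hF : ∀ q, LF χ (F q)) (hF0 : ∀ q g, F q g ≠ 0 → -(k : ℤ) ≤ χ g) (l : Fin W) (j : Fin n)
    (hl : (l : ℕ) + jb < W) :
    ∑ p : Fin W × Fin n, bl N t k p.1 (F p.2) * TT N t J W jb p (l, j) =
      bl N t k l (∑ q, rm (J q j) (F q)) := by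
  classical
  have h1 : ∀ p : Fin W × Fin n, TT N t J W jb p (l, j) = bz N t p.1 l (J p.2 j) := fun p => by
    rw [TT]; exact if_pos hl
  simp only [h1]
  rw [Fintype.sum_prod_type_right]
  simp only []
  have h2 : ∀ q : Fin n, ∑ m : Fin W, bl N t k m (F q) * bz N t m l (J q j) = bl N t k l (rm (J q j) (F q)) := by
    intro q
    refine blmul hχ hN ht k l (hF q) (hF0 q) _ fun g hg => ?_
    have := hJ _ _ _ hg
    omega
  simp only [h2]
  apply zg_ext
  intro h
  rw [bl_coeff hχ hN ht _ _ (LF.sum _ fun q => (hF q).rm hχ _), coeff_sum, Finsupp.finsetSum_apply,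
    Finset.sum_apply]
  exact Finset.sum_congr rfl fun q _ => bl_coeff hχ hN ht _ _ ((hF q).rm hχ _) _

lemma op_mul_row {ι : Type*} [Fintype ι] {Γ : Type*} [Group Γ] (U T : Matrix ι ι (Zg Γ)) (a : ι)
    (h : ∀ b, ∑ p, U a p * T p b = 0) (x : Γ) : op T (op U (bs x a)) = 0 := by
  rw [op_smulmul]
  apply hil_ext
  intro g b
  rw [op_bs, Matrix.mul_apply, h]
  simp

open scoped Classical in
/-- upper bound on nullity -/
lemma nul_TT_le (hχ : IsHomZ χ) (hN : ∀ g, g ∈ N ↔ χ g = 0) (ht : χ t = 1)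
    (hJ : ∀ i j g, (J i j).coeff g ≠ 0 → -(jb : ℤ) ≤ χ g) {A : Fin n → Fin n → G → ℤ} {c : ℕ}
    (hA0 : ∀ i j g, A i j g ≠ 0 → -(c : ℤ) ≤ χ g) (hA : ∀ i j, LF χ (A i j))
    (hAJ : ∀ i j, ∑ q, rm (J q j) (A i q) = cf (if i = j then 1 else 0)) (W : ℕ) :
    nul (op (TT N t J W jb)) ≤ (n * (c + jb) : ℕ) := by
  let a : Fin W × Fin n → Prop := fun p => c ≤ (p.1 : ℕ) ∧ (p.1 : ℕ) + jb < W
  let AA : Matrix (Fin W × Fin n) (Fin W × Fin n) (Zg N) := fun p q =>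
    if a p then bl N t (p.1 : ℕ) q.1 (A p.2 q.2) else 0
  have hmul : AA * TT N t J W jb = dg N a := by
    ext1 p ⟨l, j⟩
    rw [Matrix.mul_apply]
    by_cases hp : a p
    · simp only [AA, if_pos hp]
      by_cases hl : (l : ℕ) + jb < W
      · rw [row_TT hχ hN ht hJ (p.1 : ℕ) (A p.2) (hA _) (fun q g hg => by
          have := hA0 _ _ _ hg
          have := hp.1
          omega) l j hl, hAJ]
        apply zg_ext
        intro h
        rw [bl_coeff hχ hN ht _ _ (LF.cf χ _), cf_apply]
        by_cases h2 : p.2 = j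
        · rw [if_pos h2]
          by_cases h1 : p.1 = l
          · have hpe : p = (l, j) := Prod.ext h1 h2
            subst hpe
            rw [dg_pos hp, ← gr_one, ← gr_one, coeff_gr, coeff_gr]
            congr 1
            simp only [eq_iff_iff]
            constructor
            · intro h3
              rw [eq_comm, mul_eq_one_iff_eq_inv, ← zpow_neg] at h3
              exact (Subtype.ext (by simpa using h3)).symm
            · rintro rfl
              simp
          · rw [dg_ne (fun h => h1 (by rw [h])), ← gr_one, coeff_gr, if_neg]
            · rfl
            · intro h1'
              apply h1
              have := congrArg χ h1'
              rw [hχ.one, hχ, hχ, hχ.zpow, hχ.zpow, ht, (hN _).1 h.2] at this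
              ext
              omega
        · rw [if_neg h2, dg_ne (fun h => h2 (by rw [h]))]
          rfl
      · rw [Finset.sum_eq_zero, dg_ne]
        · rintro rfl
          exact hl hp.2
        · intro q _
          rw [TT, if_neg hl, mul_zero]
    · simp only [AA, if_neg hp, zero_mul, Finset.sum_const_zero]
      rw [dg_neg hp]
  rw [← nul_adjoint (op_eqv _)]
  have h1 : nul (op (TT N t J W jb)).adjoint ≤ nul (op (dg N a)) := by
    refine nul_mono fun x hx => ?_
    have h2 : (op (dg N a)).adjoint = op (dg N a) := by rw [op_adjoint, dg_star]
    rw [← h2, ← hmul, ← op_mul, adjoint_mul', mul_apply_eq_comp, hx, map_zero]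
  refine h1.trans ?_
  refine (nul_dg_le (((Finset.univ.filter fun m : Fin W => (m : ℕ) < c ∨ W ≤ (m : ℕ) + jb)) ×ˢ
    (Finset.univ : Finset (Fin n))) ?_).trans ?_
  · intro p hp
    rw [Finset.mem_product, Finset.mem_filter]
    refine ⟨⟨Finset.mem_univ _, ?_⟩, Finset.mem_univ _⟩
    by_contra hcon
    push Not at hcon
    exact hp hcon
  norm_cast
  rw [Finset.card_product, Finset.card_univ, Fintype.card_fin, mul_comm]
  refine Nat.mul_le_mul_left _ ?_
  have h3 : (Finset.univ.filter fun m : Fin W => (m : ℕ) < c ∨ W ≤ (m : ℕ) + jb).card =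
      (Finset.image (fun m : Fin W => (m : ℕ))
        (Finset.univ.filter fun m : Fin W => (m : ℕ) < c ∨ W ≤ (m : ℕ) + jb)).card :=
    (Finset.card_image_of_injective _ Fin.val_injective).symm
  rw [h3]
  refine (Finset.card_le_card (t := Finset.range c ∪ Finset.Ico (W - jb) W) ?_).trans ?_
  · intro m hm
    simp only [Finset.mem_image, Finset.mem_filter, Finset.mem_univ, true_and, Finset.mem_union,
      Finset.mem_range, Finset.mem_Ico] at hm ⊢
    obtain ⟨m', h, rfl⟩ := hm
    have := m'.2
    omega
  · refine (Finset.card_union_le _ _).trans ?_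
    simp only [Finset.card_range, Nat.card_Ico]
    omega

/-- lower bound on nullity -/
lemma le_nul_TT (hχ : IsHomZ χ) (hN : ∀ g, g ∈ N ↔ χ g = 0) (ht : χ t = 1)
    (hJ : ∀ i j g, (J i j).coeff g ≠ 0 → -(jb : ℤ) ≤ χ g) {F : Fin n → G → ℤ}
    (hF : ∀ q, LF χ (F q)) (hF0 : ∀ q g, F q g ≠ 0 → 0 ≤ χ g)
    (hFJ : ∀ j, ∑ q, rm (J q j) (F q) = 0) (q₀ : Fin n) (g₀ : G) (hg₀ : χ g₀ = 0) (hq : F q₀ g₀ ≠ 0) :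
    ∃ δ : ℝ, 0 < δ ∧ ∀ W : ℕ, W * δ ≤ nul (op (TT N t J W jb)) := by
  classical
  have hfin : {p : G × Fin n | χ p.1 = 0 ∧ F p.2 p.1 ≠ 0}.Finite := by
    have : {p : G × Fin n | χ p.1 = 0 ∧ F p.2 p.1 ≠ 0} ⊆
        ⋃ q : Fin n, (fun g => (g, q)) '' {g | χ g = 0 ∧ F q g ≠ 0} := by
      rintro ⟨g, q⟩ hp
      exact Set.mem_iUnion.2 ⟨q, g, hp, rfl⟩
    exact (Set.finite_iUnion fun q => (hF q 0).image _).subset this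
  let B : ℝ := ∑ p ∈ hfin.toFinset, (F p.2 p.1 : ℝ) ^ 2
  have hz : (1 : ℝ) ≤ (F q₀ g₀ : ℝ) ^ 2 := by
    have : 1 ≤ (F q₀ g₀) ^ 2 := by
      have := Int.one_le_abs hq
      nlinarith [sq_abs (F q₀ g₀)]
    exact_mod_cast this
  have hB : 1 ≤ B := by
    refine hz.trans ?_
    exact Finset.single_le_sum (f := fun p : G × Fin n => (F p.2 p.1 : ℝ) ^ 2) (fun _ _ => by positivity)
      (by rw [Set.Finite.mem_toFinset]; exact ⟨hg₀, hq⟩ : (g₀, q₀) ∈ hfin.toFinset)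
  refine ⟨1 / B, by positivity, fun W => ?_⟩
  let T := op (TT N t J W jb)
  let Q : ℕ → Hil N (Fin W × Fin n) →L[ℝ] Hil N (Fin W × Fin n) := fun s => op (dg N fun p => (p.1 : ℕ) < s)
  let P : ℕ → Hil N (Fin W × Fin n) →L[ℝ] Hil N (Fin W × Fin n) := fun s => op (dg N fun p => (p.1 : ℕ) = s)
  let TS : ℕ → Hil N (Fin W × Fin n) →L[ℝ] Hil N (Fin W × Fin n) := fun s =>
    T.adjoint * T + (Q s).adjoint * Q s
  have hTS : ∀ s x, TS s x = 0 ↔ T x = 0 ∧ Q s x = 0 := fun s x => ker_sum_sq _ _ _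
  have hTe : ∀ s, Eqv (TS s) := fun s =>
    ((op_eqv _).adjoint.mul (op_eqv _)).add ((op_eqv _).adjoint.mul (op_eqv _))
  let U : Matrix (Fin W × Fin n) (Fin W × Fin n) (Zg N) := fun p q => bl N t (p.1 : ℕ) q.1 (F q.2)
  have step : ∀ s, s < W → nul (TS (s + 1)) + 1 / B ≤ nul (TS s) := by
    intro s hs
    let k : Fin W := ⟨s, hs⟩
    let f := op U (bs 1 (k, q₀))
    have hfa : ∀ h m q, f (h, (m, q)) = F q (t ^ (-(s : ℤ)) * h * t ^ (m : ℤ)) := by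
      intro h m q
      change op U (bs 1 (k, q₀)) (h, (m, q)) = _
      rw [op_bs, inv_one, one_mul]
      change (((bl N t (s : ℕ) m (F q)).coeff h : ℤ) : ℝ) = _
      rw [bl_coeff hχ hN ht _ _ (hF q)]
    have hTf : T f = 0 := by
      refine op_mul_row U _ (k, q₀) (fun b => ?_) 1
      obtain ⟨l, j⟩ := b
      by_cases hl : (l : ℕ) + jb < W
      · have := row_TT (N := N) hχ hN ht hJ (W := W) s F hF (fun q g hg => by have := hF0 _ _ hg; omega) l j hl
        rw [hFJ] at this
        refine this.trans ?_
        apply zg_ext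
        intro h
        rw [bl_coeff hχ hN ht _ _ (LF.zero χ)]
        rfl
      · refine Finset.sum_eq_zero fun p _ => ?_
        rw [TT, if_neg hl, mul_zero]
    have hQf : Q s f = 0 := by
      rw [op_dg_zero]
      rintro h ⟨m, q⟩ hm
      rw [hfa]
      by_contra hne
      have := hF0 q (t ^ (-(s : ℤ)) * h * t ^ (m : ℤ)) (fun h0 => hne (by rw [h0]; simp))
      rw [hχ, hχ, hχ.zpow, hχ.zpow, ht, (hN _).1 h.2] at this
      simp only at hm
      omega
    have hPa : ∀ h m q, P s f (h, (m, q)) = if m = k then (F q (t ^ (-(s : ℤ)) * h * t ^ (s : ℤ)) : ℝ) else 0 := by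
      intro h m q
      rw [op_dg, hfa]
      by_cases hm : m = k
      · subst hm; simp [k]
      · rw [if_neg, if_neg hm]
        intro h; apply hm; ext; exact h
    let h₀ : N := ⟨t ^ (s : ℤ) * g₀ * t ^ (-(s : ℤ)), by rw [hN, hχ, hχ, hχ.zpow, hχ.zpow, hg₀]; ring⟩
    have hval : P s f (h₀, (k, q₀)) = F q₀ g₀ := by
      rw [hPa, if_pos rfl]
      congr 2
      simp only [h₀]
      group
    have hPf : P s f ≠ 0 := by
      intro h0
      rw [h0] at hval
      apply hq
      have h1 : ((F q₀ g₀ : ℤ) : ℝ) = 0 := hval.symm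
      exact_mod_cast h1
    have hnorm : ‖P s f‖ ^ 2 ≤ B := by
      have h1 : ‖P s f‖ ≤ Real.sqrt B := by
        refine lp.norm_le_of_forall_sum_le (by norm_num) (Real.sqrt_nonneg _) fun S => ?_
        have e2 : (2 : ENNReal).toReal = 2 := by norm_num
        rw [e2]
        have e3 : ∀ x : ℝ, x ^ (2 : ℝ) = x ^ 2 := fun x => by exact_mod_cast Real.rpow_natCast x 2
        rw [e3, Real.sq_sqrt (by linarith)]
        have e4 : ∀ p : N × (Fin W × Fin n), ‖P s f p‖ ^ (2 : ℝ) =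
            if p.2.1 = k then (F p.2.2 (t ^ (-(s : ℤ)) * p.1 * t ^ (s : ℤ)) : ℝ) ^ 2 else 0 := by
          rintro ⟨h, m, q⟩
          rw [e3, hPa, Real.norm_eq_abs, sq_abs]
          simp only []
          split_ifs <;> simp
        simp only [e4]
        rw [← Finset.sum_filter]
        have hinj : Set.InjOn (fun p : N × (Fin W × Fin n) => ((t ^ (-(s : ℤ)) * p.1 * t ^ (s : ℤ), p.2.2) : G × Fin n))
            (S.filter fun p => p.2.1 = k) := by
          rintro ⟨h, m, q⟩ hp ⟨h', m', q'⟩ hp' heq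
          simp only [Finset.coe_filter, Set.mem_ofPred_eq] at hp hp'
          simp only [Prod.mk.injEq, mul_left_inj, mul_right_inj] at heq
          rw [Prod.ext_iff, Prod.ext_iff]
          exact ⟨Subtype.ext heq.1, hp.2.trans hp'.2.symm, heq.2⟩
        have := Finset.sum_image (f := fun p : G × Fin n => (F p.2 p.1 : ℝ) ^ 2) hinj
        simp only at this
        rw [← this]
        rw [← Finset.sum_filter_ne_zero]
        refine Finset.sum_le_sum_of_subset_of_nonneg (fun p hp' => ?_) (fun _ _ _ => by positivity)
        obtain ⟨hp, hne⟩ := Finset.mem_filter.1 hp'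
        rw [Set.Finite.mem_toFinset]
        obtain ⟨x, hx, rfl⟩ := Finset.mem_image.1 hp
        refine ⟨?_, fun h0 => hne (by rw [h0]; simp)⟩
        simp only []
        rw [hχ, hχ, hχ.zpow, hχ.zpow, (hN _).1 x.1.2]; ring
      calc ‖P s f‖ ^ 2 ≤ (Real.sqrt B) ^ 2 := by gcongr
        _ = B := Real.sq_sqrt (by linarith)
    have key := nul_drop (T := TS s) (P := P s) (T' := TS (s + 1)) (hTe s) (op_eqv _) (hTe (s + 1)) (fun x => by
      rw [hTS, hTS, op_dg_zero, op_dg_zero, op_dg_zero]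
      constructor
      · rintro ⟨h1, h2⟩
        exact ⟨⟨h1, fun g i hi => h2 g i (by omega)⟩, fun g i hi => h2 g i (by omega)⟩
      · rintro ⟨⟨h1, h2⟩, h3⟩
        refine ⟨h1, fun g i hi => ?_⟩
        rcases Nat.lt_succ_iff_lt_or_eq.1 hi with h | h
        · exact h2 g i h
        · exact h3 g i h) f ((hTS _ _).2 ⟨hTf, hQf⟩) hPf h₀ (k, q₀)
    rw [hval] at key
    have hpos : 0 < ‖P s f‖ ^ 2 := by have := norm_pos_iff.2 hPf; positivity
    have : 1 / B ≤ (F q₀ g₀ : ℝ) ^ 2 / ‖P s f‖ ^ 2 := by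
      gcongr
    linarith
  have hind : ∀ s, s ≤ W → nul (TS s) + s * (1 / B) ≤ nul (TS 0) := by
    intro s
    induction s with
    | zero => intro _; simp
    | succ s ih =>
      intro hs
      have h1 := ih (by omega)
      have h2 := step s (by omega)
      push_cast
      linarith
  have h0 : nul (TS 0) = nul T := nul_congr fun x => by
    rw [hTS, op_dg_zero]
    simp
  have h1 := hind W le_rfl
  have h2 := nul_nonneg (TS W)
  rw [h0] at h1
  linarith

end stab
end GW

namespace GW
open Filter Topology MonoidAlgebra

section
variable {G : Type*} [Group G]

/-- support in levels at least `a` -/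
def Lge (χ : G → ℤ) (a : ℤ) (r : Zg G) : Prop := ∀ g, r.coeff g ≠ 0 → a ≤ χ g

lemma Lge.zero (χ : G → ℤ) (a : ℤ) : Lge χ a 0 := fun _ h => absurd rfl h

lemma Lge.add {χ : G → ℤ} {a : ℤ} {r s : Zg G} (hr : Lge χ a r) (hs : Lge χ a s) : Lge χ a (r + s) := by
  intro g hg
  rw [coeff_add, Finsupp.add_apply] at hg
  by_cases h : r.coeff g = 0
  · exact hs g (by rwa [h, zero_add] at hg)
  · exact hr g h

lemma Lge.neg {χ : G → ℤ} {a : ℤ} {r : Zg G} (hr : Lge χ a r) : Lge χ a (-r) := by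
  intro g hg
  refine hr g fun h => hg ?_
  have := congrFun (map_neg cf r) g
  change (-r).coeff g = - r.coeff g at this
  rw [this, h, neg_zero]

lemma Lge.sum {χ : G → ℤ} {a : ℤ} {κ : Type*} (S : Finset κ) {r : κ → Zg G} (hr : ∀ k, Lge χ a (r k)) :
    Lge χ a (∑ k ∈ S, r k) := by
  classical
  induction S using Finset.induction_on with
  | empty => rw [Finset.sum_empty]; exact Lge.zero _ _
  | insert x S hx ih => rw [Finset.sum_insert hx]; exact (hr x).add ih

lemma Lge.mul {χ : G → ℤ} (hχ : IsHomZ χ) {a b : ℤ} {r s : Zg G} (hr : Lge χ a r) (hs : Lge χ b s) :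
    Lge χ (a + b) (r * s) := by
  intro g hg
  have h1 : (r * s).coeff g = lm r (cf s) g := by rw [lm_cf]; rfl
  rw [h1, lm_apply, Finsupp.sum] at hg
  obtain ⟨h, hh, hne⟩ := Finset.exists_ne_zero_of_sum_ne_zero hg
  have h2 := hr h (Finsupp.mem_support_iff.1 hh)
  have h3 := hs (h⁻¹ * g) (fun h0 => hne (by rw [cf_apply, h0, mul_zero]))
  rw [hχ, hχ.inv] at h3
  linarith

lemma Lge.mono {χ : G → ℤ} {a b : ℤ} {r : Zg G} (hr : Lge χ a r) (h : b ≤ a) : Lge χ b r :=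
  fun g hg => h.trans (hr g hg)

lemma Lge.gr {χ : G → ℤ} (g : G) : Lge χ (χ g) (gr g) := by
  classical
  intro h hh
  rw [coeff_gr] at hh
  by_cases e : g = h
  · rw [e]
  · rw [if_neg e] at hh; exact absurd rfl hh

lemma exists_lge {κ : Type*} [Fintype κ] (χ : G → ℤ) (r : κ → Zg G) : ∃ c : ℕ, ∀ k, Lge χ (-(c : ℤ)) (r k) := by
  classical
  refine ⟨∑ k, ∑ g ∈ (r k).coeff.support, (χ g).natAbs, fun k g hg => ?_⟩
  have h1 : (χ g).natAbs ≤ ∑ g ∈ (r k).coeff.support, (χ g).natAbs :=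
    Finset.single_le_sum (f := fun g => (χ g).natAbs) (fun _ _ => Nat.zero_le _) (Finsupp.mem_support_iff.2 hg)
  have h2 : ∑ g ∈ (r k).coeff.support, (χ g).natAbs ≤ ∑ k, ∑ g ∈ (r k).coeff.support, (χ g).natAbs :=
    Finset.single_le_sum (f := fun k => ∑ g ∈ (r k).coeff.support, (χ g).natAbs) (fun _ _ => Nat.zero_le _)
      (Finset.mem_univ k)
  omega

variable {N : Subgroup G} {χ : G → ℤ} {t : G} {n : ℕ} {J : Matrix (Fin n) (Fin n) (Zg G)}

open scoped Classical in
theorem stable_fin (hχ : IsHomZ χ) (hN : ∀ g, g ∈ N ↔ χ g = 0) (ht : χ t = 1)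
    {A : Fin n → Fin n → G → ℤ} {c : ℕ}
    (hA0 : ∀ i j g, A i j g ≠ 0 → -(c : ℤ) ≤ χ g) (hA : ∀ i j, LF χ (A i j))
    (hAJ : ∀ i j, ∑ q, rm (J q j) (A i q) = cf (if i = j then 1 else 0)) (i j : Fin n) :
    ∑ q, lm (J i q) (A q j) = cf (if i = j then 1 else 0) := by
  obtain ⟨jb, hjb⟩ := exists_lge χ (fun p : Fin n × Fin n => J p.1 p.2)
  have hJ : ∀ i j g, (J i j).coeff g ≠ 0 → -(jb : ℤ) ≤ χ g := fun i j g hg => hjb (i, j) g hg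
  let u : Fin n → Fin n → G → ℤ := fun i j => cf (if i = j then 1 else 0) - ∑ q, lm (J i q) (A q j)
  have huL : ∀ i j, LF χ (u i j) := fun i j => by
    change LF χ (_ - _)
    rw [sub_eq_add_neg]
    exact (LF.cf _ _).add (LF.sum _ fun q => (hA _ _).lm hχ _).neg
  have hu0 : ∀ i j g, u i j g ≠ 0 → -((c + jb : ℕ) : ℤ) ≤ χ g := by
    intro i j g hg
    by_contra hlt
    push Not at hlt
    apply hg
    change cf _ g - (∑ q, lm (J i q) (A q j)) g = 0
    have h1 : (cf (if i = j then (1 : Zg G) else 0)) g = 0 := by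
      split_ifs
      · rw [cf_apply, ← gr_one, coeff_gr, if_neg]
        rintro rfl
        rw [hχ.one] at hlt; omega
      · rfl
    rw [h1, Finset.sum_apply, Finset.sum_eq_zero, sub_zero]
    intro q _
    rw [lm_congr (J i q) (A q j) 0 g, map_zero]; · rfl
    intro k hk
    by_contra hne
    have h2 := hA0 q j _ hne
    have h3 := hJ _ _ _ hk
    rw [hχ, hχ.inv] at h2
    push_cast at hlt
    linarith
  have huJ : ∀ i j, ∑ q, rm (J q j) (u i q) = 0 := by
    intro i j
    simp only [u, map_sub, Finset.sum_sub_distrib, map_sum, ← lm_rm]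
    rw [Finset.sum_comm (f := fun q p => lm (J i p) (rm (J q j) (A p q)))]
    simp only [← map_sum, hAJ, rm_cf, lm_cf]
    rw [← map_sub]
    simp
  suffices h : u i j = 0 by
    exact (sub_eq_zero.1 h).symm
  by_contra hne
  obtain ⟨g₁, hg₁⟩ := Function.ne_iff.1 hne
  -- lowest level in row i
  obtain ⟨l₀, ⟨q₀, g₀, hl₀, hgne⟩, hmin⟩ := Int.exists_least_of_bdd
    (P := fun l => ∃ q g, χ g = l ∧ u i q g ≠ 0)
    ⟨-((c + jb : ℕ) : ℤ), fun l ⟨q, g, h1, h2⟩ => h1 ▸ hu0 _ _ _ h2⟩ ⟨_, j, g₁, rfl, hg₁⟩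
  let F : Fin n → G → ℤ := fun q => lm (gr (t ^ (-l₀))) (u i q)
  have hFa : ∀ q g, F q g = u i q (t ^ l₀ * g) := fun q g => by
    simp only [F]; rw [lm_gr, zpow_neg, inv_inv]
  obtain ⟨δ, hδ, hW⟩ := le_nul_TT (N := N) (F := F) hχ hN ht hJ (fun q => (huL i q).lm hχ _) (fun q g hg => by
      rw [hFa] at hg
      have := hmin _ ⟨q, _, rfl, hg⟩
      rw [hχ, hχ.zpow, ht] at this
      linarith) (fun j => by
      simp only [F, ← lm_rm]
      rw [← map_sum, huJ, map_zero]) q₀ (t ^ (-l₀) * g₀) (by rw [hχ, hχ.zpow, ht, hl₀]; ring) (by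
      rw [hFa]; simpa using hgne)
  have hU := fun W => nul_TT_le (N := N) hχ hN ht hJ hA0 hA hAJ W
  obtain ⟨W, hWb⟩ := exists_nat_gt (((n * (c + jb) : ℕ) : ℝ) / δ)
  rw [div_lt_iff₀ hδ] at hWb
  linarith [hU W, hW W]

lemma exists_series (hχ : IsHomZ χ) {E X : Matrix (Fin n) (Fin n) (Zg G)} (hE : ∀ i j, Lge χ 1 (E i j))
    (h : 1 = E + X * J) : ∃ (A : Fin n → Fin n → G → ℤ) (c : ℕ),
    (∀ i j g, A i j g ≠ 0 → -(c : ℤ) ≤ χ g) ∧ (∀ i j, LF χ (A i j)) ∧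
    ∀ i j, ∑ q, rm (J q j) (A i q) = cf ((1 : Matrix (Fin n) (Fin n) (Zg G)) i j) := by
  classical
  obtain ⟨c, hc⟩ := exists_lge χ (fun p : Fin n × Fin n => X p.1 p.2)
  obtain ⟨jb, hjb⟩ := exists_lge χ (fun p : Fin n × Fin n => J p.1 p.2)
  have hEk : ∀ (k : ℕ) i j, Lge χ k ((E ^ k) i j) := by
    intro k
    induction k with
    | zero =>
      intro i j
      rw [pow_zero]
      by_cases hij : i = j
      · rw [hij, Matrix.one_apply_eq]
        have := Lge.gr (χ := χ) (1 : G)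
        rwa [hχ.one, gr_one] at this
      · rw [Matrix.one_apply_ne hij]; exact Lge.zero _ _
    | succ k ih =>
      intro i j
      rw [pow_succ, Matrix.mul_apply]
      push_cast
      exact Lge.sum _ fun q => (ih i q).mul hχ (hE q j)
  have hEX : ∀ (k : ℕ) i j, Lge χ (k - c) ((E ^ k * X) i j) := by
    intro k i j
    rw [Matrix.mul_apply, sub_eq_add_neg]
    exact Lge.sum _ fun q => (hEk k i q).mul hχ (hc (q, j))
  let AK : ℕ → Matrix (Fin n) (Fin n) (Zg G) := fun K => ∑ k ∈ Finset.range K, E ^ k * X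
  have hAKJ : ∀ K, AK K * J = 1 - E ^ K := by
    intro K
    have h1 : X * J = 1 - E := by rw [eq_sub_iff_add_eq, add_comm]; exact h.symm
    simp only [AK]
    rw [Finset.sum_mul]
    simp only [mul_assoc, h1]
    rw [← Finset.sum_mul, ← neg_sub E 1, mul_neg, geom_sum_mul, neg_sub]
  have hst : ∀ i j g (K : ℕ), χ g < K - c → ∀ K', K ≤ K' → (AK K' i j).coeff g = (AK K i j).coeff g := by
    intro i j g K hg K' hK'
    induction K', hK' using Nat.le_induction with
    | base => rfl
    | succ K' hK' ih =>
      have : AK (K' + 1) i j = AK K' i j + (E ^ K' * X) i j := by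
        simp only [AK]; rw [Finset.sum_range_succ]; rfl
      rw [this, coeff_add, Finsupp.add_apply, ih]
      have h2 : ((E ^ K' * X) i j).coeff g = 0 := by
        by_contra hne
        have := hEX K' i j g hne
        have : (K : ℤ) ≤ K' := by exact_mod_cast hK'
        omega
      rw [h2, add_zero]
  let A : Fin n → Fin n → G → ℤ := fun i j g => (AK (χ g + c + 1).toNat i j).coeff g
  have hA : ∀ i j g (K : ℕ), χ g < K - c → A i j g = (AK K i j).coeff g := by
    intro i j g K hK
    exact (hst i j g _ (by omega) K (by omega)).symm
  have hA0 : ∀ i j g, A i j g ≠ 0 → -(c : ℤ) ≤ χ g := by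
    intro i j g hg
    by_contra hlt
    apply hg
    rw [hA i j g 0 (by push_cast; omega)]
    simp [AK]
  refine ⟨A, c, hA0, ?_, ?_⟩
  · intro i j l
    refine ((AK (l + c + 1).toNat i j).coeff.support.finite_toSet).subset fun g hg => ?_
    obtain ⟨h1, h2⟩ := hg
    subst h1
    simpa [A] using h2
  · intro i j
    funext g
    obtain ⟨K, hK⟩ : ∃ K : ℕ, χ g + jb + c < K := ⟨(χ g + jb + c + 1).toNat, by omega⟩
    rw [Finset.sum_apply]
    have h1 : ∀ q, rm (J q j) (A i q) g = rm (J q j) (cf (AK K i q)) g := by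
      intro q
      refine rm_congr _ _ _ _ fun k hk => ?_
      rw [cf_apply]
      apply hA
      have := hjb (q, j) k hk
      rw [hχ, hχ.inv]
      omega
    simp only [h1, rm_cf]
    rw [← Finset.sum_apply, ← map_sum, ← Matrix.mul_apply, hAKJ, Matrix.sub_apply, map_sub, Pi.sub_apply]
    have h2 : cf ((E ^ K) i j) g = 0 := by
      by_contra hne
      have := hEk K i j g hne
      omega
    rw [h2, sub_zero]

end
end GW

namespace GW
open Filter Topology MonoidAlgebra

section
variable {G : Type*} [Group G]

/-- inclusion of group rings -/
noncomputable def inc (N : Subgroup G) : Zg N →+ Zg G := zlift fun h => gr (h : G)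

lemma inc_gr (N : Subgroup G) (h : N) : inc N (gr h) = gr (h : G) := zlift_gr _ _

lemma inc_coeff (N : Subgroup G) (a : Zg N) (h : N) : (inc N a).coeff h = a.coeff h := by
  classical
  have : cf (inc N a) (h : G) = cf a h := by
    induction a using zg_ind with
    | h0 => simp
    | ha r s hr hs => simp only [map_add, Pi.add_apply, hr, hs]
    | hn r hr => simp only [map_neg, Pi.neg_apply, hr]
    | hg g =>
      rw [inc_gr, cf_apply, cf_apply, coeff_gr, coeff_gr]
      by_cases e : g = h
      · rw [if_pos e, if_pos (by rw [e])]
      · rw [if_neg e, if_neg fun e' => e (Subtype.ext e')]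
  exact this

lemma inc_coeff_not (N : Subgroup G) (a : Zg N) (g : G) (hg : g ∉ N) : (inc N a).coeff g = 0 := by
  classical
  have : cf (inc N a) g = 0 := by
    induction a using zg_ind with
    | h0 => simp
    | ha r s hr hs => simp only [map_add, Pi.add_apply, hr, hs, add_zero]
    | hn r hr => simp only [map_neg, Pi.neg_apply, hr, neg_zero]
    | hg h =>
      rw [inc_gr, cf_apply, coeff_gr, if_neg]
      rintro rfl
      exact hg h.2
  exact this

variable {N : Subgroup G} {χ : G → ℤ} {t : G} {n : ℕ} {J : Matrix (Fin n) (Fin n) (Zg G)}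

lemma levs_inc_mul (hχ : IsHomZ χ) (hN : ∀ g, g ∈ N ↔ χ g = 0) (s : Set ℤ) (a : Zg N) (r : Zg G) :
    levs χ s (inc N a * r) = inc N a * levs χ s r := by
  induction a using zg_ind with
  | h0 => simp
  | ha a b ha hb => simp only [map_add, add_mul, ha, hb]
  | hn a ha => simp only [map_neg, neg_mul, ha]
  | hg h =>
    rw [inc_gr, levs_gr_mul hχ, (hN _).1 h.2]
    simp

open scoped Classical in
/-- retraction along powers of `t` -/
noncomputable def ret (N : Subgroup G) (χ : G → ℤ) (t : G) : Zg G →+ Zg N :=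
  zlift fun g => if h : g * t ^ (-χ g) ∈ N then gr ⟨_, h⟩ else 0

lemma ret_gr (hχ : IsHomZ χ) (hN : ∀ g, g ∈ N ↔ χ g = 0) (ht : χ t = 1) (g : G) :
    ret N χ t (gr g) = gr ⟨g * t ^ (-χ g), by rw [hN, hχ, hχ.zpow, ht]; ring⟩ := by
  rw [ret, zlift_gr, dif_pos]

lemma ret_inc_mul (hχ : IsHomZ χ) (hN : ∀ g, g ∈ N ↔ χ g = 0) (ht : χ t = 1) (a : Zg N) (r : Zg G) :
    ret N χ t (inc N a * r) = a * ret N χ t r := by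
  induction a using zg_ind with
  | h0 => simp
  | ha a b ha hb => simp only [map_add, add_mul, ha, hb]
  | hn a ha => simp only [map_neg, neg_mul, ha]
  | hg h =>
    induction r using zg_ind with
    | h0 => simp
    | ha a b ha hb => simp only [map_add, mul_add, ha, hb]
    | hn a ha => simp only [map_neg, mul_neg, ha]
    | hg g =>
      rw [inc_gr, ← gr_mul, ret_gr hχ hN ht, ret_gr hχ hN ht, ← gr_mul]
      congr 1
      ext
      simp only [Subgroup.coe_mul]
      rw [hχ, (hN _).1 h.2, zero_add, mul_assoc]

lemma ret_mul_t (hχ : IsHomZ χ) (hN : ∀ g, g ∈ N ↔ χ g = 0) (ht : χ t = 1) (r : Zg G) :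
    ret N χ t (r * (gr t - 1)) = 0 := by
  rw [mul_sub, mul_one, map_sub, sub_eq_zero]
  induction r using zg_ind with
  | h0 => simp
  | ha a b ha hb => simp only [map_add, add_mul, ha, hb]
  | hn a ha => simp only [map_neg, neg_mul, ha]
  | hg g =>
    rw [← gr_mul, ret_gr hχ hN ht, ret_gr hχ hN ht]
    congr 1
    ext
    simp only []
    rw [hχ, ht]
    group

lemma aug_ret (hχ : IsHomZ χ) (hN : ∀ g, g ∈ N ↔ χ g = 0) (ht : χ t = 1) (r : Zg G) :
    aug (ret N χ t r) = aug r := by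
  induction r using zg_ind with
  | h0 => simp
  | ha a b ha hb => simp only [map_add, ha, hb]
  | hn a ha => simp only [map_neg, ha]
  | hg g => rw [ret_gr hχ hN ht, aug_gr, aug_gr]

lemma LF.of_neg {χ F : G → ℤ} (h : LF (fun g => -χ g) F) : LF χ F := fun l =>
  (h (-l)).subset fun g hg => ⟨by simp only []; rw [hg.1], hg.2⟩

lemma fin_of_bdd {χ F : G → ℤ} (h : LF χ F) {a b : ℤ} (h1 : ∀ g, F g ≠ 0 → a ≤ χ g ∧ χ g ≤ b) :
    F.support.Finite := by
  have : F.support ⊆ ⋃ l ∈ Finset.Icc a b, {g | χ g = l ∧ F g ≠ 0} := by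
    intro g hg
    rw [Set.mem_iUnion₂]
    exact ⟨χ g, Finset.mem_Icc.2 (h1 g hg), rfl, hg⟩
  exact (Set.Finite.biUnion (Finset.finite_toSet _) fun l _ => h l).subset this

lemma lm_bdd (hχ : IsHomZ χ) (v : Fin n → Zg G) {A : Fin n → G → ℤ} {c : ℤ}
    (hA : ∀ q g, A q g ≠ 0 → c ≤ χ g) : ∃ a : ℤ, ∀ g, (∑ q, lm (v q) (A q)) g ≠ 0 → a ≤ χ g := by
  obtain ⟨b, hb⟩ := exists_lge χ v
  refine ⟨c - b, fun g hg => ?_⟩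
  rw [Finset.sum_apply] at hg
  obtain ⟨q, -, hq⟩ := Finset.exists_ne_zero_of_sum_ne_zero hg
  rw [lm_apply, Finsupp.sum] at hq
  obtain ⟨h, hh, hne⟩ := Finset.exists_ne_zero_of_sum_ne_zero hq
  have h1 := hb q h (Finsupp.mem_support_iff.1 hh)
  have h2 := hA q (h⁻¹ * g) (fun h0 => hne (by rw [h0, mul_zero]))
  rw [hχ, hχ.inv] at h2
  linarith

theorem cd1_of_series (hχ : IsHomZ χ) (hN : ∀ g, g ∈ N ↔ χ g = 0) (ht : χ t = 1)
    {P : Type*} [Group P] (φ : P →* G) (hφ : Function.Surjective φ) (d : P → Fin n → Zg G)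
    (hd : ∀ a b i, d (a * b) i = d a i + gr (φ a) * d b i) (x : Fin n → G)
    (hd1 : ∀ w, ∑ l, d w l * (gr (x l) - 1) = gr (φ w) - 1)
    (hker : ∀ w, φ w = 1 → ∃ z : Fin n → Zg G, ∀ l, d w l = ∑ i, z i * J i l)
    (hJd : ∀ i, ∑ l, J i l * (gr (x l) - 1) = 0 ∨ ∑ l, J i l * (gr (x l) - 1) = gr t - 1)
    {A B : Fin n → Fin n → G → ℤ} {c c' : ℕ}
    (hA0 : ∀ i j g, A i j g ≠ 0 → -(c : ℤ) ≤ χ g) (hA : ∀ i j, LF χ (A i j))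
    (hB0 : ∀ i j g, B i j g ≠ 0 → -(c' : ℤ) ≤ - χ g) (hB : ∀ i j, LF χ (B i j))
    (hAJ : ∀ i j, ∑ q, rm (J q j) (A i q) = cf ((1 : Matrix (Fin n) (Fin n) (Zg G)) i j))
    (hBJ : ∀ i j, ∑ q, rm (J q j) (B i q) = cf ((1 : Matrix (Fin n) (Fin n) (Zg G)) i j))
    (hJA : ∀ i j, ∑ q, lm (J i q) (A q j) = cf ((1 : Matrix (Fin n) (Fin n) (Zg G)) i j))
    (hJB : ∀ i j, ∑ q, lm (J i q) (B q j) = cf ((1 : Matrix (Fin n) (Fin n) (Zg G)) i j)) :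
    CD1 N := by
  classical
  obtain ⟨j1, hj1⟩ := exists_lge χ (fun p : Fin n × Fin n => J p.1 p.2)
  obtain ⟨j2, hj2⟩ := exists_lge (fun g => - χ g) (fun p : Fin n × Fin n => J p.1 p.2)
  let jb := j1 + j2
  have hJ1 : ∀ i j g, (J i j).coeff g ≠ 0 → -(jb : ℤ) ≤ χ g := fun i j g hg => by
    have := hj1 (i, j) g hg; simp only [jb]; push_cast; omega
  have hJ2 : ∀ i j g, (J i j).coeff g ≠ 0 → χ g ≤ jb := fun i j g hg => by
    have : -(j2 : ℤ) ≤ - χ g := hj2 (i, j) g hg; simp only [jb]; push_cast; omega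
  let va : (Fin n → Zg G) → Fin n → G → ℤ := fun v i => ∑ q, lm (v q) (A q i)
  let vb : (Fin n → Zg G) → Fin n → G → ℤ := fun v i => ∑ q, lm (v q) (B q i)
  let fv : (Fin n → Zg G) → Fin n → G → ℤ := fun v i => va v i - vb v i
  have fv_add : ∀ v w i, fv (v + w) i = fv v i + fv w i := by
    intro v w i
    simp only [fv, va, vb, Pi.add_apply, map_add, AddMonoidHom.add_apply, Finset.sum_add_distrib]
    abel
  have fv_smul : ∀ g v i, fv (fun q => gr g * v q) i = lm (gr g) (fv v i) := by
    intro g v i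
    simp only [fv, va, vb, lm_mul, map_sub, map_sum]
  have fv_J : ∀ (z : Fin n → Zg G) i, fv (fun l => ∑ i, z i * J i l) i = 0 := by
    intro z i
    have h1 : ∀ (A : Fin n → Fin n → G → ℤ), (∀ i j, ∑ q, lm (J i q) (A q j) = cf ((1 : Matrix (Fin n) (Fin n) (Zg G)) i j)) →
        ∑ q, lm (∑ i, z i * J i q) (A q i) = ∑ p, lm (z p) (cf ((1 : Matrix (Fin n) (Fin n) (Zg G)) p i)) := by
      intro A hJA
      simp only [map_sum, AddMonoidHom.finsetSum_apply, lm_mul]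
      rw [Finset.sum_comm]
      simp only [← map_sum, hJA]
    simp only [fv, va, vb]
    rw [h1 A hJA, h1 B hJB, sub_self]
  have vLF : ∀ (A : Fin n → Fin n → G → ℤ), (∀ i j, LF χ (A i j)) → ∀ (v : Fin n → Zg G) i,
      LF χ (∑ q, lm (v q) (A q i)) := fun A hA v i => LF.sum _ fun q => (hA q i).lm hχ _
  have fvLF : ∀ v i, LF χ (fv v i) := by
    intro v i
    simp only [fv]
    rw [sub_eq_add_neg]
    exact (vLF A hA v i).add (vLF B hB v i).neg
  have fv_eq : ∀ a b, φ a = φ b → ∀ i, fv (d a) i = fv (d b) i := by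
    intro a b hab i
    obtain ⟨z, hz⟩ := hker (a * b⁻¹) (by rw [map_mul, map_inv, hab, mul_inv_cancel])
    have h1 : d a = d (a * b⁻¹) + d b := by
      funext l
      have := hd (a * b⁻¹) b l
      rw [inv_mul_cancel_right] at this
      rw [this, map_mul, map_inv, hab, mul_inv_cancel, gr_one, one_mul]; rfl
    rw [h1, fv_add, funext hz, fv_J, zero_add]
  choose w hw using hφ
  let D : Fin (2 * jb + 1) × Fin n → N → Zg N := fun p h => bl N t 0 (p.1 : ℕ) (fv (d (w h)) p.2)
  have hD : ∀ p h h', (D p h).coeff h' = fv (d (w h)) p.2 (h' * t ^ ((p.1 : ℕ) : ℤ)) := by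
    intro p h h'
    simp only [D]
    rw [bl_coeff hχ hN ht _ _ (fvLF _ _)]
    simp
  let S : Set ℤ := {k | -(jb : ℤ) ≤ k ∧ k < jb}
  let qq : Fin (2 * jb + 1) × Fin n → Zg G := fun p =>
    ∑ l, levs χ S (gr (t ^ ((p.1 : ℕ) : ℤ)) * J p.2 l) * (gr (x l) - 1)
  refine Fam.cd1 (κ := Fin (2 * jb + 1) × Fin n)
    { D := D, q := fun p => ret N χ t (qq p), der := ?_, augq := ?_, split := ?_ }
  · intro p g h
    have h1 : ∀ i, fv (d (w ↑(g * h))) i = fv (d (w g)) i + lm (gr (g : G)) (fv (d (w h)) i) := by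
      intro i
      rw [fv_eq (w ↑(g * h)) (w g * w h) (by rw [hw, map_mul, hw, hw]; rfl), ← fv_smul, ← fv_add]
      congr 1
      funext l
      rw [hd, hw]; rfl
    apply zg_ext
    intro h'
    rw [coeff_add, Finsupp.add_apply, coeff_gr_mul, hD, hD, hD, h1, Pi.add_apply, lm_gr]
    congr 2
    simp [mul_assoc]
  · intro p
    rw [aug_ret hχ hN ht]
    simp only [qq, map_sum, map_mul, map_sub, aug_gr, map_one, sub_self, mul_zero, Finset.sum_const_zero]
  · intro h
    let v := d (w h)
    let e : Fin n → Zg G := fun i => ∑ k : Fin (2 * jb + 1), inc N (D (k, i) h) * gr (t ^ ((k : ℕ) : ℤ))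
    have he : ∀ i g, (e i).coeff g = if 0 ≤ χ g ∧ χ g ≤ 2 * jb then fv v i g else 0 := by
      intro i g
      simp only [e]
      rw [coeff_sum, Finsupp.finsetSum_apply]
      have hk : ∀ k : ℤ, g * (t ^ k)⁻¹ ∈ N ↔ χ g = k := by
        intro k
        rw [hN, hχ, hχ.inv, hχ.zpow, ht]; constructor <;> intro h <;> linarith
      split_ifs with hg
      · rw [Finset.sum_eq_single (⟨(χ g).toNat, by omega⟩ : Fin (2 * jb + 1))]
        · have hc : (((χ g).toNat : ℕ) : ℤ) = χ g := Int.toNat_of_nonneg hg.1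
          have hm := (hk (((χ g).toNat : ℕ) : ℤ)).2 hc.symm
          rw [coeff_mul_gr]
          simp only []
          rw [inc_coeff N _ ⟨_, hm⟩, hD]
          simp [v]
        · intro k _ hne
          rw [coeff_mul_gr, inc_coeff_not]
          rw [hk]
          intro h; apply hne; ext; simp [h]
        · simp
      · refine Finset.sum_eq_zero fun k _ => ?_
        rw [coeff_mul_gr, inc_coeff_not]
        rw [hk]
        have := k.2
        omega
    -- the correction term
    let Z : Fin n → G → ℤ := fun i g => if χ g < 0 then va v i g else vb v i g
    have hZ : ∀ i, (Z i).support.Finite := by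
      intro i
      obtain ⟨a, ha⟩ := lm_bdd hχ v (A := fun q => A q i) (fun q g hg => hA0 q i g hg)
      obtain ⟨b, hb⟩ := lm_bdd (χ := fun g => - χ g) (fun a b => by simp only []; rw [hχ]; ring) v
        (A := fun q => B q i) (fun q g hg => hB0 q i g hg)
      refine Set.Finite.subset (s := (va v i * fun g => if χ g < 0 then 1 else 0).support ∪
        (vb v i * fun g => if χ g < 0 then 0 else 1).support) (Set.Finite.union ?_ ?_) ?_
      · refine fin_of_bdd (χ := χ) (a := a) (b := 0) (fun l => (vLF A hA v i l).subset fun g hg => ?_) fun g hg => ?_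
        · exact ⟨hg.1, fun h0 => hg.2 (by rw [Pi.mul_apply]; simp only [va]; rw [h0, zero_mul])⟩
        · rw [Pi.mul_apply] at hg
          refine ⟨ha g (left_ne_zero_of_mul hg), ?_⟩
          by_contra hlt
          apply right_ne_zero_of_mul hg
          rw [if_neg]; omega
      · refine fin_of_bdd (χ := χ) (a := 0) (b := -b) (fun l => (vLF B hB v i l).subset fun g hg => ?_) fun g hg => ?_
        · exact ⟨hg.1, fun h0 => hg.2 (by rw [Pi.mul_apply]; simp only [vb]; rw [h0, zero_mul])⟩
        · rw [Pi.mul_apply] at hg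
          have := hb g (left_ne_zero_of_mul hg)
          refine ⟨?_, by omega⟩
          by_contra hlt
          apply right_ne_zero_of_mul hg
          rw [if_pos]; omega
      · intro g hg
        rw [Function.mem_support] at hg
        simp only [Z] at hg
        by_cases hlt : χ g < 0
        · left; rw [Function.mem_support, Pi.mul_apply, if_pos hlt, mul_one]; rwa [if_pos hlt] at hg
        · right; rw [Function.mem_support, Pi.mul_apply, if_neg hlt, mul_one]; rwa [if_neg hlt] at hg
    let z : Fin n → Zg G := fun i => mk (Z i)
    have hz : ∀ i, cf (z i) = Z i := fun i => cf_mk (hZ i)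
    have hvJ : ∀ (A : Fin n → Fin n → G → ℤ), (∀ i j, ∑ q, rm (J q j) (A i q) = cf ((1 : Matrix (Fin n) (Fin n) (Zg G)) i j)) →
        ∀ l, ∑ i, rm (J i l) (∑ q, lm (v q) (A q i)) = cf (v l) := by
      intro A hAJ l
      simp only [map_sum, ← lm_rm]
      rw [Finset.sum_comm]
      simp only [← map_sum, hAJ, lm_cf]
      congr 1
      simp [Matrix.one_apply]
    have main : ∀ l, levs χ S (∑ i, e i * J i l) = v l - ∑ i, z i * J i l := by
      intro l
      apply cf_inj
      funext g
      have h1 : cf (v l - ∑ i, z i * J i l) = ∑ i, rm (J i l) (va v i - Z i) := by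
        rw [map_sub, map_sum]
        simp only [map_sub, Finset.sum_sub_distrib, ← rm_cf, hz]
        rw [← hvJ A hAJ l]
      have h2 : cf (v l - ∑ i, z i * J i l) = ∑ i, rm (J i l) (vb v i - Z i) := by
        rw [map_sub, map_sum]
        simp only [map_sub, Finset.sum_sub_distrib, ← rm_cf, hz]
        rw [← hvJ B hBJ l]
      rw [cf_apply, coeff_levs]
      by_cases hS : χ g ∈ S
      · rw [if_pos hS, h1, Finset.sum_apply, ← cf_apply, map_sum, Finset.sum_apply]
        refine Finset.sum_congr rfl fun i _ => ?_
        rw [← rm_cf]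
        refine rm_congr _ _ _ _ fun k hk => ?_
        have b1 := hJ1 _ _ _ hk
        have b3 : χ (g * k⁻¹) = χ g - χ k := by rw [hχ, hχ.inv]; ring
        obtain ⟨s1, s2⟩ := hS
        rw [cf_apply, he, Pi.sub_apply]
        simp only [Z]
        by_cases h0 : χ (g * k⁻¹) < 0
        · rw [if_pos h0, if_neg (by omega), sub_self]
        · rw [if_neg h0, if_pos (by omega)]; rfl
      · rw [if_neg hS]
        have hS' : χ g < -(jb : ℤ) ∨ (jb : ℤ) ≤ χ g := by
          by_contra hcon
          push Not at hcon
          exact hS hcon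
        rcases hS' with hlt | hge
        · rw [h1, Finset.sum_apply, Finset.sum_eq_zero]
          intro i _
          rw [rm_congr _ _ 0, map_zero]; · rfl
          intro k hk
          have b1 := hJ1 _ _ _ hk
          have b3 : χ (g * k⁻¹) = χ g - χ k := by rw [hχ, hχ.inv]; ring
          rw [Pi.sub_apply]
          simp only [Z]
          rw [if_pos (by omega), sub_self]; rfl
        · rw [h2, Finset.sum_apply, Finset.sum_eq_zero]
          intro i _
          rw [rm_congr _ _ 0, map_zero]; · rfl
          intro k hk
          have b1 := hJ2 _ _ _ hk
          have b3 : χ (g * k⁻¹) = χ g - χ k := by rw [hχ, hχ.inv]; ring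
          rw [Pi.sub_apply]
          simp only [Z]
          rw [if_neg (by omega), sub_self]; rfl
    have hsum : ∑ p : Fin (2 * jb + 1) × Fin n, inc N (D p h) * qq p =
        ∑ l, levs χ S (∑ i, e i * J i l) * (gr (x l) - 1) := by
      simp only [qq, Finset.mul_sum, ← mul_assoc, ← levs_inc_mul hχ hN]
      rw [Finset.sum_comm]
      refine Finset.sum_congr rfl fun l _ => ?_
      rw [← Finset.sum_mul, ← map_sum]
      congr 2
      rw [Fintype.sum_prod_type_right]
      simp only [e, Finset.sum_mul]
    simp only [← ret_inc_mul hχ hN ht]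
    rw [← map_sum, hsum]
    simp only [main, sub_mul, Finset.sum_sub_distrib, Finset.sum_mul]
    rw [Finset.sum_comm]
    simp only [mul_assoc, ← Finset.mul_sum]
    have hv := hd1 (w h)
    rw [hw] at hv
    simp only [v]
    rw [hv, map_sub, map_sum, Finset.sum_eq_zero, sub_zero]
    · have := ret_inc_mul hχ hN ht (gr h - 1) 1
      rw [map_sub, inc_gr, mul_one] at this
      have e1 : inc N 1 = 1 := by rw [← gr_one, inc_gr]; rfl
      have e2 : ret N χ t 1 = 1 := by
        rw [← gr_one, ret_gr hχ hN ht, ← gr_one]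
        congr 1
        ext
        simp [hχ.one]
      rwa [e1, e2, mul_one] at this
    · intro i _
      rcases hJd i with h0 | h0
      · rw [h0]; simp
      · rw [h0]; exact ret_mul_t hχ hN ht _

end
end GW

namespace GW
open Filter Topology MonoidAlgebra

section
variable {G : Type*} [Group G]

lemma exists_fox_der {n : ℕ} (φ : FreeGroup (Fin n) →* G) : ∃ d : FreeGroup (Fin n) → Fin n → Zg G,
    (∀ a b, d (a * b) = d a + gr (φ a) • d b) ∧ ∀ i, d (FreeGroup.of i) = Pi.single i 1 := by
  classical
  let aff : Fin n → Equiv.Perm (Fin n → Zg G) := fun i =>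
    { toFun := fun m => gr (φ (FreeGroup.of i)) • m + Pi.single i 1
      invFun := fun m => gr (φ (FreeGroup.of i))⁻¹ • (m - Pi.single i 1)
      left_inv := fun m => by simp only [add_sub_cancel_right]; rw [smul_smul, gr_inv_mul, one_smul]
      right_inv := fun m => by simp only []; rw [smul_smul, gr_mul_inv, one_smul, sub_add_cancel] }
  let L := FreeGroup.lift aff
  have hL : ∀ w m, L w m = gr (φ w) • m + L w 0 := by
    intro w
    induction w using FreeGroup.induction_on with
    | C1 => intro m; simp [gr_one]
    | of i =>
      intro m
      simp only [L, FreeGroup.lift_apply_of]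
      simp [aff]
    | inv_of i _ =>
      intro m
      simp only [L, map_inv, FreeGroup.lift_apply_of]
      change gr (φ (FreeGroup.of i))⁻¹ • (m - Pi.single i 1) = _ + gr (φ (FreeGroup.of i))⁻¹ • (0 - Pi.single i 1)
      rw [smul_sub, smul_sub, smul_zero, zero_sub, sub_eq_add_neg]
    | mul a b ha hb =>
      intro m
      rw [map_mul, Equiv.Perm.mul_apply, Equiv.Perm.mul_apply, hb, ha, ha (L b 0), map_mul, gr_mul, smul_add, smul_smul,
        add_assoc]
  refine ⟨fun w => L w 0, fun a b => ?_, fun i => ?_⟩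
  · simp only []
    rw [map_mul, Equiv.Perm.mul_apply, hL a, add_comm]
  · simp only [L, FreeGroup.lift_apply_of]
    simp [aff]

variable {n : ℕ} {φ : FreeGroup (Fin n) →* G} {d : FreeGroup (Fin n) → Fin n → Zg G}

lemma d_one (hd : ∀ a b, d (a * b) = d a + gr (φ a) • d b) : d 1 = 0 := by
  have := hd 1 1
  rw [mul_one, map_one, gr_one, one_smul] at this
  simpa using this

lemma d_inv (hd : ∀ a b, d (a * b) = d a + gr (φ a) • d b) (w) : d w⁻¹ = - (gr (φ w)⁻¹ • d w) := by
  have := hd w⁻¹ w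
  rw [inv_mul_cancel, d_one hd, map_inv] at this
  exact eq_neg_of_add_eq_zero_left this.symm

lemma d_aug (hd : ∀ a b, d (a * b) = d a + gr (φ a) • d b) (hd0 : ∀ i, d (FreeGroup.of i) = Pi.single i 1)
    (w) : ∑ l, d w l * (gr (φ (FreeGroup.of l)) - 1) = gr (φ w) - 1 := by
  classical
  induction w using FreeGroup.induction_on with
  | C1 => rw [d_one hd]; simp [gr_one]
  | of i => rw [hd0]; simp [Pi.single_apply]
  | inv_of i h =>
    rw [d_inv hd]
    simp only [Pi.neg_apply, Pi.smul_apply, smul_eq_mul, neg_mul, mul_assoc, Finset.sum_neg_distrib]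
    rw [← Finset.mul_sum, h, mul_sub, gr_inv_mul, map_inv]; simp
  | mul a b ha hb =>
    rw [hd]
    simp only [Pi.add_apply, Pi.smul_apply, smul_eq_mul, add_mul, mul_assoc, Finset.sum_add_distrib]
    rw [← Finset.mul_sum, ha, hb, map_mul, gr_mul]
    simp [mul_sub]

lemma d_ker (hd : ∀ a b, d (a * b) = d a + gr (φ a) • d b) {rels : Set (FreeGroup (Fin n))}
    (hφ : ∀ w, φ w = 1 → w ∈ Subgroup.normalClosure rels) (hr : ∀ r ∈ rels, φ r = 1)
    (V : Submodule (Zg G) (Fin n → Zg G)) (hV : ∀ r ∈ rels, d r ∈ V) (w) (hw : φ w = 1) : d w ∈ V := by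
  let K : Subgroup (FreeGroup (Fin n)) :=
    { carrier := {w | φ w = 1 ∧ d w ∈ V}
      one_mem' := ⟨map_one _, by rw [d_one hd]; exact V.zero_mem⟩
      mul_mem' := fun {a b} ha hb => ⟨by rw [map_mul, ha.1, hb.1, one_mul], by
        rw [hd]; exact V.add_mem ha.2 (V.smul_mem _ hb.2)⟩
      inv_mem' := fun {a} ha => ⟨by rw [map_inv, ha.1, inv_one], by
        rw [d_inv hd]; exact V.neg_mem (V.smul_mem _ ha.2)⟩ }
  have hK : K.Normal := ⟨fun a ha g => ⟨by rw [map_mul, map_mul, ha.1, mul_one, map_inv, mul_inv_cancel], by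
    rw [hd, hd, map_mul, ha.1, mul_one, d_inv hd, smul_neg, smul_smul, gr_mul_inv, one_smul]
    rw [add_comm (d g), add_assoc, add_neg_cancel, add_zero]
    exact V.smul_mem _ ha.2⟩⟩
  have : Subgroup.normalClosure rels ≤ K := Subgroup.normalClosure_le_normal fun r hrr => ⟨hr r hrr, hV r hrr⟩
  exact (this (hφ w hw)).2

lemma rep_pos (hφ : Function.Surjective φ) (hd : ∀ a b, d (a * b) = d a + gr (φ a) • d b)
    (V : Submodule (Zg G) (Fin n → Zg G)) (hker : ∀ w, φ w = 1 → d w ∈ V)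
    {χ : G → ℤ} (hχ : IsHomZ χ) {N : Subgroup G} (hN : ∀ g, g ∈ N ↔ χ g = 0) (hfg : N.FG)
    {wt : FreeGroup (Fin n)} (ht : χ (φ wt) = 1) (hwt : d wt ∈ V) (w : FreeGroup (Fin n)) :
    ∃ v : Fin n → Zg G, (∀ l, Lge χ 1 (v l)) ∧ d w - v ∈ V := by
  classical
  let R : ℤ → FreeGroup (Fin n) → Prop := fun a w => ∃ v : Fin n → Zg G, (∀ l, Lge χ a (v l)) ∧ d w - v ∈ V
  have r1 : ∀ a w w', φ w = φ w' → R a w → R a w' := by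
    rintro a w w' h ⟨v, h1, h2⟩
    refine ⟨v, h1, ?_⟩
    have h3 := hd (w' * w⁻¹) w
    rw [inv_mul_cancel_right, map_mul, map_inv, h, mul_inv_cancel, gr_one, one_smul] at h3
    rw [h3, add_sub_assoc]
    exact V.add_mem (hker _ (by rw [map_mul, map_inv, h, mul_inv_cancel])) h2
  have lgr : ∀ (g : G) a (v : Fin n → Zg G), (∀ l, Lge χ a (v l)) → ∀ l, Lge χ (χ g + a) ((gr g • v) l) :=
    fun g a v h l => (Lge.gr g).mul hχ (h l)
  have r2 : ∀ a w w', χ (φ w) = 0 → R a w → R a w' → R a (w * w') := by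
    rintro a w w' h ⟨v, h1, h2⟩ ⟨v', h1', h2'⟩
    refine ⟨v + gr (φ w) • v', fun l => (h1 l).add ?_, ?_⟩
    · have := lgr (φ w) a v' h1' l
      rwa [h, zero_add] at this
    · rw [hd, add_sub_add_comm, ← smul_sub]
      exact V.add_mem h2 (V.smul_mem _ h2')
  have r3 : ∀ a w, χ (φ w) = 0 → R a w → R a w⁻¹ := by
    rintro a w h ⟨v, h1, h2⟩
    refine ⟨-(gr (φ w)⁻¹ • v), fun l => Lge.neg ?_, ?_⟩
    · have := lgr (φ w)⁻¹ a v h1 l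
      rwa [hχ.inv, h, neg_zero, zero_add] at this
    · rw [d_inv hd, ← neg_sub', ← smul_sub]
      exact V.neg_mem (V.smul_mem _ h2)
  have hwtk : ∀ k : ℕ, d (wt ^ k) ∈ V := by
    intro k
    induction k with
    | zero => rw [pow_zero, d_one hd]; exact V.zero_mem
    | succ k ih => rw [pow_succ, hd]; exact V.add_mem ih (V.smul_mem _ hwt)
  have hwti : ∀ w, d w ∈ V → d w⁻¹ ∈ V := fun w hw => by
    rw [d_inv hd]; exact V.neg_mem (V.smul_mem _ hw)
  have r4 : ∀ a w (k : ℕ), R a w → R (k + a) (wt ^ k * w * (wt ^ k)⁻¹) := by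
    rintro a w k ⟨v, h1, h2⟩
    refine ⟨gr (φ (wt ^ k)) • v, fun l => ?_, ?_⟩
    · have := lgr (φ (wt ^ k)) a v h1 l
      rwa [map_pow, hχ.pow, ht, mul_one, ← map_pow] at this
    · rw [hd, hd]
      have : d (wt ^ k) + gr (φ (wt ^ k)) • d w + gr (φ (wt ^ k * w)) • d (wt ^ k)⁻¹ - gr (φ (wt ^ k)) • v =
        gr (φ (wt ^ k)) • (d w - v) + (d (wt ^ k) + gr (φ (wt ^ k * w)) • d (wt ^ k)⁻¹) := by
        rw [smul_sub]; abel
      rw [this]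
      exact V.add_mem (V.smul_mem _ h2) (V.add_mem (hwtk k) (V.smul_mem _ (hwti _ (hwtk k))))
  have r5 : ∀ a w w', d w' ∈ V → R a w → R a (w * w') := by
    rintro a w w' hw' ⟨v, h1, h2⟩
    refine ⟨v, h1, ?_⟩
    rw [hd, add_sub_right_comm]
    exact V.add_mem h2 (V.smul_mem _ hw')
  obtain ⟨S, hS⟩ := hfg
  choose pr hpr using hφ
  obtain ⟨c, hc⟩ := exists_lge χ (fun p : S × Fin n => d (pr p.1) p.2)
  have hNc : ∀ h ∈ N, R (-(c : ℤ)) (pr h) := by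
    intro h hh
    rw [← hS] at hh
    induction hh using Subgroup.closure_induction with
    | mem y hy => exact ⟨d (pr y), fun l => hc (⟨y, hy⟩, l), by rw [sub_self]; exact V.zero_mem⟩
    | one =>
      refine r1 _ 1 _ (by rw [map_one, hpr]) ⟨0, fun l => Lge.zero _ _, ?_⟩
      rw [d_one hd, sub_zero]; exact V.zero_mem
    | mul x y hx hy h1 h2 =>
      refine r1 _ (pr x * pr y) _ (by rw [map_mul, hpr, hpr, hpr]) (r2 _ _ _ ?_ h1 h2)
      rw [hpr]; exact (hN x).1 (hS ▸ hx)
    | inv x hx h1 =>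
      refine r1 _ (pr x)⁻¹ _ (by rw [map_inv, hpr, hpr]) (r3 _ _ ?_ h1)
      rw [hpr]; exact (hN x).1 (hS ▸ hx)
  have hN1 : ∀ h ∈ N, R 1 (pr h) := by
    intro h hh
    have h1 := hNc ((φ wt ^ (c + 1))⁻¹ * h * φ wt ^ (c + 1)) (by
      rw [hN, hχ, hχ, hχ.inv, (hN h).1 hh]; ring)
    have h2 := r4 _ _ (c + 1) h1
    refine r1 _ _ _ ?_ (by convert h2 using 1; push_cast; ring)
    simp only [map_mul, map_inv, map_pow, hpr]
    group
  -- general element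
  obtain ⟨v, hv, hdv⟩ : ∃ v : FreeGroup (Fin n), χ (φ v) = χ (φ w) ∧ d v ∈ V := by
    rcases Int.eq_nat_or_neg (χ (φ w)) with ⟨k, hk | hk⟩
    · exact ⟨wt ^ k, by rw [map_pow, hχ.pow, ht, hk, mul_one], hwtk k⟩
    · exact ⟨(wt ^ k)⁻¹, by rw [map_inv, hχ.inv, map_pow, hχ.pow, ht, hk, mul_one], hwti _ (hwtk k)⟩
  have h1 := hN1 (φ w * (φ v)⁻¹) (by rw [hN, hχ, hχ.inv, hv]; ring)
  refine r1 _ (pr (φ w * (φ v)⁻¹) * v) w ?_ (r5 _ _ _ hdv h1)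
  rw [map_mul, hpr, inv_mul_cancel_right]

theorem cd1_of_pres {rels : Finset (FreeGroup (Fin n))} (hcard : rels.card < n)
    (e : G ≃* PresentedGroup (rels : Set (FreeGroup (Fin n)))) {χ : G → ℤ} (hχ : IsHomZ χ)
    {N : Subgroup G} (hN : ∀ g, g ∈ N ↔ χ g = 0) (hfg : N.FG) {t : G} (ht : χ t = 1) : CD1 N := by
  classical
  let φ : FreeGroup (Fin n) →* G := e.symm.toMonoidHom.comp (PresentedGroup.mk (rels : Set (FreeGroup (Fin n))))
  have hφs : Function.Surjective φ := e.symm.surjective.comp (PresentedGroup.mk_surjective _)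
  have hφk : ∀ w, φ w = 1 ↔ w ∈ Subgroup.normalClosure (rels : Set (FreeGroup (Fin n))) := by
    intro w
    change e.symm (PresentedGroup.mk _ w) = 1 ↔ _
    rw [EmbeddingLike.map_eq_one_iff]
    exact QuotientGroup.eq_one_iff w
  have hr : ∀ r ∈ (rels : Set (FreeGroup (Fin n))), φ r = 1 := fun r hr =>
    (hφk r).2 (Subgroup.subset_normalClosure hr)
  obtain ⟨d, hd, hd0⟩ := exists_fox_der φ
  obtain ⟨wt, hwt⟩ := hφs t
  -- rows
  let ee := rels.equivFin
  let ws : Fin n → FreeGroup (Fin n) := fun i => if h : (i : ℕ) < rels.card then (ee.symm ⟨i, h⟩ : FreeGroup (Fin n)) else wt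
  let J : Matrix (Fin n) (Fin n) (Zg G) := fun i l => d (ws i) l
  let V : Submodule (Zg G) (Fin n → Zg G) := Submodule.span (Zg G) (Set.range fun i => d (ws i))
  have hVr : ∀ r ∈ (rels : Set (FreeGroup (Fin n))), d r ∈ V := by
    intro r hr
    refine Submodule.subset_span ⟨⟨ee ⟨r, hr⟩, (ee ⟨r, hr⟩).2.trans hcard⟩, ?_⟩
    simp only [ws]
    rw [dif_pos (ee ⟨r, hr⟩).2]
    simp
  have hVt : d wt ∈ V := by
    refine Submodule.subset_span ⟨⟨rels.card, hcard⟩, ?_⟩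
    simp [ws]
  have hker : ∀ w, φ w = 1 → d w ∈ V := d_ker hd (fun w h => (hφk w).1 h) hr V hVr
  have hVz : ∀ v, v ∈ V → ∃ z : Fin n → Zg G, ∀ l, v l = ∑ i, z i * J i l := by
    intro v hv
    obtain ⟨z, hz⟩ := (Submodule.mem_span_range_iff_exists_fun _).1 hv
    refine ⟨z, fun l => ?_⟩
    rw [← hz, Finset.sum_apply]
    rfl
  have ser : ∀ {χ : G → ℤ} (_ : IsHomZ χ) (_ : ∀ g, g ∈ N ↔ χ g = 0) {wt} (_ : χ (φ wt) = 1) (_ : d wt ∈ V),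
      ∃ (A : Fin n → Fin n → G → ℤ) (c : ℕ),
      (∀ i j g, A i j g ≠ 0 → -(c : ℤ) ≤ χ g) ∧ (∀ i j, LF χ (A i j)) ∧
      (∀ i j, ∑ q, rm (J q j) (A i q) = cf ((1 : Matrix (Fin n) (Fin n) (Zg G)) i j)) ∧
      (∀ i j, ∑ q, lm (J i q) (A q j) = cf ((1 : Matrix (Fin n) (Fin n) (Zg G)) i j)) := by
    intro χ hχ hN wt ht hwt
    have h1 := fun i => rep_pos hφs hd V hker hχ hN hfg ht hwt (FreeGroup.of i)
    choose E hE hEV using h1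
    choose X hX using fun i => hVz _ (hEV i)
    have hEX : (1 : Matrix (Fin n) (Fin n) (Zg G)) = Matrix.of E + Matrix.of X * J := by
      ext1 i l
      rw [Matrix.add_apply, Matrix.mul_apply]
      have := hX i l
      rw [hd0, Pi.sub_apply, sub_eq_iff_eq_add'] at this
      refine Eq.trans ?_ this
      rw [Matrix.one_apply, Pi.single_apply]
      by_cases h : i = l
      · rw [if_pos h, if_pos h.symm]
      · rw [if_neg h, if_neg (Ne.symm h)]
    obtain ⟨A, c, h1, h2, h3⟩ := exists_series (J := J) hχ (E := Matrix.of E) (X := Matrix.of X)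
      (fun i j => hE i j) hEX
    have h3' : ∀ i j, cf ((1 : Matrix (Fin n) (Fin n) (Zg G)) i j) = cf (if i = j then 1 else 0) := fun i j => by
      rw [Matrix.one_apply]
    refine ⟨A, c, h1, h2, h3, fun i j => ?_⟩
    rw [h3']
    exact stable_fin (J := J) hχ hN ht h1 h2 (fun i j => by rw [h3, h3']) i j
  obtain ⟨A, c, hA0, hA, hAJ, hJA⟩ := ser hχ hN (wt := wt) (by rw [hwt, ht]) hVt
  obtain ⟨B, c', hB0, hB, hBJ, hJB⟩ := ser (χ := fun g => - χ g) (fun a b => by change -χ (a * b) = -χ a + -χ b; rw [hχ]; ring)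
    (fun g => by rw [hN]; simp) (wt := wt⁻¹) (by rw [map_inv, hwt]; change - χ t⁻¹ = 1; rw [hχ.inv, ht]; rfl) (by
      rw [d_inv hd]; exact V.neg_mem (V.smul_mem _ hVt))
  refine cd1_of_series (J := J) hχ hN ht φ hφs d (fun a b i => by rw [hd]; rfl) (fun l => φ (FreeGroup.of l))
    (d_aug hd hd0) (fun w hw => hVz _ (hker w hw)) (fun i => ?_) hA0 hA hB0 (fun i j => (hB i j).of_neg) hAJ hBJ hJA hJB
  have := d_aug hd hd0 (ws i)
  simp only [J, this]
  by_cases h : (i : ℕ) < rels.card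
  · left
    have : ws i ∈ (rels : Set (FreeGroup (Fin n))) := by
      simp only [ws]; rw [dif_pos h]; exact (ee.symm ⟨i, h⟩).2
    rw [hr _ this, gr_one, sub_self]
  · right
    have : ws i = wt := by simp only [ws]; rw [dif_neg h]
    rw [this, hwt]

/-- positive deficiency gives an epimorphism to the integers -/
theorem exists_chi {rels : Finset (FreeGroup (Fin n))} (hcard : rels.card < n)
    (e : G ≃* PresentedGroup (rels : Set (FreeGroup (Fin n)))) :
    ∃ χ : G → ℤ, IsHomZ χ ∧ ∃ t, χ t = 1 := by
  classical
  let L : (Fin n → ℤ) → FreeGroup (Fin n) →* Multiplicative ℤ := fun a =>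
    FreeGroup.lift fun i => Multiplicative.ofAdd (a i)
  have Ladd : ∀ a b w, L (a + b) w = L a w * L b w := by
    intro a b w
    have : L (a + b) = L a * L b := by
      ext i
      simp [L]
    rw [this]; rfl
  let T : (Fin n → ℤ) →+ (rels → ℤ) :=
    { toFun := fun a r => (L a r).toAdd
      map_zero' := by
        have h0 : ∀ w, L 0 w = 1 := fun w => by have := Ladd 0 0 w; simpa using this
        funext r; rw [h0]; rfl
      map_add' := fun a b => by funext r; rw [Ladd]; rfl }
  have hT : ¬ Function.Injective T.toIntLinearMap := by
    intro hinj
    have h1 := LinearMap.finrank_le_finrank_of_injective hinj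
    simp at h1
    omega
  have : ∃ a, a ≠ 0 ∧ T a = 0 := by
    by_contra hcon
    push Not at hcon
    apply hT
    rw [injective_iff_map_eq_zero]
    intro a ha
    by_contra hne
    exact hcon a hne ha
  obtain ⟨a, ha, hTa⟩ := this
  let ψ : PresentedGroup (rels : Set (FreeGroup (Fin n))) →* Multiplicative ℤ :=
    PresentedGroup.toGroup (f := fun i => Multiplicative.ofAdd (a i)) (fun r hr => congrFun hTa ⟨r, hr⟩)
  obtain ⟨i, hi⟩ := Function.ne_iff.1 ha
  refine exists_surj (χ₀ := fun g => (ψ (e g)).toAdd) (g := e.symm (PresentedGroup.of i)) (fun a b => ?_) ?_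
  · simp only [map_mul]; rfl
  · change (ψ (e (e.symm (PresentedGroup.of i)))).toAdd ≠ 0
    rw [MulEquiv.apply_symm_apply]
    have : ψ (PresentedGroup.of i) = Multiplicative.ofAdd (a i) := PresentedGroup.toGroup.of _
    rw [this]
    exact hi
end
end GW

namespace GW
open Filter Topology
section
variable {G : Type*} [Group G] {S : Finset G}

lemma wb_mul {m n : ℕ} {g h : G} (hg : g ∈ wordBall S m) (hh : h ∈ wordBall S n) : g * h ∈ wordBall S (m + n) := by
  obtain ⟨l, h1, h2, rfl⟩ := hg
  obtain ⟨l', h1', h2', rfl⟩ := hh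
  refine ⟨l ++ l', by simp; omega, ?_, by simp⟩
  intro x hx
  rcases List.mem_append.1 hx with h | h
  · exact h2 x h
  · exact h2' x h

lemma wb_inv {n : ℕ} {g : G} (hg : g ∈ wordBall S n) : g⁻¹ ∈ wordBall S n := by
  obtain ⟨l, h1, h2, rfl⟩ := hg
  refine ⟨(l.map (·⁻¹)).reverse, by simpa using h1, ?_, by rw [List.prod_inv_reverse]⟩
  intro x hx
  simp only [List.mem_reverse, List.mem_map] at hx
  obtain ⟨y, hy, rfl⟩ := hx
  rw [inv_inv]
  exact (h2 y hy).symm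

lemma wb_mono {m n : ℕ} (hmn : m ≤ n) {g : G} (hg : g ∈ wordBall S m) : g ∈ wordBall S n := by
  obtain ⟨l, h1, h2, h3⟩ := hg
  exact ⟨l, h1.trans hmn, h2, h3⟩

lemma wb_one (n : ℕ) : (1 : G) ∈ wordBall S n := ⟨[], by simp, by simp, by simp⟩

lemma wb_gen {s : G} (h : s ∈ S ∨ s⁻¹ ∈ S) : s ∈ wordBall S 1 := ⟨[s], by simp, by simpa using h, by simp⟩

open scoped Pointwise in
open scoped Classical in
lemma wb_sub (S : Finset G) (n : ℕ) : wordBall S n ⊆ ((insert 1 (S ∪ S⁻¹)) ^ n : Finset G) := by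
  induction n with
  | zero =>
    rintro g ⟨l, h1, -, rfl⟩
    have : l = [] := List.length_eq_zero_iff.1 (by omega)
    simp [this]
  | succ n ih =>
    rintro g ⟨l, h1, h2, rfl⟩
    rw [pow_succ', Finset.mem_coe, Finset.mem_mul]
    cases l with
    | nil => exact ⟨1, by simp, 1, ih (wb_one n), by simp⟩
    | cons x l =>
      refine ⟨x, ?_, l.prod, ih ⟨l, by simp at h1; omega, fun y hy => h2 y (by simp [hy]), rfl⟩, by simp⟩
      have := h2 x (by simp)
      simp [this]

lemma wb_fin (S : Finset G) (n : ℕ) : (wordBall S n).Finite := by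
  classical
  exact (Finset.finite_toSet _).subset (wb_sub S n)

lemma wb_bound (S : Finset G) : ∃ K : ℕ, ∀ n, (wordBall S n).ncard ≤ K ^ n := by
  classical
  open scoped Pointwise in
  refine ⟨(insert 1 (S ∪ S⁻¹)).card, fun n => ?_⟩
  refine (Set.ncard_le_ncard (wb_sub S n) (Finset.finite_toSet _)).trans ?_
  rw [Set.ncard_coe_finset]
  exact Finset.card_pow_le

lemma growth_bdd (S : Finset G) :
    IsBoundedUnder (· ≤ ·) atTop (fun n : ℕ => ((wordBall S n).ncard : ℝ) ^ (1 / (n : ℝ))) := by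
  obtain ⟨K, hK⟩ := wb_bound S
  refine ⟨K, ?_⟩
  rw [eventually_map]
  filter_upwards [eventually_ge_atTop 1] with n hn
  have h1 : ((wordBall S n).ncard : ℝ) ≤ (K : ℝ) ^ n := by exact_mod_cast hK n
  calc ((wordBall S n).ncard : ℝ) ^ (1 / (n : ℝ)) ≤ ((K : ℝ) ^ n) ^ (1 / (n : ℝ)) :=
        Real.rpow_le_rpow (by positivity) h1 (by positivity)
    _ = K := by
      rw [one_div]; exact Real.pow_rpow_inv_natCast (by positivity) (by omega)

lemma wb_ev {g h : G} (hg : g ∈ wordBall S 4) (hh : h ∈ wordBall S 4) (l : List Bool) :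
    ev g h l ∈ wordBall S (4 * l.length) := by
  induction l with
  | nil => rw [ev_nil]; exact wb_one _
  | cons b l ih =>
    rw [ev_cons, List.length_cons, mul_add, add_comm]
    refine wb_mul ?_ ih
    cases b
    · exact hh
    · exact hg

/-- two elements of the ball of radius four which generate a free monoid force growth -/
theorem growth_ge {g h : G} (hg : g ∈ wordBall S 4) (hh : h ∈ wordBall S 4)
    (hinj : Function.Injective (ev g h)) : (2 : ℝ) ^ ((1 : ℝ) / 4) ≤ growthRate S := by
  refine le_limsup_of_frequently_le ?_ (growth_bdd S)
  rw [frequently_atTop]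
  intro n
  refine ⟨4 * (n + 1), by omega, ?_⟩
  have h1 : 2 ^ (n + 1) ≤ (wordBall S (4 * (n + 1))).ncard := by
    have : ((fun v : List.Vector Bool (n + 1) => ev g h v.toList) '' Set.univ).ncard ≤
        (wordBall S (4 * (n + 1))).ncard := by
      refine Set.ncard_le_ncard ?_ (wb_fin S _)
      rintro _ ⟨v, -, rfl⟩
      have := wb_ev hg hh v.toList
      rwa [List.Vector.toList_length] at this
    rw [Set.ncard_image_of_injective _ (fun a b hab => List.Vector.eq _ _ (hinj hab)), Set.ncard_univ,
      Nat.card_eq_fintype_card, card_vector, Fintype.card_bool] at this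
    exact this
  have h2 : (2 : ℝ) ^ (n + 1) ≤ ((wordBall S (4 * (n + 1))).ncard : ℝ) := by exact_mod_cast h1
  calc (2 : ℝ) ^ ((1 : ℝ) / 4) = ((2 : ℝ) ^ (n + 1)) ^ (1 / ((4 * (n + 1) : ℕ) : ℝ)) := by
        rw [← Real.rpow_natCast, ← Real.rpow_mul (by norm_num)]
        congr 1
        push_cast
        field_simp
    _ ≤ _ := Real.rpow_le_rpow (by positivity) h2 (by positivity)

/-- polynomial growth implies rate one -/
theorem growth_one (K : ℕ) (hK : ∀ n, (wordBall S n).ncard ≤ (2 * (K * n) + 1) ^ 2) : growthRate S = 1 := by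
  have lim : Tendsto (fun n : ℕ => ((2 * K + 1 : ℝ) ^ (1 / (n : ℝ)) * (n : ℝ) ^ (1 / (n : ℝ))) ^ 2) atTop (𝓝 1) := by
    have h1 : Tendsto (fun n : ℕ => (2 * K + 1 : ℝ) ^ (1 / (n : ℝ))) atTop (𝓝 ((2 * K + 1 : ℝ) ^ (0 : ℝ))) :=
      tendsto_const_nhds.rpow tendsto_one_div_atTop_nhds_zero_nat (Or.inl (by positivity))
    have h2 : Tendsto (fun n : ℕ => (n : ℝ) ^ (1 / (n : ℝ))) atTop (𝓝 1) :=
      tendsto_rpow_div.comp tendsto_natCast_atTop_atTop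
    rw [Real.rpow_zero] at h1
    have := (h1.mul h2).pow 2
    simpa using this
  refine Tendsto.limsup_eq (tendsto_of_tendsto_of_tendsto_of_le_of_le' tendsto_const_nhds lim ?_ ?_)
  · filter_upwards with n
    have : 1 ≤ (wordBall S n).ncard := (Set.ncard_pos (wb_fin S n)).2 ⟨1, wb_one n⟩
    exact Real.one_le_rpow (by exact_mod_cast this) (by positivity)
  · filter_upwards [eventually_ge_atTop 1] with n hn
    have hn' : (1 : ℝ) ≤ n := by exact_mod_cast hn
    have h1 : ((wordBall S n).ncard : ℝ) ≤ (2 * (K * n) + 1) ^ 2 := by exact_mod_cast hK n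
    have h2 : ((wordBall S n).ncard : ℝ) ≤ ((2 * K + 1) * n) ^ 2 := h1.trans (by gcongr; nlinarith)
    calc ((wordBall S n).ncard : ℝ) ^ (1 / (n : ℝ)) ≤ (((2 * K + 1) * n : ℝ) ^ 2) ^ (1 / (n : ℝ)) :=
          Real.rpow_le_rpow (by positivity) h2 (by positivity)
      _ = _ := by
        rw [← Real.mul_rpow (by positivity) (by positivity), ← Real.rpow_natCast, ← Real.rpow_natCast,
          ← Real.rpow_mul (by positivity), ← Real.rpow_mul (by positivity), mul_comm ((2 : ℕ) : ℝ)]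

lemma ev_inv_hom {χ : G → ℤ} (hχ : IsHomZ χ) {g h : G} (hg : 0 < χ g) (hh : 0 < χ h) (b : Bool) (l : List Bool) :
    0 < χ (ev g h (b :: l)) := by
  induction l generalizing b with
  | nil => rw [ev_cons, ev_nil, mul_one]; cases b <;> assumption
  | cons c l ih =>
    rw [ev_cons, hχ]
    have := ih c
    have : 0 < χ (cond b g h) := by cases b <;> assumption
    omega

/-- a coincidence of positive words beginning with different letters -/
lemma ev_coincidence {χ : G → ℤ} (hχ : IsHomZ χ) {g h : G} (hg : 0 < χ g) (hh : 0 < χ h)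
    (hn : ¬ Function.Injective (ev g h)) : ∃ l l', ev g h (true :: l) = ev g h (false :: l') := by
  have key : ∀ l l', ev g h l = ev g h l' → l ≠ l' → ∃ l l', ev g h (true :: l) = ev g h (false :: l') := by
    intro l
    induction l with
    | nil =>
      intro l' h1 h2
      cases l' with
      | nil => exact absurd rfl h2
      | cons c l' =>
        have := ev_inv_hom hχ hg hh c l'
        rw [← h1, ev_nil, hχ.one] at this
        omega
    | cons b l ih =>
      intro l' h1 h2
      cases l' with
      | nil =>
        have := ev_inv_hom hχ hg hh b l
        rw [h1, ev_nil, hχ.one] at this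
        omega
      | cons c l' =>
        by_cases hbc : b = c
        · subst hbc
          rw [ev_cons, ev_cons] at h1
          exact ih l' (mul_left_cancel h1) (fun h => h2 (by rw [h]))
        · cases b <;> cases c
          · exact absurd rfl hbc
          · exact ⟨_, _, h1.symm⟩
          · exact ⟨_, _, h1⟩
          · exact absurd rfl hbc
  simp only [Function.Injective] at hn
  push Not at hn
  obtain ⟨l, l', h1, h2⟩ := hn
  exact key l l' h1 h2
end
end GW

namespace GW
open Filter Topology
section
variable {G : Type*} [Group G] {S : Finset G} {χ : G → ℤ}

/-- symmetrised generating set -/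
def Sy (S : Finset G) : Set G := {u | u ∈ S ∨ u⁻¹ ∈ S}

lemma Sy_inv {u : G} (h : u ∈ Sy S) : u⁻¹ ∈ Sy S := by
  rcases h with h | h
  · right; rwa [inv_inv]
  · left; exact h

/-- an edge of the Cayley graph within the levels `[a, b]` -/
def St (S : Finset G) (χ : G → ℤ) (a b : ℤ) (v w : G) : Prop :=
  (∃ u ∈ Sy S, w = v * u) ∧ a ≤ χ v ∧ χ v ≤ b ∧ a ≤ χ w ∧ χ w ≤ b

/-- a path of the Cayley graph within the levels `[a, b]` -/
def Pa (S : Finset G) (χ : G → ℤ) (a b : ℤ) : G → G → Prop := Relation.ReflTransGen (St S χ a b)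

lemma St.symm {a b : ℤ} {v w : G} (h : St S χ a b v w) : St S χ a b w v := by
  obtain ⟨⟨u, hu, rfl⟩, h1, h2, h3, h4⟩ := h
  exact ⟨⟨u⁻¹, Sy_inv hu, by group⟩, h3, h4, h1, h2⟩

lemma Pa.symm {a b : ℤ} {v w : G} (h : Pa S χ a b v w) : Pa S χ a b w v := by
  induction h with
  | refl => exact Relation.ReflTransGen.refl
  | tail _ h2 ih => exact Relation.ReflTransGen.head h2.symm ih

lemma Pa.trans {a b : ℤ} {v w x : G} (h : Pa S χ a b v w) (h' : Pa S χ a b w x) : Pa S χ a b v x :=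
  Relation.ReflTransGen.trans h h'

lemma Pa.mono {a b a' b' : ℤ} (ha : a' ≤ a) (hb : b ≤ b') {v w : G} (h : Pa S χ a b v w) : Pa S χ a' b' v w := by
  refine Relation.ReflTransGen.mono ?_ _ _ h
  rintro v w ⟨h1, h2, h3, h4, h5⟩
  exact ⟨h1, by omega, by omega, by omega, by omega⟩

lemma Pa.tr (hχ : IsHomZ χ) {a b : ℤ} {v w : G} (h : Pa S χ a b v w) (x : G) {a' b' : ℤ} (ha : a' = χ x + a)
    (hb : b' = χ x + b) : Pa S χ a' b' (x * v) (x * w) := by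
  induction h with
  | refl => exact Relation.ReflTransGen.refl
  | tail _ h2 ih =>
    refine Relation.ReflTransGen.tail ih ?_
    obtain ⟨⟨u, hu, rfl⟩, h1, h2, h3, h4⟩ := h2
    refine ⟨⟨u, hu, by group⟩, ?_, ?_, ?_, ?_⟩ <;> rw [hχ] <;> omega

lemma Pa.neg {a b : ℤ} {v w : G} (h : Pa S χ a b v w) : Pa S (fun g => - χ g) (-b) (-a) v w := by
  refine Relation.ReflTransGen.mono ?_ _ _ h
  rintro v w ⟨h1, h2, h3, h4, h5⟩
  exact ⟨h1, by change _ ≤ - χ _; omega, by change - χ _ ≤ _; omega, by change _ ≤ - χ _; omega,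
    by change - χ _ ≤ _; omega⟩

/-- monoid of nonnegative words -/
def Mo (S : Finset G) (χ : G → ℤ) : Submonoid G := Submonoid.closure {u | u ∈ Sy S ∧ 0 ≤ χ u}

lemma Mo_path (hχ : IsHomZ χ) {m : G} (hm : m ∈ Mo S χ) : 0 ≤ χ m ∧ ∀ v, ∃ c, Pa S χ (χ v) c v (v * m) := by
  induction hm using Submonoid.closure_induction with
  | mem u hu =>
    refine ⟨hu.2, fun v => ⟨χ v + χ u, Relation.ReflTransGen.single ⟨⟨u, hu.1, rfl⟩, ?_⟩⟩⟩
    have := hu.2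
    rw [hχ]; omega
  | one => exact ⟨by rw [hχ.one], fun v => ⟨0, by rw [mul_one]; exact Relation.ReflTransGen.refl⟩⟩
  | mul x y _ _ hx hy =>
    refine ⟨by rw [hχ]; omega, fun v => ?_⟩
    obtain ⟨c, hc⟩ := hx.2 v
    obtain ⟨c', hc'⟩ := hy.2 (v * x)
    refine ⟨max c c', ?_⟩
    rw [← mul_assoc]
    have := hχ v x
    exact (hc.mono le_rfl (le_max_left _ _)).trans (hc'.mono (by omega) (le_max_right _ _))

lemma ev_mem (M : Submonoid G) {g h : G} (hg : g ∈ M) (hh : h ∈ M) (l : List Bool) : ev g h l ∈ M := by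
  induction l with
  | nil => rw [ev_nil]; exact M.one_mem
  | cons b l ih =>
    rw [ev_cons]
    refine M.mul_mem ?_ ih
    cases b <;> assumption

lemma valley (hχ : IsHomZ χ) {g h : G} (hg : g ∈ Mo S χ) (hh : h ∈ Mo S χ) (hg0 : 0 < χ g) (hh0 : 0 < χ h)
    (hn : ¬ Function.Injective (ev g h)) : ∃ c, Pa S χ 1 c g h := by
  obtain ⟨l, l', he⟩ := ev_coincidence hχ hg0 hh0 hn
  rw [ev_cons, ev_cons] at he
  obtain ⟨c, hc⟩ := (Mo_path hχ (ev_mem _ hg hh l)).2 g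
  obtain ⟨c', hc'⟩ := (Mo_path hχ (ev_mem _ hg hh l')).2 h
  simp only [cond] at he
  rw [he] at hc
  exact ⟨max c c', (hc.mono (by omega) (le_max_left _ _)).trans (hc'.mono (by omega) (le_max_right _ _)).symm⟩

lemma unif (hχ : IsHomZ χ) (hA : ∀ g ∈ wordBall S 4, ∀ h ∈ wordBall S 4, ¬ Function.Injective (ev g h))
    {p : G} (hp : p ∈ Sy S) (hp0 : 0 < χ p) :
    ∃ c : ℤ, 0 ≤ c ∧ ∀ u ∈ Sy S, (0 < χ u → Pa S χ 1 c p u) ∧ (χ u = 0 → Pa S χ 1 c p (u * p)) := by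
  classical
  have hpM : p ∈ Mo S χ := Submonoid.subset_closure ⟨hp, hp0.le⟩
  have hpw : p ∈ wordBall S 1 := wb_gen hp
  have h1 : ∀ u ∈ Sy S, ∃ c : ℤ, (0 < χ u → Pa S χ 1 c p u) ∧ (χ u = 0 → Pa S χ 1 c p (u * p)) := by
    intro u hu
    have huw : u ∈ wordBall S 1 := wb_gen hu
    rcases lt_trichotomy (χ u) 0 with h | h | h
    · exact ⟨0, fun h' => by omega, fun h' => by omega⟩
    · have huM : u ∈ Mo S χ := Submonoid.subset_closure ⟨hu, h.ge⟩
      obtain ⟨c, hc⟩ := valley hχ hpM (Submonoid.mul_mem _ huM hpM) hp0 (by rw [hχ]; omega)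
        (hA _ (wb_mono (by norm_num) hpw) _ (wb_mono (by norm_num) (wb_mul huw hpw)))
      exact ⟨c, fun h' => by omega, fun _ => hc⟩
    · have huM : u ∈ Mo S χ := Submonoid.subset_closure ⟨hu, h.le⟩
      obtain ⟨c, hc⟩ := valley hχ hpM huM hp0 h
        (hA _ (wb_mono (by norm_num) hpw) _ (wb_mono (by norm_num) huw))
      exact ⟨c, fun _ => hc, fun h' => by omega⟩
  choose! c hc using h1
  open scoped Pointwise in
  have hle : ∀ u ∈ Sy S, c u ≤ ∑ u ∈ S ∪ S⁻¹, |c u| := fun u hu =>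
    (le_abs_self _).trans (Finset.single_le_sum (f := fun u => |c u|) (fun _ _ => abs_nonneg _) (by
      simp only [Finset.mem_union, Finset.mem_inv']
      exact hu))
  open scoped Pointwise in
  refine ⟨∑ u ∈ S ∪ S⁻¹, |c u|, Finset.sum_nonneg fun _ _ => abs_nonneg _, fun u hu => ⟨fun h => ?_, fun h => ?_⟩⟩
  · exact ((hc u hu).1 h).mono le_rfl (hle u hu)
  · exact ((hc u hu).2 h).mono le_rfl (hle u hu)

lemma raise (hχ : IsHomZ χ) {p : G} {c : ℤ}
    (hc : ∀ u ∈ Sy S, (0 < χ u → Pa S χ 1 c p u) ∧ (χ u = 0 → Pa S χ 1 c p (u * p)))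
    {a b : ℤ} {v w : G} (h : Pa S χ a b v w) (hv : a < χ v) (hw : a < χ w) :
    Pa S χ (a + 1) (max b (a + c)) v w := by
  let f : G → G := fun x => if χ x = a then x * p else x
  have f1 : ∀ x, χ x = a → f x = x * p := fun x hx => if_pos hx
  have f2 : ∀ x, a < χ x → f x = x := fun x hx => if_neg (by omega)
  have low : ∀ v w, χ v = a → St S χ a b v w → Pa S χ (a + 1) (max b (a + c)) (f v) (f w) := by
    rintro v _ hv ⟨⟨u, hu, rfl⟩, h1, h2, h3, h4⟩
    rw [f1 v hv]
    have h5 := hχ v u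
    rcases h3.eq_or_lt with h | h
    · rw [f1 _ h.symm]
      have := ((hc u hu).2 (by omega)).tr hχ v (a' := a + 1) (b' := a + c) (by rw [hv]) (by rw [hv])
      rw [← mul_assoc] at this
      exact this.mono le_rfl (le_max_right _ _)
    · rw [f2 _ h]
      have := ((hc u hu).1 (by omega)).tr hχ v (a' := a + 1) (b' := a + c) (by rw [hv]) (by rw [hv])
      exact this.mono le_rfl (le_max_right _ _)
  have step : ∀ v w, St S χ a b v w → Pa S χ (a + 1) (max b (a + c)) (f v) (f w) := by
    intro v w hvw
    rcases hvw.2.1.eq_or_lt with h | h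
    · exact low v w h.symm hvw
    rcases hvw.2.2.2.1.eq_or_lt with h' | h'
    · exact (low w v h'.symm hvw.symm).symm
    rw [f2 _ h, f2 _ h']
    refine Relation.ReflTransGen.single ⟨hvw.1, by omega, ?_, by omega, ?_⟩
    · exact hvw.2.2.1.trans (le_max_left _ _)
    · exact hvw.2.2.2.2.trans (le_max_left _ _)
  have all : Pa S χ (a + 1) (max b (a + c)) (f v) (f w) := by
    clear hv hw
    induction h with
    | refl => exact Relation.ReflTransGen.refl
    | tail _ h2 ih => exact ih.trans (step _ _ h2)
  rwa [f2 v hv, f2 w hw] at all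

lemma raise_all (hχ : IsHomZ χ) {p : G} {c : ℤ}
    (hc : ∀ u ∈ Sy S, (0 < χ u → Pa S χ 1 c p u) ∧ (χ u = 0 → Pa S χ 1 c p (u * p)))
    (k : ℕ) {b : ℤ} {v w : G} (hv : χ v = 0) (hw : χ w = 0) (h : Pa S χ (-k) b v w) :
    ∃ b', Pa S χ 0 b' v w := by
  induction k generalizing b with
  | zero => exact ⟨b, by simpa using h⟩
  | succ k ih =>
    have := raise hχ hc h (by rw [hv]; omega) (by rw [hw]; omega)
    have h2 : (-((k + 1 : ℕ) : ℤ) + 1) = -(k : ℤ) := by push_cast; ring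
    rw [h2] at this
    exact ih this

lemma lower_all (hχ : IsHomZ χ) {p : G} {c : ℤ}
    (hc : ∀ u ∈ Sy S, (0 < χ u → Pa S χ 1 c p u) ∧ (χ u = 0 → Pa S χ 1 c p (u * p)))
    (k : ℕ) {v w : G} (hv : χ v = 0) (hw : χ w = 0) (h : Pa S χ (-k) 0 v w) :
    Pa S χ (-(max c 0)) 0 v w := by
  induction k with
  | zero => exact h.mono (by simp) le_rfl
  | succ k ih =>
    by_cases hk : ((k + 1 : ℕ) : ℤ) ≤ c
    · refine h.mono ?_ le_rfl
      have := le_max_left c 0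
      omega
    · have := raise hχ hc h (by rw [hv]; omega) (by rw [hw]; omega)
      have h2 : (-((k + 1 : ℕ) : ℤ) + 1) = -(k : ℤ) := by push_cast; ring
      rw [h2] at this
      exact ih (this.mono le_rfl (max_le le_rfl (by omega)))

lemma exists_path (hχ : IsHomZ χ) (hgen : Subgroup.closure (S : Set G) = ⊤) (g : G) :
    ∃ k : ℕ, Pa S χ (-k) k 1 g := by
  have single : ∀ u ∈ Sy S, ∃ k : ℕ, Pa S χ (-k) k 1 u := fun u hu =>
    ⟨(χ u).natAbs, Relation.ReflTransGen.single ⟨⟨u, hu, by simp⟩, by rw [hχ.one]; omega⟩⟩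
  have hg : g ∈ Subgroup.closure (S : Set G) := by rw [hgen]; trivial
  induction hg using Subgroup.closure_induction with
  | mem x hx => exact single x (Or.inl hx)
  | one => exact ⟨0, Relation.ReflTransGen.refl⟩
  | mul x y _ _ hx hy =>
    obtain ⟨k, hk⟩ := hx
    obtain ⟨k', hk'⟩ := hy
    have := hk'.tr hχ x rfl rfl
    rw [mul_one] at this
    refine ⟨k + k' + (χ x).natAbs, (hk.mono ?_ ?_).trans (this.mono ?_ ?_)⟩ <;> omega
  | inv x _ hx =>
    obtain ⟨k, hk⟩ := hx
    have := (hk.tr hχ x⁻¹ rfl rfl).symm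
    rw [mul_one, inv_mul_cancel] at this
    rw [hχ.inv] at this
    exact ⟨k + (χ x).natAbs, this.mono (by omega) (by omega)⟩

/-- the kernel is finitely generated -/
theorem ker_fg (hχ : IsHomZ χ) (hgen : Subgroup.closure (S : Set G) = ⊤)
    (hA : ∀ g ∈ wordBall S 4, ∀ h ∈ wordBall S 4, ¬ Function.Injective (ev g h))
    {t : G} (ht : χ t = 1) {N : Subgroup G} (hN : ∀ g, g ∈ N ↔ χ g = 0) : N.FG := by
  classical
  have hχn : IsHomZ (fun g => - χ g) := fun a b => by change -χ (a * b) = -χ a + -χ b; rw [hχ]; ring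
  have hp : ∃ p ∈ Sy S, 0 < χ p := by
    by_contra hcon
    push Not at hcon
    have h0 : ∀ u ∈ Sy S, χ u = 0 := fun u hu => by
      have h1 := hcon u hu
      have h2 := hcon _ (Sy_inv hu)
      rw [hχ.inv] at h2
      omega
    have : Subgroup.closure (S : Set G) ≤ N := (Subgroup.closure_le _).2 fun s hs => (hN s).2 (h0 s (Or.inl hs))
    rw [hgen] at this
    have := (hN t).1 (this trivial)
    omega
  obtain ⟨p, hp, hp0⟩ := hp
  obtain ⟨c, -, hc⟩ := unif hχ hA hp hp0
  obtain ⟨c', -, hc'⟩ := unif hχn hA (Sy_inv hp) (by change 0 < - χ p⁻¹; rw [hχ.inv]; omega)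
  have path : ∀ g ∈ N, Pa S χ 0 (max c' 0) 1 g := by
    intro g hg
    obtain ⟨k, hk⟩ := exists_path hχ hgen g
    obtain ⟨b, hb⟩ := raise_all hχ hc k hχ.one ((hN g).1 hg) hk
    have h1 := (hb.mono le_rfl (Int.self_le_toNat b)).neg
    rw [neg_zero] at h1
    have h2 := (lower_all hχn hc' _ hχn.one (by change - χ g = 0; rw [(hN g).1 hg]; rfl) h1).neg
    simpa using h2
  open scoped Pointwise in
  let T : Finset G := ((Finset.Icc 0 (max c' 0)) ×ˢ (S ∪ S⁻¹)).image
    (fun q : ℤ × G => t ^ q.1 * q.2 * t ^ (-(q.1 + χ q.2)))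
  refine ⟨T, le_antisymm ((Subgroup.closure_le _).2 ?_) ?_⟩
  · intro x hx
    rw [Finset.mem_coe, Finset.mem_image] at hx
    obtain ⟨⟨k, s⟩, -, rfl⟩ := hx
    rw [SetLike.mem_coe, hN, hχ, hχ, hχ.zpow, hχ.zpow, ht]
    simp
  · intro g hg
    have key : ∀ w, Pa S χ 0 (max c' 0) 1 w → w * t ^ (-χ w) ∈ Subgroup.closure (T : Set G) := by
      intro w hw
      induction hw with
      | refl => rw [hχ.one]; simp
      | @tail v w _ h2 ih =>
        obtain ⟨⟨u, hu, rfl⟩, h1, h2, h3, h4⟩ := h2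
        have : v * u * t ^ (-χ (v * u)) = (v * t ^ (-χ v)) * (t ^ (χ v) * u * t ^ (-(χ v + χ u))) := by
          rw [hχ, zpow_neg t (χ v)]; simp only [mul_assoc, inv_mul_cancel_left]
        rw [this]
        refine Subgroup.mul_mem _ ih (Subgroup.subset_closure ?_)
        rw [Finset.mem_coe, Finset.mem_image]
        refine ⟨(χ v, u), ?_, rfl⟩
        simp only [Finset.mem_product, Finset.mem_Icc, Finset.mem_union, Finset.mem_inv']
        exact ⟨⟨h1, h2⟩, hu⟩
    have := key g (path g hg)
    rwa [(hN g).1 hg, neg_zero, zpow_zero, mul_one] at this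
end
end GW

namespace GW
open Filter Topology
section
variable {G : Type*} [Group G] {S : Finset G} {χ : G → ℤ} {N : Subgroup G}

lemma ev_append (x y : G) (l l' : List Bool) : ev x y (l ++ l') = ev x y l * ev x y l' := by simp [ev]

lemma ev_rt (x y : G) (n : ℕ) : ev x y (List.replicate n true) = x ^ n := by simp [ev]

lemma ev_rf (x y : G) (n : ℕ) : ev x y (List.replicate n false) = y ^ n := by simp [ev]

lemma ev_coe (x y : N) (l : List Bool) : ev (x : G) (y : G) l = ((ev x y l : N) : G) := by
  induction l with
  | nil => simp [ev_nil]
  | cons b l ih => rw [ev_cons, ev_cons, ih]; cases b <;> rfl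

lemma two (hN : CD1 N) {x y : G} (hx : x ∈ N) (hy : y ∈ N) (h : ¬ Function.Injective (ev x y)) :
    ∃ c ∈ N, ∃ i j : ℤ, x = c ^ i ∧ y = c ^ j := by
  rcases hN.twoGen ⟨x, hx⟩ ⟨y, hy⟩ with ⟨c, i, j, h1, h2⟩ | h1
  · exact ⟨c, c.2, i, j, congrArg Subtype.val h1, congrArg Subtype.val h2⟩
  · refine absurd (fun l l' hl => h1 (Subtype.ext ?_)) h
    rw [← ev_coe, ← ev_coe]; exact hl

lemma not_inj_of_comm {x y : G} (h : x * y = y * x) : ¬ Function.Injective (ev x y) := by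
  intro hi
  have : [true, false] = [false, true] := hi (by simp [ev, h])
  simp at this

lemma two_comm (hN : CD1 N) {x y : G} (hx : x ∈ N) (hy : y ∈ N) (h : ¬ Function.Injective (ev x y)) :
    x * y = y * x := by
  obtain ⟨c, -, i, j, rfl, rfl⟩ := two hN hx hy h
  rw [← zpow_add, ← zpow_add, add_comm]

lemma not_inj_of_pow {x y : G} {p q : ℤ} (hp : p ≠ 0) (h : x ^ p = y ^ q) :
    ¬ Function.Injective (ev x y) := by
  have key : ∀ p q : ℤ, 0 < p → x ^ p = y ^ q → ¬ Function.Injective (ev x y) := by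
    intro p q hp h hi
    obtain ⟨m, rfl⟩ := Int.eq_ofNat_of_zero_le hp.le
    have hm : m ≠ 0 := by omega
    rcases Int.eq_nat_or_neg q with ⟨k, rfl | rfl⟩
    · have : List.replicate m true = List.replicate k false := hi (by
        rw [ev_rt, ev_rf]; simpa using h)
      have h1 : true ∈ List.replicate k false := by rw [← this]; simp [hm]
      simp at h1
    · have : List.replicate m true ++ List.replicate k false = [] := hi (by
        rw [ev_append, ev_rt, ev_rf, ev_nil]
        rw [zpow_natCast, zpow_neg, zpow_natCast] at h
        rw [h, inv_mul_cancel])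
      simp [hm] at this
  rcases lt_or_gt_of_ne hp with h1 | h1
  · exact key (-p) (-q) (by omega) (by rw [zpow_neg, zpow_neg, h])
  · exact key p q h1 h

lemma zpow_ne (hN : CD1 N) {x : G} (hx : x ∈ N) (h1 : x ≠ 1) {n : ℤ} (hn : n ≠ 0) : x ^ n ≠ 1 := by
  intro h
  refine hN.tfz (g := ⟨x, hx⟩) (fun h => h1 (congrArg Subtype.val h)) n hn (Subtype.ext ?_)
  simpa using h

lemma comm_trans (hN : CD1 N) {x y z : G} (hx : x ∈ N) (hy : y ∈ N) (hz : z ∈ N) (hy1 : y ≠ 1)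
    (h : x * y = y * x) (h' : z * y = y * z) : x * z = z * x := by
  by_cases hx1 : x = 1
  · simp [hx1]
  by_cases hz1 : z = 1
  · simp [hz1]
  obtain ⟨c, -, i, j, h1, h2⟩ := two hN hx hy (not_inj_of_comm h)
  obtain ⟨d, -, l, k, h3, h4⟩ := two hN hz hy (not_inj_of_comm h')
  have hj : j ≠ 0 := by rintro rfl; exact hy1 (by simpa using h2)
  have hl : l ≠ 0 := by rintro rfl; exact hz1 (by simpa using h3)
  refine two_comm hN hx hz (not_inj_of_pow (p := j * l) (q := k * i) (mul_ne_zero hj hl) ?_)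
  have e1 : x ^ j = y ^ i := by rw [h1, h2, ← zpow_mul, ← zpow_mul, mul_comm]
  have e2 : z ^ k = y ^ l := by rw [h3, h4, ← zpow_mul, ← zpow_mul, mul_comm]
  rw [zpow_mul, e1, zpow_mul, e2, ← zpow_mul, ← zpow_mul, mul_comm]

lemma conj_comm (hN : CD1 N) {c n : G} (hc : c ∈ N) (hn : n ∈ N) (hc1 : c ≠ 1)
    (h : n * c * n⁻¹ * c = c * (n * c * n⁻¹)) : n * c = c * n := by
  have hy : n * c * n⁻¹ ∈ N := N.mul_mem (N.mul_mem hn hc) (N.inv_mem hn)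
  obtain ⟨d, -, p, q, h1, h2⟩ := two hN hy hc (not_inj_of_comm h)
  have hq : q ≠ 0 := by rintro rfl; exact hc1 (by simpa using h2)
  have e : (n * c * n⁻¹) ^ q = c ^ p := by rw [h1, h2, ← zpow_mul, ← zpow_mul, mul_comm]
  rw [conj_zpow] at e
  have key : ∀ q p : ℤ, 0 < q → n * c ^ q * n⁻¹ = c ^ p → ¬ Function.Injective (ev n c) := by
    intro q p hq e hi
    obtain ⟨m, rfl⟩ := Int.eq_ofNat_of_zero_le hq.le
    have hm : m ≠ 0 := by omega
    rcases Int.eq_nat_or_neg p with ⟨k, rfl | rfl⟩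
    · have : [true] ++ List.replicate m false = List.replicate k false ++ [true] := hi (by
        rw [ev_append, ev_append, ev_rf, ev_rf, ev_cons, ev_nil]
        simp only [cond, mul_one]
        rw [zpow_natCast, zpow_natCast, mul_inv_eq_iff_eq_mul] at e
        exact e)
      have h2 := congrArg List.getLast? this
      obtain ⟨m, rfl⟩ := Nat.exists_eq_succ_of_ne_zero hm
      rw [List.getLast?_append, List.getLast?_append] at h2
      simp [List.replicate_succ'] at h2
    · have : List.replicate k false ++ ([true] ++ List.replicate m false) = [true] := hi (by
        rw [ev_append, ev_append, ev_rf, ev_rf, ev_cons, ev_nil]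
        simp only [cond, mul_one]
        rw [zpow_natCast, zpow_neg, zpow_natCast, mul_inv_eq_iff_eq_mul] at e
        rw [e, mul_inv_cancel_left])
      have h2 := congrArg List.length this
      simp at h2
      omega
  apply two_comm hN hn hc
  rcases lt_or_gt_of_ne hq with h1 | h1
  · refine key (-q) (-p) (by omega) ?_
    rw [zpow_neg, zpow_neg, ← e]; group
  · exact key q p h1 e

/-- the kernel is commutative -/
theorem ker_comm (hN : CD1 N) (hχ : IsHomZ χ) (hgen : Subgroup.closure (S : Set G) = ⊤)
    (hA : ∀ g ∈ wordBall S 4, ∀ h ∈ wordBall S 4, ¬ Function.Injective (ev g h))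
    (hNχ : ∀ g, g ∈ N ↔ χ g = 0) : ∀ x ∈ N, ∀ y ∈ N, x * y = y * x := by
  have central : ∀ g : G, (∀ u ∈ Sy S, g * u = u * g) → ∀ x, g * x = x * g := by
    intro g hg x
    have : x ∈ Subgroup.closure (S : Set G) := by rw [hgen]; trivial
    have h2 : Subgroup.closure (S : Set G) ≤ Subgroup.centralizer {g} := (Subgroup.closure_le _).2 fun s hs => by
      rw [SetLike.mem_coe, Subgroup.mem_centralizer_singleton_iff]
      exact (hg s (Or.inl hs)).symm
    exact (Subgroup.mem_centralizer_singleton_iff.1 (h2 this)).symm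
  have TN : ∀ s u : G, s * u * s⁻¹ * u⁻¹ ∈ N := fun s u => by
    rw [hNχ, hχ, hχ, hχ, hχ.inv, hχ.inv]; ring
  have TB : ∀ s ∈ Sy S, ∀ u ∈ Sy S, s * u * s⁻¹ * u⁻¹ ∈ wordBall S 4 := fun s hs u hu =>
    wb_mul (m := 3) (n := 1) (wb_mul (m := 2) (n := 1) (wb_mul (m := 1) (n := 1) (wb_gen hs) (wb_gen hu))
      (wb_gen (Sy_inv hs))) (wb_gen (Sy_inv hu))
  by_cases hab : ∀ s ∈ Sy S, ∀ u ∈ Sy S, s * u = u * s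
  · intro x _ y _
    exact central x (fun u hu => (central u (fun v hv => hab u hu v hv) x).symm) y
  push Not at hab
  obtain ⟨s, hs, u, hu, hsu⟩ := hab
  set c := s * u * s⁻¹ * u⁻¹ with hcdef
  have hc1 : c ≠ 1 := by
    intro h
    apply hsu
    rw [hcdef, mul_inv_eq_one, mul_inv_eq_iff_eq_mul] at h
    exact h
  have hcN : c ∈ N := TN s u
  have hT : ∀ s ∈ Sy S, ∀ u ∈ Sy S, (s * u * s⁻¹ * u⁻¹) * c = c * (s * u * s⁻¹ * u⁻¹) := fun s' hs' u' hu' =>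
    two_comm hN (TN _ _) hcN (hA _ (TB _ hs' _ hu') _ (TB _ hs _ hu))
  have conjN : ∀ g x, x ∈ N → g * x * g⁻¹ ∈ N := fun g x hx => by
    rw [hNχ, hχ, hχ, hχ.inv, (hNχ x).1 hx]; ring
  have step : ∀ g ∈ Sy S, ∀ x ∈ N, x * c = c * x → (g * x * g⁻¹) * c = c * (g * x * g⁻¹) := by
    intro g hg x hx hxc
    by_cases hcen : ∀ u ∈ Sy S, g⁻¹ * u = u * g⁻¹
    · have := central _ hcen x
      have e : g * x * g⁻¹ = x := by rw [mul_assoc, ← this, mul_inv_cancel_left]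
      rw [e, hxc]
    · push Not at hcen
      obtain ⟨v, hv, hgv⟩ := hcen
      have hy1 : g⁻¹ * v * g⁻¹⁻¹ * v⁻¹ ≠ 1 := by
        intro h
        apply hgv
        rw [mul_inv_eq_one, mul_inv_eq_iff_eq_mul] at h
        exact h
      have e : g * (g⁻¹ * v * g⁻¹⁻¹ * v⁻¹) * g⁻¹ = v * g * v⁻¹ * g⁻¹ := by group
      have hy2 : v * g * v⁻¹ * g⁻¹ ≠ 1 := by
        rw [← e]
        intro h
        exact hy1 (conj_eq_one_iff.1 h)
      have h1 := comm_trans hN hx hcN (TN _ _) hc1 hxc (hT _ (Sy_inv hg) _ hv)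
      have h2 : (g * x * g⁻¹) * (v * g * v⁻¹ * g⁻¹) = (v * g * v⁻¹ * g⁻¹) * (g * x * g⁻¹) := by
        rw [← e]
        calc _ = g * (x * (g⁻¹ * v * g⁻¹⁻¹ * v⁻¹)) * g⁻¹ := by group
          _ = _ := by rw [h1]; group
      exact comm_trans hN (conjN g x hx) (TN v g) hcN hy2 h2 (hT _ hv _ hg).symm
  have all : ∀ g x, x ∈ N → (x * c = c * x ↔ (g * x * g⁻¹) * c = c * (g * x * g⁻¹)) := by
    intro g
    have hg : g ∈ Subgroup.closure (S : Set G) := by rw [hgen]; trivial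
    induction hg using Subgroup.closure_induction with
    | mem g hg =>
      refine fun x hx => ⟨step g (Or.inl hg) x hx, fun h => ?_⟩
      have := step _ (Sy_inv (Or.inl hg)) _ (conjN g x hx) h
      have e : g⁻¹ * (g * x * g⁻¹) * g⁻¹⁻¹ = x := by group
      rwa [e] at this
    | one => intro x _; simp
    | mul g h _ _ ihg ihh =>
      intro x hx
      have e : g * h * x * (g * h)⁻¹ = g * (h * x * h⁻¹) * g⁻¹ := by group
      rw [e, ihh x hx, ihg _ (conjN h x hx)]
    | inv g _ ih =>
      intro x hx
      rw [ih _ (conjN g⁻¹ x hx)]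
      have e : g * (g⁻¹ * x * g⁻¹⁻¹) * g⁻¹ = x := by group
      rw [e]
  have hcen : ∀ n ∈ N, n * c = c * n := fun n hn => conj_comm hN hcN hn hc1 ((all n c hcN).1 rfl)
  intro x hx y hy
  exact comm_trans hN hx hcN hy hc1 (hcen x hx) (hcen y hy)

/-- the kernel is cyclic -/
theorem ker_cyclic (hN : CD1 N) (hfg : N.FG) (hcomm : ∀ x ∈ N, ∀ y ∈ N, x * y = y * x) :
    ∃ a ∈ N, ∀ x ∈ N, ∃ i : ℤ, x = a ^ i := by
  classical
  have key : ∀ T : Finset G, (∀ x ∈ T, x ∈ N) → ∃ a ∈ N, ∀ x ∈ T, ∃ i : ℤ, x = a ^ i := by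
    intro T
    induction T using Finset.induction_on with
    | empty => exact fun _ => ⟨1, N.one_mem, by simp⟩
    | insert x T _ ih =>
      intro h
      obtain ⟨a, ha, hT⟩ := ih fun y hy => h y (Finset.mem_insert_of_mem hy)
      have hx := h x (Finset.mem_insert_self _ _)
      obtain ⟨c, hc, i, j, h1, h2⟩ := two hN hx ha (not_inj_of_comm (hcomm x hx a ha))
      refine ⟨c, hc, fun y hy => ?_⟩
      rcases Finset.mem_insert.1 hy with rfl | hy
      · exact ⟨i, h1⟩
      · obtain ⟨k, hk⟩ := hT y hy
        exact ⟨j * k, by rw [hk, h2, zpow_mul]⟩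
  obtain ⟨T, hT⟩ := hfg
  obtain ⟨a, ha, h⟩ := key T fun x hx => by rw [← hT]; exact Subgroup.subset_closure hx
  refine ⟨a, ha, fun x hx => ?_⟩
  have : Subgroup.closure (T : Set G) ≤ Subgroup.zpowers a := (Subgroup.closure_le _).2 fun y hy => by
    obtain ⟨i, hi⟩ := h y hy
    exact ⟨i, hi.symm⟩
  rw [hT] at this
  obtain ⟨i, hi⟩ := this hx
  exact ⟨i, hi.symm⟩

lemma conj_pm (hN : CD1 N) (hχ : IsHomZ χ) (hNχ : ∀ g, g ∈ N ↔ χ g = 0) {a : G} (ha : a ∈ N)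
    (hcyc : ∀ x ∈ N, ∃ i : ℤ, x = a ^ i) (g : G) : g * a * g⁻¹ = a ∨ g * a * g⁻¹ = a⁻¹ := by
  by_cases ha1 : a = 1
  · simp [ha1]
  have conjN : ∀ g x, x ∈ N → g * x * g⁻¹ ∈ N := fun g x hx => by
    rw [hNχ, hχ, hχ, hχ.inv, (hNχ x).1 hx]; ring
  obtain ⟨m, hm⟩ := hcyc _ (conjN g a ha)
  obtain ⟨k, hk⟩ := hcyc _ (conjN g⁻¹ a ha)
  have e : a ^ (k * m) = a := by
    rw [zpow_mul, ← hk, conj_zpow, ← hm]; group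
  have e2 : k * m = 1 := by
    by_contra hne
    apply zpow_ne hN ha ha1 (n := k * m - 1) (by omega)
    rw [zpow_sub_one, e, mul_inv_cancel]
  rcases Int.eq_one_or_neg_one_of_mul_eq_one (by rw [mul_comm]; exact e2 : m * k = 1) with rfl | rfl
  · left; simpa using hm
  · right; simpa using hm
end
end GW

namespace GW
open Filter Topology
section
variable {G : Type*} [Group G] {S : Finset G} {χ : G → ℤ}

lemma conj_pm_zpow {a g : G} (h : g * a * g⁻¹ = a ∨ g * a * g⁻¹ = a⁻¹) (i : ℤ) :
    ∃ e : ℤ, (e = 1 ∨ e = -1) ∧ g * a ^ i = a ^ (e * i) * g := by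
  have h1 : g * a ^ i = (g * a * g⁻¹) ^ i * g := by rw [conj_zpow]; group
  rcases h with h | h
  · exact ⟨1, Or.inl rfl, by rw [h1, h, one_mul]⟩
  · exact ⟨-1, Or.inr rfl, by rw [h1, h, inv_zpow, neg_one_mul, zpow_neg]⟩

/-- growth of a group with normal form `a ^ i * t ^ j` -/
theorem growth_nf {a t : G} (hconj : ∀ g, g * a * g⁻¹ = a ∨ g * a * g⁻¹ = a⁻¹)
    (hnf : ∀ g, ∃ i j : ℤ, g = a ^ i * t ^ j) : growthRate S = 1 := by
  classical
  choose I J hIJ using hnf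
  open scoped Pointwise in
  let K : ℕ := ∑ u ∈ S ∪ S⁻¹, ((I u).natAbs + (J u).natAbs)
  have hK : ∀ u, (u ∈ S ∨ u⁻¹ ∈ S) → (I u).natAbs + (J u).natAbs ≤ K := fun u hu =>
    Finset.single_le_sum (f := fun u => (I u).natAbs + (J u).natAbs) (fun _ _ => Nat.zero_le _) (by
      simpa [Finset.mem_union, Finset.mem_inv'] using hu)
  have main : ∀ n, ∀ g ∈ wordBall S n, ∃ i j : ℤ, i.natAbs ≤ K * n ∧ j.natAbs ≤ K * n ∧ g = a ^ i * t ^ j := by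
    intro n
    induction n with
    | zero =>
      rintro g ⟨l, h1, -, rfl⟩
      have : l = [] := List.length_eq_zero_iff.1 (by omega)
      exact ⟨0, 0, by simp, by simp, by simp [this]⟩
    | succ n ih =>
      rintro g ⟨l, h1, h2, rfl⟩
      cases l with
      | nil => exact ⟨0, 0, by simp, by simp, by simp⟩
      | cons x l =>
        obtain ⟨i, j, hi, hj, he⟩ := ih l.prod ⟨l, by simp at h1; omega, fun y hy => h2 y (by simp [hy]), rfl⟩
        have hx := hK x (h2 x (by simp))
        obtain ⟨e, he1, he2⟩ := conj_pm_zpow (hconj (t ^ (J x))) i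
        refine ⟨I x + e * i, J x + j, ?_, ?_, ?_⟩
        · rw [mul_add, mul_one]
          rcases he1 with rfl | rfl <;> omega
        · rw [mul_add, mul_one]; omega
        · rw [List.prod_cons, he]
          calc x * (a ^ i * t ^ j) = a ^ I x * t ^ J x * (a ^ i * t ^ j) := by rw [← hIJ x]
            _ = a ^ I x * (t ^ J x * a ^ i) * t ^ j := by group
            _ = _ := by rw [he2, zpow_add, zpow_add]; group
  refine growth_one K fun n => ?_
  let F : Finset ℤ := Finset.Icc (-((K * n : ℕ) : ℤ)) ((K * n : ℕ) : ℤ)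
  have hF : F.card = 2 * (K * n) + 1 := by
    rw [Int.card_Icc]; omega
  have hsub : wordBall S n ⊆ ((F ×ˢ F).image fun q : ℤ × ℤ => a ^ q.1 * t ^ q.2 : Finset G) := by
    intro g hg
    obtain ⟨i, j, hi, hj, he⟩ := main n g hg
    rw [Finset.mem_coe, Finset.mem_image]
    refine ⟨(i, j), ?_, he.symm⟩
    simp only [F, Finset.mem_product, Finset.mem_Icc]
    omega
  refine (Set.ncard_le_ncard hsub (Finset.finite_toSet _)).trans ?_
  rw [Set.ncard_coe_finset]
  refine Finset.card_image_le.trans ?_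
  rw [Finset.card_product, hF, pow_two]

lemma nf_of_gen {a t : G} (hgen : Subgroup.closure {a, t} = ⊤) (h : t * a * t⁻¹ = a⁻¹) (g : G) :
    ∃ i j : ℤ, g = a ^ i * t ^ j := by
  have hg : g ∈ Subgroup.closure {a, t} := by rw [hgen]; trivial
  have h' : t⁻¹ * a * t = a⁻¹ := by
    have := congrArg (fun x => t⁻¹ * x⁻¹ * t) h
    simp only [inv_inv] at this
    rw [← this]; group
  have ht : ∀ j : ℤ, t ^ j * a * (t ^ j)⁻¹ = a ∨ t ^ j * a * (t ^ j)⁻¹ = a⁻¹ := by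
    intro j
    induction j using Int.induction_on with
    | zero => left; simp
    | succ n ih =>
      have e : t ^ ((n : ℤ) + 1) * a * (t ^ ((n : ℤ) + 1))⁻¹ = (t ^ (n : ℤ) * a * (t ^ (n : ℤ))⁻¹)⁻¹ := by
        rw [zpow_add_one]
        calc _ = t ^ (n : ℤ) * (t * a * t⁻¹) * (t ^ (n : ℤ))⁻¹ := by group
          _ = _ := by rw [h]; group
      rw [e]
      rcases ih with ih | ih <;> rw [ih] <;> simp
    | pred n ih =>
      have e : t ^ (-(n : ℤ) - 1) * a * (t ^ (-(n : ℤ) - 1))⁻¹ = (t ^ (-(n : ℤ)) * a * (t ^ (-(n : ℤ)))⁻¹)⁻¹ := by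
        rw [zpow_sub_one]
        calc _ = t ^ (-(n : ℤ)) * (t⁻¹ * a * t) * (t ^ (-(n : ℤ)))⁻¹ := by group
          _ = _ := by rw [h']; group
      rw [e]
      rcases ih with ih | ih <;> rw [ih] <;> simp
  induction hg using Subgroup.closure_induction with
  | mem x hx =>
    rcases hx with rfl | hx
    · exact ⟨1, 0, by simp⟩
    · rw [Set.mem_singleton_iff] at hx
      exact ⟨0, 1, by simp [hx]⟩
  | one => exact ⟨0, 0, by simp⟩
  | mul x y _ _ hx hy =>
    obtain ⟨i, j, rfl⟩ := hx
    obtain ⟨k, l, rfl⟩ := hy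
    obtain ⟨e, -, he⟩ := conj_pm_zpow (ht j) k
    refine ⟨i + e * k, j + l, ?_⟩
    calc _ = a ^ i * (t ^ j * a ^ k) * t ^ l := by group
      _ = _ := by rw [he, zpow_add, zpow_add]; group
  | inv x _ hx =>
    obtain ⟨i, j, rfl⟩ := hx
    obtain ⟨e, -, he⟩ := conj_pm_zpow (ht (-j)) (-i)
    refine ⟨e * (-i), -j, ?_⟩
    rw [← he]; group

/-- identification of the group from its normal form -/
theorem classify (hχ : IsHomZ χ) {a t : G} (ha : χ a = 0) (ht : χ t = 1)
    (hconj : ∀ g, g * a * g⁻¹ = a ∨ g * a * g⁻¹ = a⁻¹)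
    (hcyc : ∀ x, χ x = 0 → ∃ i : ℤ, x = a ^ i) (htf : a ≠ 1 → ∀ n : ℤ, a ^ n = 1 → n = 0) :
    Nonempty (G ≃* Multiplicative ℤ) ∨ Nonempty (G ≃* Multiplicative (ℤ × ℤ)) ∨
      Nonempty (G ≃* KleinBottleGroup) := by
  have hnf : ∀ g, ∃ i j : ℤ, g = a ^ i * t ^ j := by
    intro g
    obtain ⟨i, hi⟩ := hcyc (g * t ^ (-χ g)) (by rw [hχ, hχ.zpow, ht]; simp)
    exact ⟨i, χ g, by rw [← hi]; group⟩
  have hval : ∀ i j : ℤ, χ (a ^ i * t ^ j) = j := fun i j => by rw [hχ, hχ.zpow, hχ.zpow, ha, ht]; ring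
  by_cases ha1 : a = 1
  · left
    let f : G →* Multiplicative ℤ := MonoidHom.mk' (fun g => Multiplicative.ofAdd (χ g)) (fun x y => by
      rw [hχ]; rfl)
    refine ⟨MulEquiv.ofBijective f ⟨?_, ?_⟩⟩
    · rw [injective_iff_map_eq_one]
      intro g hg
      obtain ⟨i, hi⟩ := hcyc g (Multiplicative.ofAdd.injective hg)
      rw [hi, ha1, one_zpow]
    · intro z
      refine ⟨t ^ z.toAdd, ?_⟩
      change Multiplicative.ofAdd (χ (t ^ z.toAdd)) = z
      rw [hχ.zpow, ht, mul_one]; rfl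
  right
  have inj : ∀ i j : ℤ, a ^ i * t ^ j = 1 → i = 0 ∧ j = 0 := by
    intro i j h
    have h1 := hval i j
    rw [h, hχ.one] at h1
    subst h1
    exact ⟨htf ha1 i (by simpa using h), rfl⟩
  rcases hconj t with h | h
  · left
    have hc : Commute a t := by
      rw [mul_inv_eq_iff_eq_mul] at h
      exact h.symm
    let f : Multiplicative (ℤ × ℤ) →* G := MonoidHom.mk' (fun z => a ^ z.toAdd.1 * t ^ z.toAdd.2) (fun x y => by
      rw [toAdd_mul, Prod.fst_add, Prod.snd_add, zpow_add, zpow_add, mul_assoc, mul_assoc, ← mul_assoc (a ^ y.toAdd.1),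
        ((hc.zpow_zpow y.toAdd.1 x.toAdd.2)).eq, mul_assoc])
    refine ⟨(MulEquiv.ofBijective f ⟨?_, ?_⟩).symm⟩
    · rw [injective_iff_map_eq_one]
      intro z hz
      obtain ⟨h1, h2⟩ := inj _ _ hz
      exact Multiplicative.toAdd.injective (Prod.ext h1 h2)
    · intro g
      obtain ⟨i, j, rfl⟩ := hnf g
      exact ⟨Multiplicative.ofAdd (i, j), rfl⟩
  · right
    let φ : Fin 2 → G := ![a, t]
    have hrel : ∀ r ∈ kleinBottleRels, FreeGroup.lift φ r = 1 := by
      intro r hr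
      rw [kleinBottleRels, Set.mem_singleton_iff] at hr
      subst hr
      simp only [map_mul, map_inv, FreeGroup.lift_apply_of]
      change t * a * t⁻¹ * a = 1
      rw [h, inv_mul_cancel]
    let f : KleinBottleGroup →* G := PresentedGroup.toGroup hrel
    have hfa : f (PresentedGroup.of 0) = a := PresentedGroup.toGroup.of hrel
    have hft : f (PresentedGroup.of 1) = t := PresentedGroup.toGroup.of hrel
    refine ⟨(MulEquiv.ofBijective f ⟨?_, ?_⟩).symm⟩
    · rw [injective_iff_map_eq_one]
      intro z hz
      have hcl : Subgroup.closure {(PresentedGroup.of 0 : KleinBottleGroup), PresentedGroup.of 1} = ⊤ := by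
        rw [← PresentedGroup.closure_range_of]
        congr 1
        ext x
        simp [eq_comm]
      have hr : (PresentedGroup.of 1 : KleinBottleGroup) * PresentedGroup.of 0 * (PresentedGroup.of 1)⁻¹ =
          (PresentedGroup.of 0)⁻¹ := by
        rw [← mul_eq_one_iff_eq_inv]
        exact PresentedGroup.one_of_mem (rels := kleinBottleRels) (Set.mem_singleton _)
      obtain ⟨i, j, rfl⟩ := nf_of_gen hcl hr z
      rw [map_mul, map_zpow, map_zpow, hfa, hft] at hz
      obtain ⟨rfl, rfl⟩ := inj _ _ hz
      simp
    · intro g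
      obtain ⟨i, j, rfl⟩ := hnf g
      exact ⟨PresentedGroup.of 0 ^ i * PresentedGroup.of 1 ^ j, by rw [map_mul, map_zpow, map_zpow, hfa, hft]⟩
end
end GW

/-- If `G` is a finitely presented group possessing a finite generating set
`S` with `ω(G,S) < 2^(1/4)`, then either `G` has deficiency at most 0 (it admits no
finite presentation with strictly more generators than relators), or `G` is `ℤ`,
`ℤ × ℤ`, or the Klein bottle group, in which case `ω(G,S) = 1`. -/
theorem statement17 {G : Type*} [Group G] (hfp : IsFinitelyPresented G)
    (S : Finset G) (hgen : Subgroup.closure (S : Set G) = ⊤)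
    (hS : growthRate S < (2 : ℝ) ^ ((1 : ℝ) / 4)) :
    (¬ ∃ (n : ℕ) (rels : Finset (FreeGroup (Fin n))), rels.card < n ∧
        Nonempty (G ≃* PresentedGroup (rels : Set (FreeGroup (Fin n))))) ∨
    ((Nonempty (G ≃* Multiplicative ℤ) ∨ Nonempty (G ≃* Multiplicative (ℤ × ℤ)) ∨
      Nonempty (G ≃* KleinBottleGroup)) ∧ growthRate S = 1) := by
  by_cases hdef : ∃ (n : ℕ) (rels : Finset (FreeGroup (Fin n))), rels.card < n ∧
        Nonempty (G ≃* PresentedGroup (rels : Set (FreeGroup (Fin n))))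
  swap
  · exact Or.inl hdef
  right
  obtain ⟨n, rels, hcard, ⟨e⟩⟩ := hdef
  obtain ⟨χ, hχ, t, ht⟩ := GW.exists_chi hcard e
  let N : Subgroup G :=
    { carrier := {g | χ g = 0}
      mul_mem' := fun {x y} (hx : χ x = 0) (hy : χ y = 0) => by
        change χ (x * y) = 0
        rw [hχ, hx, hy]; rfl
      one_mem' := hχ.one
      inv_mem' := fun {x} (hx : χ x = 0) => by
        change χ x⁻¹ = 0
        rw [hχ.inv, hx]; rfl }
  have hN : ∀ g, g ∈ N ↔ χ g = 0 := fun g => Iff.rfl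
  have hA : ∀ g ∈ wordBall S 4, ∀ h ∈ wordBall S 4, ¬ Function.Injective (GW.ev g h) := fun g hg h hh hi =>
    absurd (GW.growth_ge hg hh hi) (not_le.2 hS)
  have hfg : N.FG := GW.ker_fg hχ hgen hA ht hN
  have hcd : GW.CD1 N := GW.cd1_of_pres hcard e hχ hN hfg ht
  obtain ⟨a, ha, hcyc⟩ := GW.ker_cyclic hcd hfg (GW.ker_comm hcd hχ hgen hA hN)
  have hconj := GW.conj_pm hcd hχ hN ha hcyc
  refine ⟨GW.classify hχ ha ht hconj hcyc (fun h1 n hn => ?_), GW.growth_nf (a := a) (t := t) hconj fun g => ?_⟩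
  · by_contra h0
    exact GW.zpow_ne hcd ha h1 h0 hn
  · obtain ⟨i, hi⟩ := hcyc (g * t ^ (-χ g)) (by rw [hN, hχ, hχ.zpow, ht]; simp)
    exact ⟨i, χ g, by rw [← hi]; group⟩
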